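/- Let Ω ⊂ ℝⁿ be a bounded domain, p > 1, and suppose the unweighted Poincaré inequality ∫_Ω |u − u_Ω|^p dx ≤ C ∫_Ω |∇u|^p dx holds for all u ∈ W^{1,p}(Ω) (i.e. (P_{p,a,b}) with a = 0, b = p... with a = 0 and b = p the hypothesis reads ∫_Ω |u − u_Ω|^p dx ≤ C ∫_Ω |∇u|^p ρ^p dx). Then the classical Korn inequality (K_p) holds: there exists C' > 0 such that ∫_Ω |Dv|^p dx ≤ C' { ∫_Ω |ε(v)|^p dx + ∫_Ω |v|^p dx } for every v ∈ W^{1,p}(Ω)ⁿ. -/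

import Mathlib

open MeasureTheory Set Filter
open scoped ENNReal NNReal Topology

noncomputable section

abbrev Evec (n : ℕ) := EuclideanSpace ℝ (Fin n)

/-- `ρ(x) = dist(x, ∂Ω)`, the distance to the boundary of `Ω`. -/
def bdist {n : ℕ} (Ω : Set (Evec n)) (x : Evec n) : ℝ := Metric.infDist x (frontier Ω)

/-- A bounded domain: open, connected and bounded. -/
def IsBoundedDomain {n : ℕ} (Ω : Set (Evec n)) : Prop :=
  IsOpen Ω ∧ IsConnected Ω ∧ Bornology.IsBounded Ω

/-- A closed cube in `ℝⁿ`. -/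
def IsClosedCube {n : ℕ} (Q : Set (Evec n)) : Prop :=
  ∃ (c : Evec n) (r : ℝ), 0 < r ∧ Q = {x : Evec n | ∀ i, |x i - c i| ≤ r}

/-- The weighted `p`-energy `∫_S |g(x)|^p ρ(x)^a dx`, where `ρ` is the distance
to the boundary of `Ω`. -/
def wIp {n : ℕ} (Ω S : Set (Evec n)) (p a : ℝ) (g : Evec n → ℝ) : ℝ≥0∞ :=
  ∫⁻ x in S, ENNReal.ofReal (|g x| ^ p * bdist Ω x ^ a)

/-- The weighted `L^p(S, ρ^a)` norm `(∫_S |g(x)|^p ρ(x)^a dx)^{1/p}`. -/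
def wLp {n : ℕ} (Ω S : Set (Evec n)) (p a : ℝ) (g : Evec n → ℝ) : ℝ≥0∞ :=
  wIp Ω S p a g ^ (1 / p)

/-- The weighted average `u_{Ω,a} = (∫_Ω ρ^a)⁻¹ ∫_Ω u ρ^a`. -/
def wAvg {n : ℕ} (Ω : Set (Evec n)) (a : ℝ) (u : Evec n → ℝ) : ℝ :=
  (∫ x in Ω, bdist Ω x ^ a)⁻¹ * ∫ x in Ω, u x * bdist Ω x ^ a

/-- `|∇u(x)|` for a scalar function `u`. -/
def gradLen {n : ℕ} (u : Evec n → ℝ) (x : Evec n) : ℝ := ‖fderiv ℝ u x‖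

/-- The entry `∂v_i/∂x_j (x)` of the gradient matrix `Dv`. -/
def pder {n : ℕ} (v : Evec n → Evec n) (i j : Fin n) (x : Evec n) : ℝ :=
  fderiv ℝ v x (EuclideanSpace.single j 1) i

/-- `|Dv(x)|`, the (Frobenius) norm of the gradient matrix of a vector field `v`. -/
def DvLen {n : ℕ} (v : Evec n → Evec n) (x : Evec n) : ℝ :=
  Real.sqrt (∑ i, ∑ j, pder v i j x ^ 2)

/-- `|ε(v)(x)|`, the norm of the symmetric part `ε_{ij}(v) = (∂v_i/∂x_j + ∂v_j/∂x_i)/2`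
of the gradient matrix. -/
def epsLen {n : ℕ} (v : Evec n → Evec n) (x : Evec n) : ℝ :=
  Real.sqrt (∑ i, ∑ j, ((pder v i j x + pder v j i x) / 2) ^ 2)

/-- `u ∈ W^{1,p}(Ω, ρ^a, ρ^b)` (scalar case). -/
def MemW1 {n : ℕ} (Ω : Set (Evec n)) (p a b : ℝ) (u : Evec n → ℝ) : Prop :=
  DifferentiableOn ℝ u Ω ∧ wIp Ω Ω p a u < ⊤ ∧ wIp Ω Ω p b (gradLen u) < ⊤

/-- `v ∈ W^{1,p}(Ω, ρ^a, ρ^b)ⁿ` (vector case). -/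
def MemW1Vec {n : ℕ} (Ω : Set (Evec n)) (p a b : ℝ) (v : Evec n → Evec n) : Prop :=
  DifferentiableOn ℝ v Ω ∧ wIp Ω Ω p a (fun x => ‖v x‖) < ⊤ ∧ wIp Ω Ω p b (DvLen v) < ⊤

/-- The weighted Poincaré inequality `(P_{p,a,b})`: there is `C > 0` such that
`∫_Ω |u - u_{Ω,a}|^p ρ^a ≤ C ∫_Ω |∇u|^p ρ^b` for all `u ∈ W^{1,p}(Ω,ρ^a,ρ^b)`. -/
def PoincareIneq {n : ℕ} (Ω : Set (Evec n)) (p a b : ℝ) : Prop :=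
  ∃ C > 0, ∀ u : Evec n → ℝ, MemW1 Ω p a b u →
    wIp Ω Ω p a (fun x => u x - wAvg Ω a u) ≤ ENNReal.ofReal C * wIp Ω Ω p b (gradLen u)

open scoped ContDiff Convolution

/-- The convolution `x ↦ ∫ f(y) K(x - y) dy` of `f` with a kernel `K`. -/
def cv {n : ℕ} (K f : Evec n → ℝ) (x : Evec n) : ℝ := ∫ y, f y * K (x - y)

/-- The partial derivative in the `l`-th coordinate direction. -/
def pd {n : ℕ} (l : Fin n) (F : Evec n → ℝ) (x : Evec n) : ℝ :=
  fderiv ℝ F x (EuclideanSpace.single l 1)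

lemma cv_eq_convolution {n : ℕ} (K f : Evec n → ℝ) :
    cv K f = f ⋆[ContinuousLinearMap.mul ℝ ℝ, volume] K := rfl

lemma pd_contDiff {n : ℕ} {F : Evec n → ℝ} (hF : ContDiff ℝ ∞ F) (l : Fin n) :
    ContDiff ℝ ∞ (pd l F) :=
  (hF.fderiv_right (by simp)).clm_apply contDiff_const

lemma pd_hasCompactSupport {n : ℕ} {F : Evec n → ℝ} (hF : HasCompactSupport F) (l : Fin n) :
    HasCompactSupport (pd l F) := hF.fderiv_apply ℝ _

lemma pd_comm {n : ℕ} {F : Evec n → ℝ} (hF : ContDiff ℝ ∞ F) (j l : Fin n) :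
    pd j (pd l F) = pd l (pd j F) := by
  ext x
  have h1 : DifferentiableAt ℝ (fderiv ℝ F) x :=
    ((hF.fderiv_right (m := ∞) (by simp)).differentiable (by simp)) x
  have h2 := (hF.contDiffAt (x := x)).isSymmSndFDerivAt
    (by simpa using WithTop.coe_le_coe.2 (le_top : (2 : ℕ∞) ≤ ⊤))
  have key : ∀ a b : Fin n, pd a (pd b F) x =
      fderiv ℝ (fderiv ℝ F) x (EuclideanSpace.single a 1) (EuclideanSpace.single b 1) := by
    intro a b
    unfold pd
    rw [fderiv_clm_apply h1 (differentiableAt_const _)]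
    simp
  rw [key, key]
  exact h2 _ _

lemma cv_contDiff {n : ℕ} {K f : Evec n → ℝ} (hK : ContDiff ℝ ∞ K) (hc : HasCompactSupport K)
    (hf : LocallyIntegrable f) : ContDiff ℝ ∞ (cv K f) := by
  rw [cv_eq_convolution]
  exact hc.contDiff_convolution_right _ hf hK

lemma pd_cv {n : ℕ} {K f : Evec n → ℝ} (hK : ContDiff ℝ ∞ K) (hc : HasCompactSupport K)
    (hf : LocallyIntegrable f) (l : Fin n) : pd l (cv K f) = cv (pd l K) f := by
  ext x
  have h := hc.hasFDerivAt_convolution_right (ContinuousLinearMap.mul ℝ ℝ) hf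
    (hK.of_le (by simp)) x
  unfold pd
  rw [cv_eq_convolution, h.fderiv, convolution_precompR_apply _ hf (hc.fderiv ℝ)
    (hK.continuous_fderiv (by simp))]
  rfl

lemma cv_integrable {n : ℕ} {K f : Evec n → ℝ} (hK : Continuous K) (hc : HasCompactSupport K)
    (hf : LocallyIntegrable f) (x : Evec n) : Integrable fun y => f y * K (x - y) := by
  have h := hc.convolutionExists_right (μ := volume) (ContinuousLinearMap.mul ℝ ℝ) hf hK x
  exact h

lemma enorm_cv_le {n : ℕ} (K f : Evec n → ℝ) (x : Evec n) :
    ‖cv K f x‖ₑ ≤ ∫⁻ y, ‖K (x - y)‖ₑ * ‖f y‖ₑ := by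
  refine (enorm_integral_le_lintegral_enorm _).trans_eq (lintegral_congr fun y => ?_)
  rw [enorm_mul, mul_comm]

lemma cv_add {n : ℕ} {K f g : Evec n → ℝ} (hK : Continuous K) (hc : HasCompactSupport K)
    (hf : LocallyIntegrable f) (hg : LocallyIntegrable g) (x : Evec n) :
    cv K (fun y => f y + g y) x = cv K f x + cv K g x := by
  unfold cv
  rw [← integral_add (cv_integrable hK hc hf x) (cv_integrable hK hc hg x)]
  simp only [add_mul]

lemma cv_sub {n : ℕ} {K f g : Evec n → ℝ} (hK : Continuous K) (hc : HasCompactSupport K)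
    (hf : LocallyIntegrable f) (hg : LocallyIntegrable g) (x : Evec n) :
    cv K (fun y => f y - g y) x = cv K f x - cv K g x := by
  unfold cv
  rw [← integral_sub (cv_integrable hK hc hf x) (cv_integrable hK hc hg x)]
  simp only [sub_mul]

lemma cv_kernel_sub {n : ℕ} {K L f : Evec n → ℝ} (hK : Continuous K) (hc : HasCompactSupport K)
    (hL : Continuous L) (hcL : HasCompactSupport L)
    (hf : LocallyIntegrable f) (x : Evec n) :
    cv (fun y => K y - L y) f x = cv K f x - cv L f x := by
  unfold cv
  rw [← integral_sub (cv_integrable hK hc hf x) (cv_integrable hL hcL hf x)]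
  simp only [mul_sub]

/-- **Young's inequality** for the convolution of an `L¹` and an `L^p` function. -/
lemma lintegral_cv_rpow_le {n : ℕ} {K f : Evec n → ℝ} (hK : Measurable K)
    (hf : AEMeasurable f) {p : ℝ} (hp : 1 < p) :
    ∫⁻ x, ‖cv K f x‖ₑ ^ p ≤ (∫⁻ x, ‖K x‖ₑ) ^ p * ∫⁻ x, ‖f x‖ₑ ^ p := by
  have hp0 : 0 < p := by linarith
  have hKx : ∀ x : Evec n, AEMeasurable (fun y => ‖K (x - y)‖ₑ) := fun x =>
    (hK.comp (measurable_const.sub measurable_id)).enorm.aemeasurable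
  have hK1 : ∀ x : Evec n, ∫⁻ y, ‖K (x - y)‖ₑ = ∫⁻ y, ‖K y‖ₑ := fun x =>
    lintegral_sub_left_eq_self (fun y => ‖K y‖ₑ) x
  have pt : ∀ x, ‖cv K f x‖ₑ ^ p ≤
      (∫⁻ x, ‖K x‖ₑ) ^ (p - 1) * ∫⁻ y, ‖K (x - y)‖ₑ * ‖f y‖ₑ ^ p := by
    intro x
    have h := ENNReal.lintegral_mul_norm_pow_le (μ := (volume : Measure (Evec n)))
      (p := 1 / p) (q := 1 - 1 / p)
      (f := fun y => ‖K (x - y)‖ₑ * ‖f y‖ₑ ^ p) (g := fun y => ‖K (x - y)‖ₑ)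
      ((hKx x).mul (hf.enorm.pow_const p)) (hKx x) (by positivity)
      (by rw [sub_nonneg, div_le_one hp0]; exact hp.le) (by ring)
    have e : ∀ y, (‖K (x - y)‖ₑ * ‖f y‖ₑ ^ p) ^ (1 / p) * ‖K (x - y)‖ₑ ^ (1 - 1 / p)
        = ‖K (x - y)‖ₑ * ‖f y‖ₑ := by
      intro y
      rw [ENNReal.mul_rpow_of_nonneg _ _ (by positivity), ← ENNReal.rpow_mul,
        mul_one_div_cancel hp0.ne', ENNReal.rpow_one, mul_right_comm,
        ← ENNReal.rpow_add_of_nonneg _ _ (by positivity)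
          (by rw [sub_nonneg, div_le_one hp0]; exact hp.le)]
      simp
    simp only [e] at h
    rw [hK1] at h
    calc ‖cv K f x‖ₑ ^ p ≤ (∫⁻ y, ‖K (x - y)‖ₑ * ‖f y‖ₑ) ^ p :=
          ENNReal.rpow_le_rpow (enorm_cv_le K f x) hp0.le
      _ ≤ _ := ENNReal.rpow_le_rpow h hp0.le
      _ = _ := by
          rw [ENNReal.mul_rpow_of_nonneg _ _ hp0.le, ← ENNReal.rpow_mul, ← ENNReal.rpow_mul,
            one_div_mul_cancel hp0.ne', ENNReal.rpow_one, mul_comm]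
          congr 2
          field_simp
  calc ∫⁻ x, ‖cv K f x‖ₑ ^ p
      ≤ ∫⁻ x, (∫⁻ x, ‖K x‖ₑ) ^ (p - 1) * ∫⁻ y, ‖K (x - y)‖ₑ * ‖f y‖ₑ ^ p := lintegral_mono pt
    _ = (∫⁻ x, ‖K x‖ₑ) ^ (p - 1) * ∫⁻ y, (∫⁻ x, ‖K x‖ₑ) * ‖f y‖ₑ ^ p := by
        have hm : AEMeasurable (fun z : Evec n × Evec n => ‖K (z.1 - z.2)‖ₑ * ‖f z.2‖ₑ ^ p)
            (volume.prod volume) :=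
          (hK.comp (measurable_fst.sub measurable_snd)).enorm.aemeasurable.mul
            ((hf.enorm.pow_const p).comp_snd)
        rw [lintegral_const_mul'', lintegral_lintegral_swap hm]
        · congr 1
          refine lintegral_congr fun y => ?_
          rw [lintegral_mul_const'', lintegral_sub_right_eq_self (fun x => ‖K x‖ₑ) y]
          exact (hK.comp (measurable_id.sub measurable_const)).enorm.aemeasurable
        · exact hm.lintegral_prod_right'
    _ = _ := by
        rw [lintegral_const_mul'' _ (hf.enorm.pow_const p), ← mul_assoc]
        congr 1
        nth_rw 2 [← ENNReal.rpow_one (∫⁻ x, ‖K x‖ₑ)]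
        rw [← ENNReal.rpow_add_of_nonneg _ _ (by linarith) zero_le_one]
        simp

lemma cv_continuous {n : ℕ} {K f : Evec n → ℝ} (hK : Continuous K) (hc : HasCompactSupport K)
    (hf : LocallyIntegrable f) : Continuous (cv K f) := by
  rw [cv_eq_convolution]
  exact hc.continuous_convolution_right _ hf hK

lemma cv_hasCompactSupport {n : ℕ} {K f : Evec n → ℝ} (hc : HasCompactSupport K)
    (hf : HasCompactSupport f) : HasCompactSupport (cv K f) := by
  rw [cv_eq_convolution]
  exact hf.convolution _ hc

lemma eLpNorm_ofReal {n : ℕ} (f : Evec n → ℝ) {p : ℝ} (hp : 0 < p) :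
    eLpNorm f (ENNReal.ofReal p) = (∫⁻ x, ‖f x‖ₑ ^ p) ^ (1 / p) := by
  rw [eLpNorm_eq_lintegral_rpow_enorm_toReal (by simpa using hp) ENNReal.ofReal_ne_top,
    ENNReal.toReal_ofReal hp.le]

lemma eLpNorm_le_iff_lintegral {n : ℕ} (f g : Evec n → ℝ) {p : ℝ} (hp : 0 < p) (A : ℝ≥0∞) :
    eLpNorm f (ENNReal.ofReal p) ≤ A * eLpNorm g (ENNReal.ofReal p) ↔
      ∫⁻ x, ‖f x‖ₑ ^ p ≤ A ^ p * ∫⁻ x, ‖g x‖ₑ ^ p := by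
  rw [eLpNorm_ofReal f hp, eLpNorm_ofReal g hp, one_div, ENNReal.rpow_inv_le_iff hp,
    ENNReal.mul_rpow_of_nonneg _ _ hp.le, ← ENNReal.rpow_mul, inv_mul_cancel₀ hp.ne',
    ENNReal.rpow_one]

lemma integral_mul_pd {n : ℕ} {F G : Evec n → ℝ} (hF : ContDiff ℝ ∞ F) (hG : ContDiff ℝ ∞ G)
    (hc : HasCompactSupport F) (j : Fin n) :
    ∫ x, F x * pd j G x = - ∫ x, pd j F x * G x := by
  have h1 := pd_contDiff hF j
  have h2 := pd_contDiff hG j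
  refine integral_mul_fderiv_eq_neg_fderiv_mul_of_integrable ?_ ?_ ?_
    (fun x _ => hF.differentiable (by simp) x) (fun x _ => hG.differentiable (by simp) x)
  · exact (h1.continuous.mul hG.continuous).integrable_of_hasCompactSupport
      ((pd_hasCompactSupport hc j).mul_right)
  · exact (hF.continuous.mul h2.continuous).integrable_of_hasCompactSupport hc.mul_right
  · exact (hF.continuous.mul hG.continuous).integrable_of_hasCompactSupport hc.mul_right

lemma integral_pd_mul_pd_comm {n : ℕ} {F G : Evec n → ℝ} (hF : ContDiff ℝ ∞ F)
    (hG : ContDiff ℝ ∞ G) (hc : HasCompactSupport F) (j l : Fin n) :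
    ∫ x, pd j F x * pd l G x = ∫ x, pd l F x * pd j G x := by
  have h1 := integral_mul_pd hF (pd_contDiff hG l) hc j
  have h2 := integral_mul_pd hF (pd_contDiff hG j) hc l
  rw [pd_comm hG j l] at h1
  linarith

lemma enorm_rpow_two (x : ℝ) : ‖x‖ₑ ^ (2 : ℝ) = ENNReal.ofReal (x ^ 2) := by
  rw [Real.enorm_eq_ofReal_abs, ENNReal.ofReal_rpow_of_nonneg (abs_nonneg _) (by norm_num)]
  norm_cast
  rw [sq_abs]

/-- The `L²` bound for the derivatives of a curl-free kernel, in terms of its divergence. -/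
lemma lintegral_cv_pd_sq_le {n : ℕ} {D : Fin n → Evec n → ℝ} (hD : ∀ l, ContDiff ℝ ∞ (D l))
    (hc : ∀ l, HasCompactSupport (D l)) (hcurl : ∀ j l, pd j (D l) = pd l (D j))
    {f : Evec n → ℝ} (hf : Continuous f) (hfc : HasCompactSupport f) (j l : Fin n) :
    ∫⁻ x, ‖cv (pd j (D l)) f x‖ₑ ^ (2 : ℝ) ≤
      (∫⁻ x, ‖∑ l, pd l (D l) x‖ₑ) ^ (2 : ℝ) * ∫⁻ x, ‖f x‖ₑ ^ (2 : ℝ) := by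
  have hfl : LocallyIntegrable f := hf.locallyIntegrable
  set F : Fin n → Evec n → ℝ := fun l => cv (D l) f with hFdef
  have hF : ∀ l, ContDiff ℝ ∞ (F l) := fun l => cv_contDiff (hD l) (hc l) hfl
  have hFc : ∀ l, HasCompactSupport (F l) := fun l => cv_hasCompactSupport (hc l) hfc
  have hpF : ∀ j l, pd j (F l) = cv (pd j (D l)) f := fun j l => pd_cv (hD l) (hc l) hfl j
  have hint : ∀ a b a' b', Integrable (fun x => pd a (F b) x * pd a' (F b') x) := fun a b a' b' =>
    ((pd_contDiff (hF b) a).continuous.mul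
      (pd_contDiff (hF b') a').continuous).integrable_of_hasCompactSupport
      ((pd_hasCompactSupport (hFc b) a).mul_right)
  have hdiv : ∀ x, ∑ l, pd l (F l) x = cv (fun y => ∑ l, pd l (D l) y) f x := by
    intro x
    simp only [hpF]
    unfold cv
    rw [← integral_finsetSum]
    · simp only [Finset.mul_sum]
    · exact fun i _ => cv_integrable (pd_contDiff (hD i) i).continuous
        (pd_hasCompactSupport (hc i) i) hfl x
  have key : ∫ x, pd j (F l) x ^ 2 ≤ ∫ x, (∑ l, pd l (F l) x) ^ 2 := by
    calc ∫ x, pd j (F l) x ^ 2 ≤ ∑ a, ∑ b, ∫ x, pd a (F b) x * pd a (F b) x := by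
          refine le_trans (le_of_eq ?_) (le_trans (Finset.single_le_sum
            (f := fun b => ∫ x, pd j (F b) x * pd j (F b) x) (fun b _ => ?_)
            (Finset.mem_univ l)) (Finset.single_le_sum
            (f := fun a => ∑ b, ∫ x, pd a (F b) x * pd a (F b) x) (fun a _ => ?_)
            (Finset.mem_univ j)))
          · simp only [sq]
          · exact integral_nonneg fun x => mul_self_nonneg _
          · exact Finset.sum_nonneg fun b _ => integral_nonneg fun x => mul_self_nonneg _
      _ = ∑ a, ∑ b, ∫ x, pd a (F a) x * pd b (F b) x := by
          refine Finset.sum_congr rfl fun a _ => Finset.sum_congr rfl fun b _ => ?_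
          have : pd a (F b) = pd b (F a) := by rw [hpF, hpF, hcurl]
          rw [integral_pd_mul_pd_comm (hF a) (hF b) (hFc a) a b, ← this]
      _ = ∫ x, (∑ l, pd l (F l) x) ^ 2 := by
          simp only [sq, Finset.sum_mul_sum]
          rw [integral_finsetSum _ fun a _ => integrable_finsetSum _ fun b _ => hint a a b b]
          refine Finset.sum_congr rfl fun a _ => ?_
          rw [integral_finsetSum _ fun b _ => hint a a b b]
  have hi1 : Integrable (fun x => pd j (F l) x ^ 2) := by simpa only [sq] using hint j l j l
  have hi2 : Integrable (fun x => (∑ l, pd l (F l) x) ^ 2) := by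
    simp only [sq, Finset.sum_mul_sum]
    exact integrable_finsetSum _ fun a _ => integrable_finsetSum _ fun b _ => hint a a b b
  calc ∫⁻ x, ‖cv (pd j (D l)) f x‖ₑ ^ (2 : ℝ) = ENNReal.ofReal (∫ x, pd j (F l) x ^ 2) := by
        rw [ofReal_integral_eq_lintegral_ofReal hi1 (ae_of_all _ fun x => sq_nonneg _)]
        simp only [enorm_rpow_two, hpF]
    _ ≤ ENNReal.ofReal (∫ x, (∑ l, pd l (F l) x) ^ 2) := ENNReal.ofReal_le_ofReal key
    _ = ∫⁻ x, ‖cv (fun y => ∑ l, pd l (D l) y) f x‖ₑ ^ (2 : ℝ) := by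
        rw [ofReal_integral_eq_lintegral_ofReal hi2 (ae_of_all _ fun x => sq_nonneg _)]
        simp only [enorm_rpow_two, hdiv]
    _ ≤ _ := by
        refine lintegral_cv_rpow_le ?_ hf.aemeasurable (by norm_num)
        exact (continuous_finsetSum _ fun l _ => (pd_contDiff (hD l) l).continuous).measurable

/-- An `L^p` bound for convolution operators extends from `C_c` to `L^p`. -/
lemma lintegral_cv_le_of_continuous {n : ℕ} {K : Evec n → ℝ} (hK : Continuous K)
    (hc : HasCompactSupport K) {p : ℝ} (hp : 1 < p) {A : ℝ≥0∞} (hA : A ≠ ⊤)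
    (H : ∀ f : Evec n → ℝ, Continuous f → HasCompactSupport f →
      ∫⁻ x, ‖cv K f x‖ₑ ^ p ≤ A ^ p * ∫⁻ x, ‖f x‖ₑ ^ p)
    {f : Evec n → ℝ} (hf : MemLp f (ENNReal.ofReal p)) :
    ∫⁻ x, ‖cv K f x‖ₑ ^ p ≤ A ^ p * ∫⁻ x, ‖f x‖ₑ ^ p := by
  have hp0 : 0 < p := by linarith
  have h1p : (1 : ℝ≥0∞) ≤ ENNReal.ofReal p := by simpa using hp.le
  have hfl : LocallyIntegrable f := hf.locallyIntegrable h1p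
  rw [← eLpNorm_le_iff_lintegral (cv K f) f hp0]
  obtain ⟨B, hBdef⟩ : ∃ B : ℝ≥0∞, B = ∫⁻ x, ‖K x‖ₑ := ⟨_, rfl⟩
  have hB : B ≠ ⊤ := hBdef ▸ (hK.integrable_of_hasCompactSupport hc).2.ne
  refine ENNReal.le_of_forall_pos_le_add fun ε hε _ => ?_
  obtain ⟨δ, hδdef⟩ : ∃ δ : ℝ≥0∞, δ = ε / (A + B + 1) := ⟨_, rfl⟩
  have hAB : A + B + 1 ≠ ⊤ := by finiteness
  have hδ : δ ≠ 0 := by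
    simp only [hδdef, ne_eq, ENNReal.div_eq_zero_iff, ENNReal.coe_eq_zero, not_or]
    exact ⟨hε.ne', hAB⟩
  obtain ⟨g, hgc, hfg, hgcont, hgm⟩ :=
    hf.exists_hasCompactSupport_eLpNorm_sub_le ENNReal.ofReal_ne_top hδ
  have hgl : LocallyIntegrable g := hgcont.locallyIntegrable
  have e : cv K f = cv K g + cv K (f - g) := by
    ext x
    have := cv_sub hK hc hfl hgl x
    simp only [Pi.add_apply]
    rw [show cv K (f - g) x = cv K (fun y => f y - g y) x from rfl, this]; ring
  have hgn : eLpNorm g (ENNReal.ofReal p) ≤ eLpNorm f (ENNReal.ofReal p) + δ := by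
    have h3 := eLpNorm_sub_le hf.1 (hf.1.sub hgm.1) h1p
    rw [sub_sub_cancel] at h3
    exact h3.trans (add_le_add le_rfl hfg)
  have s1 : eLpNorm (cv K f) (ENNReal.ofReal p)
      ≤ eLpNorm (cv K g) (ENNReal.ofReal p) + eLpNorm (cv K (f - g)) (ENNReal.ofReal p) := by
    rw [e]
    exact eLpNorm_add_le (cv_continuous hK hc hgl).aestronglyMeasurable
      (cv_continuous hK hc (hfl.sub hgl)).aestronglyMeasurable h1p
  have s2 : eLpNorm (cv K g) (ENNReal.ofReal p) ≤ A * eLpNorm g (ENNReal.ofReal p) := by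
    rw [eLpNorm_le_iff_lintegral (cv K g) g hp0]
    exact H g hgcont hgc
  have s3 : eLpNorm (cv K (f - g)) (ENNReal.ofReal p) ≤ B * eLpNorm (f - g) (ENNReal.ofReal p) := by
    rw [eLpNorm_le_iff_lintegral (cv K (f - g)) (f - g) hp0, hBdef]
    exact lintegral_cv_rpow_le hK.measurable (hf.1.sub hgm.1).aemeasurable hp
  have s4 : (A + B + 1) * δ = ε := by rw [hδdef, ENNReal.mul_div_cancel (by simp) hAB]
  refine s1.trans ((add_le_add (s2.trans (mul_le_mul' le_rfl hgn))
    (s3.trans (mul_le_mul' le_rfl hfg))).trans ?_)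
  rw [← s4, mul_add, add_assoc, add_mul, add_mul]
  exact add_le_add le_rfl le_self_add

/-- A smooth function on `ℝ`, vanishing for `t ≤ 1/2` and equal to `t ^ (-n/2)` for `t ≥ 1`. -/
def profile (n : ℕ) (t : ℝ) : ℝ := t ^ (-(n / 2 : ℝ)) * Real.smoothTransition (2 * t - 1)

lemma profile_of_le {n : ℕ} {t : ℝ} (ht : t ≤ 1 / 2) : profile n t = 0 := by
  rw [profile, Real.smoothTransition.zero_of_nonpos (by linarith), mul_zero]

lemma profile_contDiff (n : ℕ) : ContDiff ℝ ∞ (profile n) := by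
  rw [contDiff_iff_contDiffAt]
  intro t
  rcases lt_or_ge t (1 / 2) with ht | ht
  · refine (contDiffAt_const (c := (0 : ℝ))).congr_of_eventuallyEq ?_
    filter_upwards [eventually_lt_nhds ht] with s hs using profile_of_le hs.le
  · have ht0 : t ≠ 0 := by linarith
    refine ((contDiffAt_id.rpow_const_of_ne ht0).mul ?_)
    exact (Real.smoothTransition.contDiff.comp (by fun_prop)).contDiffAt

lemma deriv_profile {n : ℕ} {t : ℝ} (ht : 0 < t) :
    n * profile n t + 2 * t * deriv (profile n) t =
      4 * t * t ^ (-(n / 2 : ℝ)) * deriv Real.smoothTransition (2 * t - 1) := by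
  have hs : DifferentiableAt ℝ Real.smoothTransition (2 * t - 1) :=
    (Real.smoothTransition.contDiff (n := ⊤)).differentiable (by simp) _
  have h1 : HasDerivAt (fun s : ℝ => s ^ (-(n / 2 : ℝ))) (-(n / 2 : ℝ) * t ^ (-(n / 2 : ℝ) - 1)) t :=
    Real.hasDerivAt_rpow_const (Or.inl ht.ne')
  have h2 : HasDerivAt (fun s : ℝ => Real.smoothTransition (2 * s - 1))
      (deriv Real.smoothTransition (2 * t - 1) * (2 * 1)) t := by
    have h : HasDerivAt (fun s : ℝ => 2 * s - 1) (2 * 1) t :=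
      ((hasDerivAt_id t).const_mul 2).sub_const 1
    exact hs.hasDerivAt.comp t h
  have h3 : deriv (profile n) t = _ := (h1.mul h2).deriv
  rw [h3, Real.rpow_sub_one ht.ne', profile]
  field_simp
  ring

/-- The unnormalised kernel `x_l |x|^{-n}`, smoothed in the unit ball. -/
def preW {n : ℕ} (l : Fin n) (x : Evec n) : ℝ := x l * profile n (‖x‖ ^ 2)

lemma preW_contDiff {n : ℕ} (l : Fin n) : ContDiff ℝ ∞ (preW (n := n) l) := by
  refine ContDiff.mul ?_ ((profile_contDiff n).comp (contDiff_norm_sq ℝ))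
  exact (EuclideanSpace.proj (𝕜 := ℝ) l).contDiff

lemma pd_preW {n : ℕ} (j l : Fin n) (x : Evec n) :
    pd j (preW l) x = (if j = l then profile n (‖x‖ ^ 2) else 0) +
      2 * x j * x l * deriv (profile n) (‖x‖ ^ 2) := by
  have h1 : HasFDerivAt (fun y : Evec n => y l) (EuclideanSpace.proj (𝕜 := ℝ) l) x :=
    (EuclideanSpace.proj (𝕜 := ℝ) l).hasFDerivAt
  have h2 := HasDerivAt.comp_hasFDerivAt x
    (((profile_contDiff n).differentiable (by simp)) (‖x‖ ^ 2)).hasDerivAt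
    (hasStrictFDerivAt_norm_sq x).hasFDerivAt
  have h3 : fderiv ℝ (preW l) x = _ := (h1.mul h2).fderiv
  rw [pd, h3]
  have h4 : inner ℝ x (EuclideanSpace.single j (1 : ℝ)) = x j := by
    simp [EuclideanSpace.inner_single_right]
  simp [h4, eq_comm]
  ring

/-- The divergence of `preW`. -/
def prePhi {n : ℕ} (x : Evec n) : ℝ := ∑ l, pd l (preW (n := n) l) x

lemma prePhi_eq {n : ℕ} (x : Evec n) :
    prePhi x = n * profile n (‖x‖ ^ 2) + 2 * ‖x‖ ^ 2 * deriv (profile n) (‖x‖ ^ 2) := by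
  simp only [prePhi, pd_preW, if_true, Finset.sum_add_distrib, EuclideanSpace.real_norm_sq_eq]
  rw [Finset.mul_sum, Finset.sum_mul]
  simp [pow_two, mul_assoc]

lemma prePhi_eq_of_ne {n : ℕ} {x : Evec n} (hx : x ≠ 0) :
    prePhi x = 4 * ‖x‖ ^ 2 * (‖x‖ ^ 2) ^ (-(n / 2 : ℝ)) *
      deriv Real.smoothTransition (2 * ‖x‖ ^ 2 - 1) := by
  rw [prePhi_eq, deriv_profile (by positivity)]

lemma prePhi_nonneg {n : ℕ} (x : Evec n) : 0 ≤ prePhi x := by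
  rcases eq_or_ne x 0 with rfl | hx
  · rw [prePhi_eq, norm_zero, profile_of_le (by norm_num)]; simp
  · rw [prePhi_eq_of_ne hx]
    have := Real.smoothTransition.monotone.deriv_nonneg (x := 2 * ‖x‖ ^ 2 - 1)
    positivity

lemma deriv_smoothTransition_of_one_le {t : ℝ} (ht : 1 ≤ t) :
    deriv Real.smoothTransition t = 0 := by
  have hc : Continuous (deriv Real.smoothTransition) :=
    (Real.smoothTransition.contDiff (n := ⊤)).continuous_deriv (by simp)
  have h : closure (Ioi (1 : ℝ)) ⊆ {s | deriv Real.smoothTransition s = 0} := by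
    refine closure_minimal (fun s hs => ?_) (isClosed_eq hc continuous_const)
    have : Real.smoothTransition =ᶠ[𝓝 s] fun _ => 1 := by
      filter_upwards [eventually_gt_nhds hs] with u hu
        using Real.smoothTransition.one_of_one_le hu.le
    simp [this.deriv_eq]
  rw [closure_Ioi] at h
  exact h ht

lemma prePhi_of_one_le {n : ℕ} {x : Evec n} (hx : 1 ≤ ‖x‖) : prePhi x = 0 := by
  have h0 : x ≠ 0 := by rintro rfl; simp at hx; linarith
  rw [prePhi_eq_of_ne h0, deriv_smoothTransition_of_one_le (by nlinarith), mul_zero]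

lemma prePhi_contDiff {n : ℕ} : ContDiff ℝ ∞ (prePhi (n := n)) :=
  ContDiff.sum fun l _ => pd_contDiff (preW_contDiff l) l

lemma hasCompactSupport_of_norm {n : ℕ} {F : Evec n → ℝ} (r : ℝ) (h : ∀ x, r ≤ ‖x‖ → F x = 0) :
    HasCompactSupport F :=
  HasCompactSupport.of_support_subset_isCompact (isCompact_closedBall (0 : Evec n) r) fun x hx => by
    by_contra hc
    exact hx (h x (by simpa using (not_le.1 (by simpa using hc)).le))

lemma integral_prePhi_pos {n : ℕ} (hn : 0 < n) : 0 < ∫ x : Evec n, prePhi x := by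
  have hdiff : Differentiable ℝ Real.smoothTransition :=
    (Real.smoothTransition.contDiff (n := ⊤)).differentiable (by simp)
  obtain ⟨t, ht, hd⟩ := exists_deriv_eq_slope Real.smoothTransition one_pos
    hdiff.continuous.continuousOn hdiff.differentiableOn
  simp only [Real.smoothTransition.one, Real.smoothTransition.zero, sub_zero, div_one] at hd
  have h0 : 0 < (t + 1) / 2 := by linarith [ht.1]
  set x : Evec n := EuclideanSpace.single ⟨0, hn⟩ (Real.sqrt ((t + 1) / 2)) with hxdef
  have hx : ‖x‖ ^ 2 = (t + 1) / 2 := by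
    rw [hxdef, PiLp.norm_single, Real.norm_eq_abs, sq_abs, Real.sq_sqrt h0.le]
  have hx0 : x ≠ 0 := by rintro h; rw [h] at hx; simp at hx; linarith
  refine (prePhi_contDiff.continuous).integral_pos_of_hasCompactSupport_nonneg_nonzero
    (hasCompactSupport_of_norm 1 fun _ => prePhi_of_one_le) (fun x => prePhi_nonneg x) (x := x) ?_
  rw [prePhi_eq_of_ne hx0, hx, show 2 * ((t + 1) / 2) - 1 = t by ring, hd]
  positivity

/-- The smoothed gradient of the fundamental solution of the Laplacian, normalised so that its
divergence `kerPhi` has integral one. -/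
def kerW {n : ℕ} (l : Fin n) (x : Evec n) : ℝ := (∫ y : Evec n, prePhi y)⁻¹ * preW l x

/-- The divergence of `kerW`, a bump function supported in the unit ball. -/
def kerPhi {n : ℕ} (x : Evec n) : ℝ := (∫ y : Evec n, prePhi y)⁻¹ * prePhi x

lemma pd_const_mul {n : ℕ} {F : Evec n → ℝ} (hF : Differentiable ℝ F) (c : ℝ) (j : Fin n) :
    pd j (fun x => c * F x) = fun x => c * pd j F x := by
  ext x
  rw [pd, fderiv_const_mul (hF x)]
  simp [pd]

lemma kerW_contDiff {n : ℕ} (l : Fin n) : ContDiff ℝ ∞ (kerW (n := n) l) :=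
  contDiff_const.mul (preW_contDiff l)

lemma pd_kerW {n : ℕ} (j l : Fin n) (x : Evec n) :
    pd j (kerW l) x = (∫ y : Evec n, prePhi y)⁻¹ * pd j (preW l) x :=
  congrFun (pd_const_mul ((preW_contDiff l).differentiable (by simp)) _ j) x

lemma pd_kerW_symm {n : ℕ} (j l : Fin n) : pd j (kerW (n := n) l) = pd l (kerW j) := by
  ext x
  rw [pd_kerW, pd_kerW, pd_preW, pd_preW]
  simp only [eq_comm (a := j)]
  ring

lemma pd_kerW_neg {n : ℕ} (j l : Fin n) (x : Evec n) :
    pd j (kerW (n := n) l) (-x) = pd j (kerW l) x := by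
  simp [pd_kerW, pd_preW]

lemma sum_pd_kerW {n : ℕ} (x : Evec n) : ∑ l, pd l (kerW (n := n) l) x = kerPhi x := by
  simp only [pd_kerW, ← Finset.mul_sum]; rfl

lemma kerPhi_contDiff {n : ℕ} : ContDiff ℝ ∞ (kerPhi (n := n)) :=
  contDiff_const.mul prePhi_contDiff

lemma kerPhi_of_one_le {n : ℕ} {x : Evec n} (hx : 1 ≤ ‖x‖) : kerPhi x = 0 := by
  rw [kerPhi, prePhi_of_one_le hx, mul_zero]

lemma kerPhi_hasCompactSupport {n : ℕ} : HasCompactSupport (kerPhi (n := n)) :=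
  hasCompactSupport_of_norm 1 fun _ => kerPhi_of_one_le

lemma integral_kerPhi {n : ℕ} (hn : 0 < n) : ∫ x : Evec n, kerPhi x = 1 := by
  simp only [kerPhi]
  rw [integral_const_mul, inv_mul_cancel₀ (integral_prePhi_pos hn).ne']

lemma kerW_far {n : ℕ} (l : Fin n) {x : Evec n} (hx : 1 ≤ ‖x‖) :
    kerW l x = (∫ y : Evec n, prePhi y)⁻¹ * (x l * (‖x‖ ^ n)⁻¹) := by
  rw [kerW, preW, profile, Real.smoothTransition.one_of_one_le (by nlinarith), mul_one]
  congr 2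
  rw [← Real.rpow_natCast ‖x‖ 2, ← Real.rpow_mul (norm_nonneg x), ← Real.rpow_natCast ‖x‖ n,
    ← Real.rpow_neg (norm_nonneg x)]
  congr 1
  push_cast
  ring

/-- The `L¹`-normalised dilation of `F` by the factor `s`. -/
def dil {n : ℕ} (s : ℝ) (F : Evec n → ℝ) (x : Evec n) : ℝ := s⁻¹ ^ n * F (s⁻¹ • x)

lemma dil_contDiff {n : ℕ} {F : Evec n → ℝ} (hF : ContDiff ℝ ∞ F) (s : ℝ) :
    ContDiff ℝ ∞ (dil s F) :=
  contDiff_const.mul (hF.comp (contDiff_const_smul _))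

lemma fderiv_dil {n : ℕ} {F : Evec n → ℝ} (hF : Differentiable ℝ F) (s : ℝ) (x : Evec n) :
    fderiv ℝ (dil s F) x = (s⁻¹ ^ n * s⁻¹) • fderiv ℝ F (s⁻¹ • x) := by
  have h1 : HasFDerivAt (fun y : Evec n => s⁻¹ • y) (s⁻¹ • ContinuousLinearMap.id ℝ (Evec n)) x :=
    (hasFDerivAt_id x).const_smul s⁻¹
  have h2 : fderiv ℝ (dil s F) x = _ :=
    (((hF (s⁻¹ • x)).hasFDerivAt.comp x h1).const_mul (s⁻¹ ^ n)).fderiv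
  rw [h2]
  ext y
  simp
  ring

lemma pd_dil {n : ℕ} {F : Evec n → ℝ} (hF : Differentiable ℝ F) (s : ℝ) (j : Fin n) (x : Evec n) :
    pd j (dil s F) x = s⁻¹ * dil s (pd j F) x := by
  rw [pd, fderiv_dil hF, dil, pd]
  simp
  ring

lemma dil_neg {n : ℕ} {F : Evec n → ℝ} (hF : ∀ x, F (-x) = F x) (s : ℝ) (x : Evec n) :
    dil s F (-x) = dil s F x := by
  rw [dil, smul_neg, hF, dil]

lemma dil_eq_zero {n : ℕ} {F : Evec n → ℝ} (hF : ∀ x, 1 ≤ ‖x‖ → F x = 0) {s : ℝ} (hs : 0 < s)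
    {x : Evec n} (hx : s ≤ ‖x‖) : dil s F x = 0 := by
  rw [dil, hF, mul_zero]
  rw [norm_smul, norm_inv, Real.norm_of_nonneg hs.le, ← div_eq_inv_mul]
  exact (one_le_div hs).2 hx

lemma integral_dil {n : ℕ} (F : Evec n → ℝ) {s : ℝ} (hs : 0 < s) :
    ∫ x, dil s F x = ∫ x, F x := by
  simp only [dil]
  rw [integral_const_mul, Measure.integral_comp_inv_smul_of_nonneg volume F hs.le]
  simp only [finrank_euclideanSpace, Fintype.card_fin, smul_eq_mul]
  rw [← mul_assoc, ← mul_pow, inv_mul_cancel₀ hs.ne', one_pow, one_mul]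

lemma lintegral_dil {n : ℕ} {F : Evec n → ℝ} (h1 : Integrable F)
    {s : ℝ} (hs : 0 < s) : ∫⁻ x, ‖dil s F x‖ₑ = ∫⁻ x, ‖F x‖ₑ := by
  have h2 : Integrable (dil s F) :=
    ((integrable_comp_smul_iff volume F (inv_ne_zero hs.ne')).2 h1).const_mul _
  rw [← ofReal_integral_norm_eq_lintegral_enorm h1, ← ofReal_integral_norm_eq_lintegral_enorm h2,
    ← integral_dil (fun x => ‖F x‖) hs]
  congr 2 with x
  simp [dil, abs_of_pos hs]

lemma dil_kerW_far {n : ℕ} (l : Fin n) {s : ℝ} (hs : 0 < s) {x : Evec n} (hx : s ≤ ‖x‖) :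
    s * dil s (kerW l) x = (∫ y : Evec n, prePhi y)⁻¹ * (x l * (‖x‖ ^ n)⁻¹) := by
  have h1 : ‖s⁻¹ • x‖ = s⁻¹ * ‖x‖ := by
    rw [norm_smul, norm_inv, Real.norm_of_nonneg hs.le]
  have h2 : 1 ≤ ‖s⁻¹ • x‖ := by
    rw [h1, ← div_eq_inv_mul]; exact (one_le_div hs).2 hx
  rw [dil, kerW_far l h2, h1, mul_pow, mul_inv]
  have : (s⁻¹ ^ n) ≠ 0 := by positivity
  simp only [PiLp.smul_apply, smul_eq_mul]
  field_simp

/-- The difference of two rescalings of `kerW l`, compactly supported. -/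
def kerD {n : ℕ} (s r : ℝ) (l : Fin n) (x : Evec n) : ℝ :=
  s * dil s (kerW l) x - r * dil r (kerW l) x

lemma kerD_contDiff {n : ℕ} (s r : ℝ) (l : Fin n) : ContDiff ℝ ∞ (kerD s r l) :=
  (contDiff_const.mul (dil_contDiff (kerW_contDiff l) s)).sub
    (contDiff_const.mul (dil_contDiff (kerW_contDiff l) r))

lemma kerD_of_le {n : ℕ} {s r : ℝ} (hs : 0 < s) (hsr : s ≤ r) (l : Fin n) {x : Evec n}
    (hx : r ≤ ‖x‖) : kerD s r l x = 0 := by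
  rw [kerD, dil_kerW_far l hs (hsr.trans hx), dil_kerW_far l (hs.trans_le hsr) hx, sub_self]

lemma kerD_hasCompactSupport {n : ℕ} {s r : ℝ} (hs : 0 < s) (hsr : s ≤ r) (l : Fin n) :
    HasCompactSupport (kerD s r l) :=
  hasCompactSupport_of_norm r fun _ => kerD_of_le hs hsr l

lemma pd_kerD {n : ℕ} {s r : ℝ} (hs : 0 < s) (hr : 0 < r) (j l : Fin n) (x : Evec n) :
    pd j (kerD s r l) x = dil s (pd j (kerW l)) x - dil r (pd j (kerW l)) x := by
  have hW : Differentiable ℝ (kerW (n := n) l) := (kerW_contDiff l).differentiable (by simp)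
  have h : ∀ t : ℝ, Differentiable ℝ (dil t (kerW (n := n) l)) := fun t =>
    (dil_contDiff (kerW_contDiff l) t).differentiable (by simp)
  have h1 : pd j (kerD s r l) x =
      pd j (fun y => s * dil s (kerW l) y) x - pd j (fun y => r * dil r (kerW l) y) x := by
    rw [pd, pd, pd, ← sub_apply, ← fderiv_fun_sub (((h s).const_mul s) x)
      (((h r).const_mul r) x)]
    rfl
  simp only [h1, pd_const_mul (h s), pd_const_mul (h r), pd_dil hW]
  field_simp

lemma pd_kerD_symm {n : ℕ} {s r : ℝ} (hs : 0 < s) (hr : 0 < r) (j l : Fin n) :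
    pd j (kerD (n := n) s r l) = pd l (kerD s r j) := by
  ext x
  rw [pd_kerD hs hr, pd_kerD hs hr, pd_kerW_symm]

lemma pd_kerD_neg {n : ℕ} {s r : ℝ} (hs : 0 < s) (hr : 0 < r) (j l : Fin n) (x : Evec n) :
    pd j (kerD s r l) (-x) = pd j (kerD s r l) x := by
  rw [pd_kerD hs hr, pd_kerD hs hr, dil_neg (pd_kerW_neg j l), dil_neg (pd_kerW_neg j l)]

lemma sum_pd_kerD {n : ℕ} {s r : ℝ} (hs : 0 < s) (hr : 0 < r) (x : Evec n) :
    ∑ l, pd l (kerD s r l) x = dil s kerPhi x - dil r kerPhi x := by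
  simp only [pd_kerD hs hr, Finset.sum_sub_distrib, dil, ← Finset.mul_sum, sum_pd_kerW]

lemma norm_fderiv_le_of_dil_eq {n : ℕ} {G : Evec n → ℝ} (hG : ContDiff ℝ ∞ G)
    (h : ∀ s : ℝ, 1 ≤ s → ∀ x, s < ‖x‖ → G x = dil s G x) :
    ∃ C : ℝ, 0 ≤ C ∧ ∀ x, x ≠ 0 → ‖fderiv ℝ G x‖ ≤ C * (‖x‖ ^ (n + 1))⁻¹ := by
  obtain ⟨M, hM⟩ := (isCompact_closedBall (0 : Evec n) 2).exists_bound_of_continuousOn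
    (hG.continuous_fderiv (by simp)).continuousOn
  have hM0 : 0 ≤ M := (norm_nonneg _).trans (hM 0 (by simp))
  refine ⟨M * 2 ^ (n + 1), by positivity, fun x hx => ?_⟩
  have hx0 : 0 < ‖x‖ := norm_pos_iff.2 hx
  rcases le_or_gt ‖x‖ 2 with h2 | h2
  · refine (hM x (by simpa using h2)).trans ?_
    rw [mul_assoc]
    refine le_mul_of_one_le_right hM0 ?_
    rw [← div_eq_mul_inv]
    exact (one_le_div (by positivity)).2 (by gcongr)
  · have hs : (1 : ℝ) ≤ ‖x‖ / 2 := by linarith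
    have he : G =ᶠ[𝓝 x] dil (‖x‖ / 2) G := by
      filter_upwards [continuous_norm.continuousAt.eventually (lt_mem_nhds
        (show ‖x‖ / 2 < ‖x‖ by linarith))] with y hy using h _ hs y hy
    rw [he.fderiv_eq, fderiv_dil (hG.differentiable (by simp)), norm_smul, ← pow_succ,
      Real.norm_of_nonneg (by positivity)]
    have h3 := hM ((‖x‖ / 2)⁻¹ • x) (by
      rw [mem_closedBall_zero_iff, norm_smul, norm_inv, Real.norm_of_nonneg (by positivity)]
      field_simp; rfl)
    calc (‖x‖ / 2)⁻¹ ^ (n + 1) * ‖fderiv ℝ G ((‖x‖ / 2)⁻¹ • x)‖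
        ≤ (‖x‖ / 2)⁻¹ ^ (n + 1) * M := by gcongr
      _ = M * 2 ^ (n + 1) * (‖x‖ ^ (n + 1))⁻¹ := by
        rw [inv_div, div_pow]; ring

lemma pd_kerW_eq_dil {n : ℕ} (j l : Fin n) {s : ℝ} (hs : 1 ≤ s) {x : Evec n} (hx : s < ‖x‖) :
    pd j (kerW l) x = dil s (pd j (kerW l)) x := by
  have hs0 : 0 < s := by linarith
  have he : kerW l =ᶠ[𝓝 x] fun y => s * dil s (kerW l) y := by
    filter_upwards [continuous_norm.continuousAt.eventually (lt_mem_nhds hx)] with y hy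
    rw [kerW_far l (hs.trans hy.le), dil_kerW_far l hs0 hy.le]
  rw [pd, he.fderiv_eq]
  change pd j (fun y => s * dil s (kerW l) y) x = _
  simp only [pd_const_mul ((dil_contDiff (kerW_contDiff l) s).differentiable (by simp)),
    pd_dil ((kerW_contDiff l).differentiable (by simp))]
  field_simp

lemma abs_sub_le_of_norm_fderiv_le {n : ℕ} {G : Evec n → ℝ} (hG : Differentiable ℝ G) {C : ℝ}
    (hC : 0 ≤ C) (h : ∀ x, x ≠ 0 → ‖fderiv ℝ G x‖ ≤ C * (‖x‖ ^ (n + 1))⁻¹)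
    {x y : Evec n} (hxy : 2 * ‖y‖ ≤ ‖x‖) (hx : x ≠ 0) :
    |G (x - y) - G x| ≤ C * 2 ^ (n + 1) * (‖y‖ * (‖x‖ ^ (n + 1))⁻¹) := by
  have hx0 : 0 < ‖x‖ := norm_pos_iff.2 hx
  have hb : ∀ z ∈ Metric.closedBall x ‖y‖,
      ‖fderiv ℝ G z‖ ≤ C * 2 ^ (n + 1) * (‖x‖ ^ (n + 1))⁻¹ := by
    intro z hz
    rw [mem_closedBall_iff_norm] at hz
    have h1 : ‖x‖ / 2 ≤ ‖z‖ := by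
      have := norm_sub_norm_le x z
      rw [norm_sub_rev] at this
      linarith
    have hz0 : z ≠ 0 := by rintro rfl; rw [norm_zero] at h1; linarith
    refine (h z hz0).trans ?_
    rw [mul_assoc]
    refine mul_le_mul_of_nonneg_left ?_ hC
    calc (‖z‖ ^ (n + 1))⁻¹ ≤ ((‖x‖ / 2) ^ (n + 1))⁻¹ := by gcongr
      _ = _ := by rw [div_pow, inv_div]; ring
  have := (convex_closedBall x ‖y‖).norm_image_sub_le_of_norm_fderiv_le (fun z _ => hG z) hb
    (Metric.mem_closedBall_self (norm_nonneg y)) (show x - y ∈ _ by simp)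
  simp only [sub_sub_cancel_left, norm_neg, Real.norm_eq_abs] at this
  linarith

lemma dil_abs_sub_le {n : ℕ} {G : Evec n → ℝ} {C : ℝ}
    (h : ∀ x y : Evec n, 2 * ‖y‖ ≤ ‖x‖ → x ≠ 0 →
      |G (x - y) - G x| ≤ C * (‖y‖ * (‖x‖ ^ (n + 1))⁻¹)) {s : ℝ} (hs : 0 < s) {x y : Evec n}
    (hxy : 2 * ‖y‖ ≤ ‖x‖) (hx : x ≠ 0) :
    |dil s G (x - y) - dil s G x| ≤ C * (‖y‖ * (‖x‖ ^ (n + 1))⁻¹) := by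
  have hn : ∀ z : Evec n, ‖s⁻¹ • z‖ = s⁻¹ * ‖z‖ := fun z => by
    rw [norm_smul, norm_inv, Real.norm_of_nonneg hs.le]
  have h1 := h (s⁻¹ • x) (s⁻¹ • y) (by
    rw [hn, hn]
    have := inv_pos.2 hs
    nlinarith) (smul_ne_zero (inv_ne_zero hs.ne') hx)
  rw [dil, dil, ← mul_sub, abs_mul, abs_of_nonneg (by positivity), smul_sub]
  refine (mul_le_mul_of_nonneg_left h1 (by positivity)).trans_eq ?_
  rw [hn, hn, mul_pow, inv_pow, inv_pow]
  have : 0 < ‖x‖ := norm_pos_iff.2 hx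
  field_simp
  ring

/-- The second derivatives of the truncated kernels satisfy a uniform smoothness condition. -/
lemma exists_pd_kerD_smooth (n : ℕ) : ∃ C : ℝ, 0 ≤ C ∧ ∀ s r : ℝ, 0 < s → 0 < r →
    ∀ (j l : Fin n) (x y : Evec n), 2 * ‖y‖ ≤ ‖x‖ → x ≠ 0 →
      |pd j (kerD s r l) (x - y) - pd j (kerD s r l) x| ≤ C * (‖y‖ * (‖x‖ ^ (n + 1))⁻¹) := by
  have h1 : ∀ j l : Fin n, ∃ C : ℝ, 0 ≤ C ∧ ∀ x y : Evec n, 2 * ‖y‖ ≤ ‖x‖ → x ≠ 0 →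
      |pd j (kerW l) (x - y) - pd j (kerW l) x| ≤ C * (‖y‖ * (‖x‖ ^ (n + 1))⁻¹) := by
    intro j l
    have hG := pd_contDiff (kerW_contDiff (n := n) l) j
    obtain ⟨C, hC, h⟩ := norm_fderiv_le_of_dil_eq hG fun s hs x hx => pd_kerW_eq_dil j l hs hx
    exact ⟨C * 2 ^ (n + 1), by positivity, fun x y hxy hx =>
      abs_sub_le_of_norm_fderiv_le (hG.differentiable (by simp)) hC h hxy hx⟩
  choose C hC h using h1
  refine ⟨∑ j, ∑ l, 2 * C j l, Finset.sum_nonneg fun j _ => Finset.sum_nonneg fun l _ =>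
    mul_nonneg two_pos.le (hC j l), fun s r hs hr j l x y hxy hx => ?_⟩
  have hle : 2 * C j l ≤ ∑ j, ∑ l, 2 * C j l :=
    (Finset.single_le_sum (f := fun l => 2 * C j l) (fun l _ => mul_nonneg two_pos.le (hC j l))
      (Finset.mem_univ l)).trans
    (Finset.single_le_sum (f := fun j => ∑ l, 2 * C j l) (fun j _ => Finset.sum_nonneg fun l _ =>
      mul_nonneg two_pos.le (hC j l)) (Finset.mem_univ j))
  rw [pd_kerD hs hr, pd_kerD hs hr]
  have a := dil_abs_sub_le (h j l) hs hxy hx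
  have b := dil_abs_sub_le (h j l) hr hxy hx
  have hq : 0 ≤ ‖y‖ * (‖x‖ ^ (n + 1))⁻¹ := by positivity
  refine le_trans ?_ (mul_le_mul_of_nonneg_right hle hq)
  rw [abs_le] at *
  constructor <;> linarith [a.1, a.2, b.1, b.2]

lemma volume_closedBall_eq {n : ℕ} (x : Evec n) {r : ℝ} (hr : 0 ≤ r) :
    volume (Metric.closedBall x r) = ENNReal.ofReal r ^ n * volume (Metric.ball (0 : Evec n) 1) := by
  rw [Measure.addHaar_closedBall volume x hr, finrank_euclideanSpace, Fintype.card_fin,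
    ENNReal.ofReal_pow hr]

lemma volume_closedBall_mul {n : ℕ} (x : Evec n) {a r : ℝ} (ha : 0 ≤ a) (hr : 0 ≤ r) :
    volume (Metric.closedBall x (a * r)) =
      ENNReal.ofReal a ^ n * volume (Metric.closedBall x r) := by
  rw [volume_closedBall_eq x (by positivity), volume_closedBall_eq x hr, ENNReal.ofReal_mul ha,
    mul_pow, mul_assoc]

/-- A ball on which the average of `‖f‖` exceeds `t` has bounded radius. -/
lemma exists_radius_bound {n : ℕ} (hn : 0 < n) {f : Evec n → ℝ} (hf : Integrable f) {t : ℝ}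
    (ht : 0 < t) : ∃ R : ℝ, ∀ (x : Evec n) (r : ℝ), 0 < r →
      ENNReal.ofReal t * volume (Metric.closedBall x r) < ∫⁻ y in Metric.closedBall x r, ‖f y‖ₑ →
      r ≤ R := by
  have hV : volume (Metric.ball (0 : Evec n) 1) ≠ 0 := (Metric.measure_ball_pos _ _ one_pos).ne'
  have hV' : volume (Metric.ball (0 : Evec n) 1) ≠ ⊤ := measure_ball_lt_top.ne
  have hF : ∫⁻ y, ‖f y‖ₑ ≠ ⊤ := hf.2.ne
  have ht' : ENNReal.ofReal t ≠ 0 := by simpa using ht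
  have hq : (∫⁻ y, ‖f y‖ₑ) / (ENNReal.ofReal t * volume (Metric.ball (0 : Evec n) 1)) ≠ ⊤ :=
    ENNReal.div_ne_top hF (mul_ne_zero ht' hV)
  refine ⟨max 1 ((∫⁻ y, ‖f y‖ₑ) /
    (ENNReal.ofReal t * volume (Metric.ball (0 : Evec n) 1))).toReal, fun x r hr h => ?_⟩
  rcases le_or_gt r 1 with h1 | h1
  · exact h1.trans (le_max_left _ _)
  refine le_trans ?_ (le_max_right _ _)
  rw [← ENNReal.ofReal_le_iff_le_toReal hq,
    ENNReal.le_div_iff_mul_le (Or.inl (mul_ne_zero ht' hV))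
      (Or.inl (ENNReal.mul_ne_top ENNReal.ofReal_ne_top hV'))]
  have h2 : ENNReal.ofReal r ≤ ENNReal.ofReal r ^ n := by
    apply le_self_pow₀ _ hn.ne'
    simpa using h1.le
  calc ENNReal.ofReal r * (ENNReal.ofReal t * volume (Metric.ball (0 : Evec n) 1))
      ≤ ENNReal.ofReal r ^ n * (ENNReal.ofReal t * volume (Metric.ball (0 : Evec n) 1)) :=
        mul_le_mul' h2 le_rfl
    _ = ENNReal.ofReal t * volume (Metric.closedBall x r) := by
        rw [volume_closedBall_eq x hr.le]; ring
    _ ≤ ∫⁻ y, ‖f y‖ₑ := h.le.trans (setLIntegral_le_lintegral _ _)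

/-- Lebesgue differentiation: if all small balls around `x` have average at most `t`,
then `‖f x‖ ≤ t`, for almost every `x`. -/
lemma ae_norm_le_of_average_le {n : ℕ} {f : Evec n → ℝ} (hf : Integrable f) (t : ℝ) :
    ∀ᵐ x : Evec n, (∀ r : ℝ, 0 < r →
      ∫⁻ y in Metric.closedBall x r, ‖f y‖ₑ ≤ ENNReal.ofReal t * volume (Metric.closedBall x r)) →
      ‖f x‖ₑ ≤ ENNReal.ofReal t := by
  filter_upwards [IsUnifLocDoublingMeasure.ae_tendsto_average (μ := (volume : Measure (Evec n)))
    hf.locallyIntegrable 1] with x hx hb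
  have hδ : Tendsto (fun k : ℕ => (1 : ℝ) / ((k : ℝ) + 1)) atTop (𝓝[>] 0) :=
    tendsto_nhdsWithin_iff.2 ⟨tendsto_one_div_add_atTop_nhds_zero_nat,
      Eventually.of_forall fun k => by simp only [mem_Ioi]; positivity⟩
  have h1 := hx (fun _ : ℕ => x) _ hδ (Eventually.of_forall fun k =>
    Metric.mem_closedBall_self (by positivity))
  refine le_of_tendsto (h1.enorm) (Eventually.of_forall fun k => ?_)
  have hr : (0 : ℝ) < 1 / ((k : ℝ) + 1) := by positivity
  have hv : volume (Metric.closedBall x (1 / ((k : ℝ) + 1))) ≠ 0 :=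
    (Metric.measure_closedBall_pos _ _ hr).ne'
  have hv' : volume (Metric.closedBall x (1 / ((k : ℝ) + 1))) ≠ ⊤ := measure_closedBall_lt_top.ne
  rw [average_eq, enorm_smul]
  refine (mul_le_mul' le_rfl ((enorm_integral_le_lintegral_enorm _).trans (hb _ hr))).trans_eq ?_
  rw [measureReal_restrict_apply_univ, measureReal_def, Real.enorm_of_nonneg (by positivity),
    ENNReal.ofReal_inv_of_pos (ENNReal.toReal_pos hv hv'), ENNReal.ofReal_toReal hv',
    mul_left_comm, ENNReal.inv_mul_cancel hv hv', mul_one]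

/-- A Calderón–Zygmund covering: disjoint sets comparable to balls on which the average of `‖f‖`
is comparable to `t`, such that `‖f‖ ≤ t` almost everywhere outside of them. -/
lemma exists_cz_cover {n : ℕ} (hn : 0 < n) {f : Evec n → ℝ} (hf : Integrable f) {t : ℝ}
    (ht : 0 < t) : ∃ (u : Set (Evec n)) (r : Evec n → ℝ) (Q : u → Set (Evec n)),
      Countable u ∧ (∀ i : u, 0 < r i) ∧ (∀ i, MeasurableSet (Q i)) ∧ Pairwise (Function.onFun Disjoint Q) ∧
      (∀ i : u, Q i ⊆ Metric.closedBall i (r i)) ∧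
      (∀ i, volume (Q i) ≠ 0) ∧
      (∀ i, ∫⁻ y in Q i, ‖f y‖ₑ ≤ 5 ^ n * ENNReal.ofReal t * volume (Q i)) ∧
      (∀ i : u, ENNReal.ofReal t * volume (Metric.closedBall (i : Evec n) (2 * r i)) ≤
        10 ^ n * ∫⁻ y in Q i, ‖f y‖ₑ) ∧
      ∀ᵐ x : Evec n, x ∉ ⋃ i, Q i → ‖f x‖ₑ ≤ ENNReal.ofReal t := by
  obtain ⟨R, hR⟩ := exists_radius_bound hn hf ht
  set P : Evec n → ℝ → Prop := fun x r => 0 < r ∧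
    ENNReal.ofReal t * volume (Metric.closedBall x r) < ∫⁻ y in Metric.closedBall x r, ‖f y‖ₑ
    with hP
  set S : Set (Evec n) := {x | ∃ r, P x r} with hS
  have hex : ∀ x ∈ S, ∃ r, P x r ∧ ∀ r', 2 * r ≤ r' → ¬ P x r' := by
    intro x hx
    have hbdd : BddAbove {r | P x r} := ⟨R, fun r hr => hR x r hr.1 hr.2⟩
    obtain ⟨r₀, hr₀⟩ := hx
    have hpos : 0 < sSup {r | P x r} := hr₀.1.trans_le (le_csSup hbdd hr₀)
    obtain ⟨r, hr, hlt⟩ := exists_lt_of_lt_csSup (s := {r | P x r}) ⟨r₀, hr₀⟩ (half_lt_self hpos)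
    refine ⟨r, hr, fun r' hr' hc => ?_⟩
    have := le_csSup hbdd (show r' ∈ {r | P x r} from hc)
    linarith
  choose! ρ hρ hρ2 using hex
  obtain ⟨u, huS, hdisj, hcov⟩ := Vitali.exists_disjoint_subfamily_covering_enlargement_closedBall
    S id ρ R (fun x hx => hR x _ (hρ x hx).1 (hρ x hx).2) 5 (by norm_num)
  have hcount : u.Countable := hdisj.countable_of_nonempty_interior fun x hx =>
    ⟨x, Metric.ball_subset_interior_closedBall (Metric.mem_ball_self (hρ x (huS hx)).1)⟩
  have : Countable u := hcount.to_subtype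
  obtain ⟨e, he⟩ := Countable.exists_injective_nat u
  set B : u → Set (Evec n) := fun i => Metric.closedBall i (ρ i) with hB
  set L : u → Set (Evec n) := fun i => Metric.closedBall i (5 * ρ i) with hL
  have hρpos : ∀ i : u, 0 < ρ i := fun i => (hρ i (huS i.2)).1
  have hBL : ∀ i, B i ⊆ L i := fun i =>
    Metric.closedBall_subset_closedBall (by linarith [hρpos i])
  set Q : u → Set (Evec n) := fun i => B i ∪ (L i \ ((⋃ j, B j) ∪ ⋃ j : {j : u // e j < e i}, L j))
    with hQ
  have hBQ : ∀ i, B i ⊆ Q i := fun i => subset_union_left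
  have hQL : ∀ i, Q i ⊆ L i := fun i => union_subset (hBL i) sdiff_subset
  have hBm : ∀ i, MeasurableSet (B i) := fun i => Metric.isClosed_closedBall.measurableSet
  have hLm : ∀ i, MeasurableSet (L i) := fun i => Metric.isClosed_closedBall.measurableSet
  have hL5 : ∀ i, volume (L i) = 5 ^ n * volume (B i) := fun i => by
    rw [hL, hB]
    simp only
    rw [volume_closedBall_mul _ (by norm_num) (hρpos i).le]
    simp
  have hcovQ : ∀ i, L i ⊆ ⋃ j, Q j := by
    intro i x hx
    by_cases hxB : x ∈ ⋃ j, B j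
    · obtain ⟨j, hj⟩ := mem_iUnion.1 hxB
      exact mem_iUnion.2 ⟨j, hBQ j hj⟩
    · have hne : ∃ k, ∃ j : u, e j = k ∧ x ∈ L j := ⟨_, i, rfl, hx⟩
      classical
      obtain ⟨j, hj, hxj⟩ := Nat.find_spec hne
      refine mem_iUnion.2 ⟨j, Or.inr ⟨hxj, ?_⟩⟩
      rintro (h | h)
      · exact hxB h
      · obtain ⟨⟨k, hk⟩, hxk⟩ := mem_iUnion.1 h
        exact Nat.find_min hne (hj ▸ hk) ⟨k, rfl, hxk⟩
  refine ⟨u, fun x => 5 * ρ x, Q, this, fun i => by linarith [hρpos i], fun i => ?_, ?_, hQL,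
    fun i h0 => ?_, fun i => ?_, fun i => ?_, ?_⟩
  · exact (hBm i).union ((hLm i).diff ((MeasurableSet.iUnion hBm).union
      (MeasurableSet.iUnion fun j => hLm j)))
  · have key : ∀ i j, e i < e j → Disjoint (Q i) (Q j) := by
      intro i j hij
      have hne : i ≠ j := fun h => by rw [h] at hij; exact lt_irrefl _ hij
      rw [Set.disjoint_left]
      rintro x (hx | hx) (hy | hy)
      · exact Set.disjoint_left.1 (hdisj i.2 j.2 (fun h => hne (Subtype.ext h))) hx hy
      · exact hy.2 (Or.inl (mem_iUnion.2 ⟨i, hx⟩))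
      · exact hx.2 (Or.inl (mem_iUnion.2 ⟨j, hy⟩))
      · exact hy.2 (Or.inr (mem_iUnion.2 ⟨⟨i, hij⟩, hx.1⟩))
    intro i j hij
    rcases lt_or_gt_of_ne (fun h => hij (he h)) with h | h
    · exact key i j h
    · exact (key j i h).symm
  · exact (Metric.measure_closedBall_pos volume (i : Evec n) (hρpos i)).ne'
      (measure_mono_null (hBQ i) h0)
  · have h1 : ∫⁻ y in L i, ‖f y‖ₑ ≤ ENNReal.ofReal t * volume (L i) := by
      by_contra hc
      exact hρ2 i (huS i.2) (5 * ρ i) (by linarith [hρpos i])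
        ⟨by linarith [hρpos i], not_le.1 hc⟩
    refine (lintegral_mono_set (hQL i)).trans (h1.trans ?_)
    rw [hL5, ← mul_assoc, mul_comm (ENNReal.ofReal t)]
    exact mul_le_mul' le_rfl (measure_mono (hBQ i))
  · have h1 := (hρ i (huS i.2)).2.le
    rw [show 2 * (5 * ρ i) = 10 * ρ i by ring, volume_closedBall_mul _ (by norm_num) (hρpos i).le,
      mul_left_comm, show ENNReal.ofReal 10 = 10 by simp]
    exact mul_le_mul' le_rfl (h1.trans (lintegral_mono_set (hBQ i)))
  · filter_upwards [ae_norm_le_of_average_le hf t] with x hx hxQ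
    refine hx fun r hr => ?_
    by_contra hc
    have hxS : x ∈ S := ⟨r, hr, not_le.1 hc⟩
    obtain ⟨b, hb, hsub⟩ := hcov x hxS
    exact hxQ (hcovQ ⟨b, hb⟩ (hsub (Metric.mem_closedBall_self (hρ x hxS).1.le)))

/-- A (truncated) Calderón–Zygmund convolution kernel with constant `A`. -/
structure IsCZKernel {n : ℕ} (K : Evec n → ℝ) (A : ℝ) : Prop where
  continuous : Continuous K
  hasCompactSupport : HasCompactSupport K
  even : ∀ x, K (-x) = K x
  smooth : ∀ x y, 2 * ‖y‖ ≤ ‖x‖ → x ≠ 0 → |K (x - y) - K x| ≤ A * (‖y‖ * (‖x‖ ^ (n + 1))⁻¹)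
  sq_le : ∀ f : Evec n → ℝ, MemLp f (ENNReal.ofReal 2) →
    ∫⁻ x, ‖cv K f x‖ₑ ^ (2 : ℝ) ≤ ENNReal.ofReal A ^ (2 : ℝ) * ∫⁻ x, ‖f x‖ₑ ^ (2 : ℝ)

/-- The function `|x|^{-n-1}` outside the ball of radius two. -/
def tail (n : ℕ) : Evec n → ℝ := {x | 2 < ‖x‖}.indicator fun x => (‖x‖ ^ (n + 1))⁻¹

lemma measurable_tail (n : ℕ) : Measurable (tail n) :=
  Measurable.indicator (by fun_prop) (measurableSet_lt measurable_const measurable_norm)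

lemma integrable_tail (n : ℕ) : Integrable (tail n) := by
  have h := (integrable_one_add_norm (μ := (volume : Measure (Evec n))) (r := (n + 1 : ℕ))
    (by simp)).const_mul (2 ^ (n + 1))
  refine h.mono' (measurable_tail n).aestronglyMeasurable (Eventually.of_forall fun x => ?_)
  rw [tail, Real.rpow_neg (by positivity), Real.rpow_natCast]
  by_cases hx : 2 < ‖x‖
  · rw [indicator_of_mem (show x ∈ {x | 2 < ‖x‖} from hx), Real.norm_of_nonneg (by positivity),
      ← div_eq_mul_inv, ← one_div, div_le_div_iff₀ (by positivity) (by positivity), one_mul,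
      ← mul_pow]
    exact pow_le_pow_left₀ (by positivity) (by linarith) _
  · rw [indicator_of_notMem (show x ∉ {x | 2 < ‖x‖} from hx), norm_zero]
    positivity

lemma dil_tail {n : ℕ} {R : ℝ} (hR : 0 < R) {x : Evec n} (hx : 2 * R < ‖x‖) :
    dil R (tail n) x = R * (‖x‖ ^ (n + 1))⁻¹ := by
  have h1 : ‖R⁻¹ • x‖ = R⁻¹ * ‖x‖ := by
    rw [norm_smul, norm_inv, Real.norm_of_nonneg hR.le]
  have h2 : R⁻¹ • x ∈ {x : Evec n | 2 < ‖x‖} := by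
    rw [mem_ofPred_eq, h1, ← div_eq_inv_mul]
    exact (lt_div_iff₀ hR).2 hx
  have h3 : 0 < ‖x‖ := by linarith
  rw [dil, tail, indicator_of_mem h2, h1, mul_pow, inv_pow, inv_pow]
  field_simp
  ring

lemma lintegral_tail_le {n : ℕ} (c : Evec n) {R : ℝ} (hR : 0 < R) :
    ∫⁻ x in (Metric.closedBall c (2 * R))ᶜ, ENNReal.ofReal (R * (‖x - c‖ ^ (n + 1))⁻¹) ≤
      ∫⁻ x, ‖tail n x‖ₑ := by
  rw [← lintegral_dil (integrable_tail n) hR,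
    ← lintegral_sub_right_eq_self (fun x => ‖dil R (tail n) x‖ₑ) c]
  refine le_trans (setLIntegral_mono' Metric.isClosed_closedBall.measurableSet.compl
    fun x hx => ?_) (setLIntegral_le_lintegral _ _)
  rw [mem_compl_iff, mem_closedBall_iff_norm, not_le] at hx
  rw [dil_tail hR hx, Real.enorm_of_nonneg (by positivity)]

/-- Off the doubled balls, a singular integral of a sum of atoms is controlled in `L¹`. -/
lemma lintegral_cv_atoms_le {n : ℕ} {K : Evec n → ℝ} {A : ℝ} (hA : 0 ≤ A) (hK : IsCZKernel K A)
    {ι : Type*} [Countable ι] {c : ι → Evec n} {R : ι → ℝ} {Q : ι → Set (Evec n)}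
    (hR : ∀ i, 0 < R i) (hQm : ∀ i, MeasurableSet (Q i))
    (hQd : Pairwise (Function.onFun Disjoint Q)) (hQ : ∀ i, Q i ⊆ Metric.closedBall (c i) (R i))
    {b : Evec n → ℝ} (hb : Integrable b) (hb0 : ∀ x ∉ ⋃ i, Q i, b x = 0)
    (hmean : ∀ i, ∫ x in Q i, b x = 0) :
    ∫⁻ x in (⋃ i, Metric.closedBall (c i) (2 * R i))ᶜ, ‖cv K b x‖ₑ ≤
      ENNReal.ofReal A * (∫⁻ x, ‖tail n x‖ₑ) * ∫⁻ x, ‖b x‖ₑ := by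
  have hint : ∀ x, Integrable fun y => b y * K (x - y) := fun x =>
    cv_integrable hK.continuous hK.hasCompactSupport hb.locallyIntegrable x
  have hcv : ∀ x, HasSum (fun i => ∫ y in Q i, b y * K (x - y)) (cv K b x) := by
    intro x
    have h := hasSum_integral_iUnion hQm hQd (hint x).integrableOn
    rwa [setIntegral_eq_integral_of_forall_compl_eq_zero fun y hy => by
      rw [hb0 y hy, zero_mul]] at h
  have hpt : ∀ i, ∀ x ∈ (Metric.closedBall (c i) (2 * R i))ᶜ, ‖∫ y in Q i, b y * K (x - y)‖ₑ ≤
      (∫⁻ y in Q i, ‖b y‖ₑ) * ENNReal.ofReal (A * (R i * (‖x - c i‖ ^ (n + 1))⁻¹)) := by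
    intro i x hx
    rw [mem_compl_iff, mem_closedBall_iff_norm, not_le] at hx
    have h1 : ∫ y in Q i, b y * K (x - y) = ∫ y in Q i, b y * (K (x - y) - K (x - c i)) := by
      simp only [mul_sub]
      rw [integral_sub (hint x).integrableOn (hb.integrableOn.mul_const _), integral_mul_const,
        hmean, zero_mul, sub_zero]
    rw [h1, ← lintegral_mul_const'' _ hb.1.enorm.restrict]
    refine (enorm_integral_le_lintegral_enorm _).trans
      (setLIntegral_mono' (hQm i) fun y hy => ?_)
    rw [enorm_mul]
    refine mul_le_mul' le_rfl ?_
    have hy' := hQ i hy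
    rw [mem_closedBall_iff_norm] at hy'
    have hne : x - c i ≠ 0 := fun h => by
      rw [h, norm_zero] at hx; linarith [hR i]
    have h2 := hK.smooth (x - c i) (y - c i) (by linarith) hne
    rw [sub_sub_sub_cancel_right] at h2
    rw [Real.enorm_eq_ofReal_abs]
    refine ENNReal.ofReal_le_ofReal (h2.trans ?_)
    gcongr
  calc ∫⁻ x in (⋃ i, Metric.closedBall (c i) (2 * R i))ᶜ, ‖cv K b x‖ₑ
      ≤ ∫⁻ x in (⋃ i, Metric.closedBall (c i) (2 * R i))ᶜ,
          ∑' i, ‖∫ y in Q i, b y * K (x - y)‖ₑ :=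
        lintegral_mono fun x => by
          rw [← (hcv x).tsum_eq]; exact enorm_tsum_le_tsum_enorm
    _ ≤ ∫⁻ x in (⋃ i, Metric.closedBall (c i) (2 * R i))ᶜ, ∑' i, (∫⁻ y in Q i, ‖b y‖ₑ) *
          ENNReal.ofReal (A * (R i * (‖x - c i‖ ^ (n + 1))⁻¹)) := by
        refine setLIntegral_mono' (MeasurableSet.iUnion fun i =>
          Metric.isClosed_closedBall.measurableSet).compl fun x hx => ?_
        exact ENNReal.tsum_le_tsum fun i => hpt i x fun h => hx (mem_iUnion.2 ⟨i, h⟩)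
    _ = ∑' i, ∫⁻ x in (⋃ i, Metric.closedBall (c i) (2 * R i))ᶜ, (∫⁻ y in Q i, ‖b y‖ₑ) *
          ENNReal.ofReal (A * (R i * (‖x - c i‖ ^ (n + 1))⁻¹)) :=
        lintegral_tsum fun i => by fun_prop
    _ ≤ ∑' i, ENNReal.ofReal A * (∫⁻ x, ‖tail n x‖ₑ) * ∫⁻ y in Q i, ‖b y‖ₑ := by
        refine ENNReal.tsum_le_tsum fun i => ?_
        refine (lintegral_mono_set (t := (Metric.closedBall (c i) (2 * R i))ᶜ)
          (compl_subset_compl.2 (subset_iUnion (fun i => Metric.closedBall (c i) (2 * R i)) i))).trans ?_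
        simp only [ENNReal.ofReal_mul hA]
        rw [lintegral_const_mul _ (by fun_prop), lintegral_const_mul _ (by fun_prop), mul_comm]
        exact mul_le_mul' (mul_le_mul' le_rfl (lintegral_tail_le (c i) (hR i))) le_rfl
    _ = ENNReal.ofReal A * (∫⁻ x, ‖tail n x‖ₑ) * ∫⁻ x in ⋃ i, Q i, ‖b x‖ₑ := by
        rw [ENNReal.tsum_mul_left, lintegral_iUnion hQm hQd]
    _ ≤ _ := mul_le_mul' le_rfl (setLIntegral_le_lintegral _ _)

/-- Given disjoint sets of positive finite measure, replace `f` by its averages on these sets. -/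
lemma exists_averaging {n : ℕ} {ι : Type*} [Countable ι] {Q : ι → Set (Evec n)}
    (hQm : ∀ i, MeasurableSet (Q i)) (hQd : Pairwise (Function.onFun Disjoint Q))
    (hQ0 : ∀ i, volume (Q i) ≠ 0) (hQt : ∀ i, volume (Q i) ≠ ⊤)
    {f : Evec n → ℝ} (hf : Integrable f) :
    ∃ g : Evec n → ℝ, Integrable g ∧ ∫⁻ x, ‖g x‖ₑ ≤ ∫⁻ x, ‖f x‖ₑ ∧
      (∀ x ∉ ⋃ i, Q i, g x = f x) ∧ (∀ i, ∫ x in Q i, (f x - g x) = 0) ∧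
      ∀ i, ∀ x ∈ Q i, ‖g x‖ₑ ≤ (∫⁻ y in Q i, ‖f y‖ₑ) / volume (Q i) := by
  classical
  set U : Set (Evec n) := ⋃ i, Q i with hU
  have hUm : MeasurableSet U := MeasurableSet.iUnion hQm
  set a : ι → ℝ := fun i => (volume.real (Q i))⁻¹ * ∫ y in Q i, f y with ha
  set g : Evec n → ℝ := fun x => if h : ∃ i, x ∈ Q i then a h.choose else f x with hg
  have hgQ : ∀ i, ∀ x ∈ Q i, g x = a i := by
    intro i x hx
    have h : ∃ i, x ∈ Q i := ⟨i, hx⟩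
    have : h.choose = i := by
      by_contra hne
      exact Set.disjoint_left.1 (hQd hne) h.choose_spec hx
    rw [hg]
    simp only [dif_pos h, this]
  have hgU : ∀ x ∉ U, g x = f x := by
    intro x hx
    rw [hg]
    exact dif_neg fun ⟨i, hi⟩ => hx (mem_iUnion.2 ⟨i, hi⟩)
  have hreal : ∀ i, 0 < volume.real (Q i) := fun i => ENNReal.toReal_pos (hQ0 i) (hQt i)
  have hae : ∀ i, ‖a i‖ₑ ≤ (∫⁻ y in Q i, ‖f y‖ₑ) / volume (Q i) := by
    intro i
    rw [ha, enorm_mul, Real.enorm_of_nonneg (by positivity), ENNReal.ofReal_inv_of_pos (hreal i),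
      ofReal_measureReal (hQt i), mul_comm, ← div_eq_mul_inv]
    exact ENNReal.div_le_div_right (enorm_integral_le_lintegral_enorm _) _
  have hmeas : AEStronglyMeasurable g := by
    have h1 : AEStronglyMeasurable g (volume.restrict U) := by
      rw [hU, aestronglyMeasurable_iUnion_iff]
      intro i
      refine (aestronglyMeasurable_const (b := a i)).congr ?_
      filter_upwards [ae_restrict_mem (hQm i)] with x hx using (hgQ i x hx).symm
    have h2 : AEStronglyMeasurable g (volume.restrict Uᶜ) := by
      refine hf.1.restrict.congr ?_
      filter_upwards [ae_restrict_mem hUm.compl] with x hx using (hgU x hx).symm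
    have := aestronglyMeasurable_union_iff.2 ⟨h1, h2⟩
    rwa [union_compl_self, Measure.restrict_univ] at this
  have hgi : ∀ i, ∫⁻ x in Q i, ‖g x‖ₑ ≤ ∫⁻ x in Q i, ‖f x‖ₑ := by
    intro i
    rw [setLIntegral_congr_fun (hQm i) (g := fun _ => ‖a i‖ₑ) fun x hx => by rw [hgQ i x hx],
      setLIntegral_const]
    refine (mul_le_mul' (hae i) le_rfl).trans_eq ?_
    exact ENNReal.div_mul_cancel (hQ0 i) (hQt i)
  have hle : ∫⁻ x, ‖g x‖ₑ ≤ ∫⁻ x, ‖f x‖ₑ := by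
    rw [← lintegral_add_compl _ hUm, ← lintegral_add_compl (fun x => ‖f x‖ₑ) hUm]
    refine add_le_add ?_ (setLIntegral_congr_fun hUm.compl fun x hx => by rw [hgU x hx]).le
    rw [hU, lintegral_iUnion hQm hQd, lintegral_iUnion hQm hQd]
    exact ENNReal.tsum_le_tsum hgi
  have hgint : Integrable g := ⟨hmeas, hle.trans_lt hf.2⟩
  refine ⟨g, hgint, hle, hgU, fun i => ?_, fun i x hx => (hgQ i x hx).symm ▸ hae i⟩
  rw [integral_sub hf.integrableOn hgint.integrableOn,
    setIntegral_congr_fun (hQm i) (g := fun _ => a i) fun x hx => hgQ i x hx, setIntegral_const,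
    ha, smul_eq_mul, mul_inv_cancel_left₀ (hreal i).ne', sub_self]

/-- The weak type `(1,1)` estimate for Calderón–Zygmund kernels. -/
lemma exists_weak_type_one (n : ℕ) (hn : 0 < n) {A : ℝ} (hA : 0 ≤ A) :
    ∃ C : ℝ≥0∞, C ≠ ⊤ ∧ ∀ K : Evec n → ℝ, IsCZKernel K A → ∀ f : Evec n → ℝ, Integrable f →
      ∀ t : ℝ, 0 < t → ENNReal.ofReal t * volume {x | ENNReal.ofReal t < ‖cv K f x‖ₑ} ≤
        C * ∫⁻ x, ‖f x‖ₑ := by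
  have hJ : ∫⁻ x, ‖tail n x‖ₑ ≠ ⊤ := (integrable_tail n).2.ne
  refine ⟨4 * ENNReal.ofReal A ^ (2 : ℝ) * 5 ^ n + 10 ^ n +
    4 * (ENNReal.ofReal A * ∫⁻ x, ‖tail n x‖ₑ), by finiteness, fun K hK f hf t ht => ?_⟩
  obtain ⟨u, r, Q, hu, hr, hQm, hQd, hQs, hQ0, hQf, hQv, hae⟩ := exists_cz_cover hn hf ht
  have hQt : ∀ i, volume (Q i) ≠ ⊤ := fun i =>
    ((measure_mono (hQs i)).trans_lt measure_closedBall_lt_top).ne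
  obtain ⟨g, hg, hgle, hgf, hmean, hgQ⟩ := exists_averaging hQm hQd hQ0 hQt hf
  obtain ⟨τ, hτ⟩ : ∃ τ : ℝ≥0∞, τ = ENNReal.ofReal t := ⟨_, rfl⟩
  have hτ0 : τ ≠ 0 := by rw [hτ]; simpa using ht
  have hτt : τ ≠ ⊤ := by rw [hτ]; finiteness
  rw [← hτ] at hQf hQv hae ⊢
  obtain ⟨F, hF⟩ : ∃ F : ℝ≥0∞, F = ∫⁻ x, ‖f x‖ₑ := ⟨_, rfl⟩
  have hgb : ∀ᵐ x, ‖g x‖ₑ ≤ 5 ^ n * τ := by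
    filter_upwards [hae] with x hx
    by_cases h : x ∈ ⋃ i, Q i
    · obtain ⟨i, hi⟩ := mem_iUnion.1 h
      exact (hgQ i x hi).trans (ENNReal.div_le_of_le_mul (hQf i))
    · rw [hgf x h]
      refine (hx h).trans (le_mul_of_one_le_left' ?_)
      exact one_le_pow₀ (by norm_num)
  have hg2 : ∫⁻ x, ‖g x‖ₑ ^ (2 : ℝ) ≤ 5 ^ n * τ * F := by
    calc ∫⁻ x, ‖g x‖ₑ ^ (2 : ℝ) ≤ ∫⁻ x, 5 ^ n * τ * ‖g x‖ₑ := by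
          refine lintegral_mono_ae ?_
          filter_upwards [hgb] with x hx
          rw [ENNReal.rpow_two, pow_two]
          exact mul_le_mul' hx le_rfl
      _ = 5 ^ n * τ * ∫⁻ x, ‖g x‖ₑ := lintegral_const_mul'' _ hg.1.enorm
      _ ≤ _ := mul_le_mul' le_rfl (hF ▸ hgle)
  have hFt : F ≠ ⊤ := hF ▸ hf.2.ne
  have hgm : MemLp g (ENNReal.ofReal 2) := by
    refine ⟨hg.1, ?_⟩
    rw [eLpNorm_ofReal g two_pos]
    refine ENNReal.rpow_lt_top_of_nonneg (by norm_num) (hg2.trans_lt ?_).ne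
    finiteness
  set b : Evec n → ℝ := fun x => f x - g x with hb
  have hbi : Integrable b := hf.sub hg
  have hble : ∫⁻ x, ‖b x‖ₑ ≤ 2 * F := by
    calc ∫⁻ x, ‖b x‖ₑ ≤ ∫⁻ x, (‖f x‖ₑ + ‖g x‖ₑ) := lintegral_mono fun x => enorm_sub_le
      _ = (∫⁻ x, ‖f x‖ₑ) + ∫⁻ x, ‖g x‖ₑ := lintegral_add_left' hf.1.enorm _
      _ ≤ 2 * F := by rw [two_mul, hF]; exact add_le_add le_rfl hgle
  have hbad := lintegral_cv_atoms_le hA hK (c := fun i : u => (i : Evec n)) (R := fun i => r i)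
    hr hQm hQd hQs hbi (fun x hx => by rw [hb]; simp only [hgf x hx, sub_self]) hmean
  set S : Set (Evec n) := ⋃ i : u, Metric.closedBall (i : Evec n) (2 * r i) with hS
  have hSm : MeasurableSet S :=
    MeasurableSet.iUnion fun i => Metric.isClosed_closedBall.measurableSet
  have hfgb : ∀ x, cv K f x = cv K g x + cv K b x := by
    intro x
    rw [hb, cv_sub hK.continuous hK.hasCompactSupport hf.locallyIntegrable hg.locallyIntegrable]
    ring
  have hcg : Continuous (cv K g) :=
    cv_continuous hK.continuous hK.hasCompactSupport hg.locallyIntegrable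
  have hcb : Continuous (cv K b) :=
    cv_continuous hK.continuous hK.hasCompactSupport hbi.locallyIntegrable
  have hsub : {x | τ < ‖cv K f x‖ₑ} ⊆
      {x | (τ / 2) ^ (2 : ℝ) ≤ ‖cv K g x‖ₑ ^ (2 : ℝ)} ∪ (S ∪ ({x | τ / 2 ≤ ‖cv K b x‖ₑ} ∩ Sᶜ)) := by
    intro x hx
    by_contra hc
    simp only [mem_union, mem_inter_iff, not_or, not_and, mem_compl_iff, not_not] at hc
    obtain ⟨h1, h2, h3⟩ := hc
    have h4 : ‖cv K g x‖ₑ < τ / 2 := by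
      by_contra h
      exact h1 (ENNReal.rpow_le_rpow (not_lt.1 h) two_pos.le)
    have h5 : ‖cv K b x‖ₑ < τ / 2 := by
      by_contra h
      exact h2 (h3 (not_lt.1 h))
    have h6 : ‖cv K f x‖ₑ ≤ τ := by
      rw [hfgb, ← ENNReal.add_halves τ]
      exact (enorm_add_le _ _).trans (add_le_add h4.le h5.le)
    exact absurd hx (not_lt.2 h6)
  have e1 : τ * volume {x | (τ / 2) ^ (2 : ℝ) ≤ ‖cv K g x‖ₑ ^ (2 : ℝ)} ≤
      4 * ENNReal.ofReal A ^ (2 : ℝ) * 5 ^ n * F := by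
    have h1 := (mul_meas_ge_le_lintegral₀ (μ := volume) (f := fun x => ‖cv K g x‖ₑ ^ (2 : ℝ))
      (by fun_prop) ((τ / 2) ^ (2 : ℝ))).trans ((hK.sq_le g hgm).trans (mul_le_mul' le_rfl hg2))
    have hdp : (τ / 2) ^ (2 : ℝ) = τ ^ 2 / 2 ^ 2 := by
      rw [ENNReal.div_rpow_of_nonneg _ _ two_pos.le, ENNReal.rpow_two, ENNReal.rpow_two]
    have h2 : τ * (τ * volume {x | (τ / 2) ^ (2 : ℝ) ≤ ‖cv K g x‖ₑ ^ (2 : ℝ)}) ≤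
        τ * (4 * ENNReal.ofReal A ^ (2 : ℝ) * 5 ^ n * F) := by
      calc _ = 4 * (τ ^ 2 / 2 ^ 2 * volume {x | (τ / 2) ^ (2 : ℝ) ≤ ‖cv K g x‖ₑ ^ (2 : ℝ)}) := by
            rw [← mul_assoc, ← mul_assoc, show (2 : ℝ≥0∞) ^ 2 = 4 by norm_num,
              ENNReal.mul_div_cancel (by norm_num) (by norm_num), pow_two]
        _ ≤ 4 * (ENNReal.ofReal A ^ (2 : ℝ) * (5 ^ n * τ * F)) := by
            refine mul_le_mul' le_rfl (le_trans (le_of_eq ?_) h1)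
            rw [← hdp]
        _ = _ := by ring
    exact (ENNReal.mul_le_mul_iff_right hτ0 hτt).1 h2
  have e2 : τ * volume S ≤ 10 ^ n * F := by
    calc τ * volume S ≤ τ * ∑' i : u, volume (Metric.closedBall (i : Evec n) (2 * r i)) :=
          mul_le_mul' le_rfl (measure_iUnion_le _)
      _ = ∑' i : u, τ * volume (Metric.closedBall (i : Evec n) (2 * r i)) :=
          ENNReal.tsum_mul_left.symm
      _ ≤ ∑' i : u, 10 ^ n * ∫⁻ y in Q i, ‖f y‖ₑ := ENNReal.tsum_le_tsum hQv
      _ = 10 ^ n * ∫⁻ y in ⋃ i, Q i, ‖f y‖ₑ := by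
          rw [ENNReal.tsum_mul_left, lintegral_iUnion hQm hQd]
      _ ≤ 10 ^ n * F := mul_le_mul' le_rfl (hF ▸ setLIntegral_le_lintegral _ _)
  have e3 : τ * volume ({x | τ / 2 ≤ ‖cv K b x‖ₑ} ∩ Sᶜ) ≤
      4 * (ENNReal.ofReal A * ∫⁻ x, ‖tail n x‖ₑ) * F := by
    have h1 := mul_meas_ge_le_lintegral₀ (μ := volume.restrict Sᶜ) (f := fun x => ‖cv K b x‖ₑ)
      (by fun_prop) (τ / 2)
    rw [Measure.restrict_apply' hSm.compl] at h1
    calc _ = 2 * (τ / 2 * volume ({x | τ / 2 ≤ ‖cv K b x‖ₑ} ∩ Sᶜ)) := by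
          rw [← mul_assoc, ENNReal.mul_div_cancel (by norm_num) (by norm_num)]
      _ ≤ 2 * (ENNReal.ofReal A * (∫⁻ x, ‖tail n x‖ₑ) * (2 * F)) :=
          mul_le_mul' le_rfl (h1.trans (hbad.trans (mul_le_mul' le_rfl hble)))
      _ = _ := by ring
  calc τ * volume {x | τ < ‖cv K f x‖ₑ}
      ≤ τ * (volume {x | (τ / 2) ^ (2 : ℝ) ≤ ‖cv K g x‖ₑ ^ (2 : ℝ)} + (volume S +
          volume ({x | τ / 2 ≤ ‖cv K b x‖ₑ} ∩ Sᶜ))) :=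
        mul_le_mul' le_rfl ((measure_mono hsub).trans ((measure_union_le _ _).trans
          (add_le_add le_rfl (measure_union_le _ _))))
    _ ≤ 4 * ENNReal.ofReal A ^ (2 : ℝ) * 5 ^ n * F + (10 ^ n * F +
          4 * (ENNReal.ofReal A * ∫⁻ x, ‖tail n x‖ₑ) * F) := by
        rw [mul_add, mul_add]
        exact add_le_add e1 (add_le_add e2 e3)
    _ = _ := by rw [← hF]; ring

/-- The second derivatives of the truncated kernels are uniformly Calderón–Zygmund. -/
lemma exists_isCZKernel_pd_kerD (n : ℕ) : ∃ A : ℝ, 0 ≤ A ∧ ∀ s r : ℝ, 0 < s → s ≤ r →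
    ∀ j l : Fin n, IsCZKernel (pd j (kerD s r l)) A := by
  obtain ⟨C, hC, h⟩ := exists_pd_kerD_smooth n
  have hi : Integrable (kerPhi (n := n)) :=
    kerPhi_contDiff.continuous.integrable_of_hasCompactSupport kerPhi_hasCompactSupport
  have hB : 2 * ∫⁻ x, ‖kerPhi (n := n) x‖ₑ ≠ ⊤ := ENNReal.mul_ne_top (by simp) hi.2.ne
  refine ⟨C + (2 * ∫⁻ x, ‖kerPhi (n := n) x‖ₑ).toReal, by positivity,
    fun s r hs hsr j l => ?_⟩
  have hr : 0 < r := hs.trans_le hsr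
  have hK := (pd_contDiff (kerD_contDiff (n := n) s r l) j).continuous
  have hc := pd_hasCompactSupport (kerD_hasCompactSupport (n := n) hs hsr l) j
  refine ⟨hK, hc, pd_kerD_neg hs hr j l, fun x y hxy hx => ?_, fun f hf => ?_⟩
  · refine (h s r hs hr j l x y hxy hx).trans ?_
    gcongr
    simp
  · have key := lintegral_cv_le_of_continuous hK hc one_lt_two hB (fun g hg hgc =>
      (lintegral_cv_pd_sq_le (kerD_contDiff (n := n) s r) (kerD_hasCompactSupport hs hsr)
        (pd_kerD_symm hs hr) hg hgc j l).trans ?_) hf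
    · refine key.trans (mul_le_mul' (ENNReal.rpow_le_rpow ?_ two_pos.le) le_rfl)
      rw [ENNReal.ofReal_add hC ENNReal.toReal_nonneg, ENNReal.ofReal_toReal hB]
      exact le_add_self
    · refine mul_le_mul' (ENNReal.rpow_le_rpow ?_ two_pos.le) le_rfl
      simp only [sum_pd_kerD hs hr]
      calc _ ≤ ∫⁻ x, (‖dil s (kerPhi (n := n)) x‖ₑ + ‖dil r (kerPhi (n := n)) x‖ₑ) :=
            lintegral_mono fun x => enorm_sub_le
        _ = _ := by
            rw [lintegral_add_left (dil_contDiff kerPhi_contDiff s).continuous.enorm.measurable,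
              lintegral_dil hi hs, lintegral_dil hi hr, two_mul]

lemma lintegral_superlevel_rpow {n : ℕ} {f : Evec n → ℝ} (hf : Measurable f) {p : ℝ} (hp : 1 < p) :
    ENNReal.ofReal (p - 1) * ∫⁻ t in Ioi (0 : ℝ), (∫⁻ x in {x | t < |f x|}, ‖f x‖ₑ) *
      ENNReal.ofReal (t ^ (p - 2)) = ∫⁻ x, ‖f x‖ₑ ^ p := by
  have h := lintegral_rpow_eq_lintegral_meas_lt_mul (volume.withDensity fun x => ‖f x‖ₑ)
    (f := fun x => |f x|) (Eventually.of_forall fun x => abs_nonneg _)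
    (by fun_prop) (p := p - 1) (by linarith)
  rw [lintegral_withDensity_eq_lintegral_mul _ hf.enorm (by fun_prop)] at h
  have e1 : ∀ x, ((fun x => ‖f x‖ₑ) * fun x => ENNReal.ofReal (|f x| ^ (p - 1))) x
      = ‖f x‖ₑ ^ p := by
    intro x
    rw [Pi.mul_apply, ← ENNReal.ofReal_rpow_of_nonneg (abs_nonneg _) (by linarith),
      ← Real.norm_eq_abs, ofReal_norm]
    nth_rewrite 1 [← ENNReal.rpow_one ‖f x‖ₑ]
    rw [← ENNReal.rpow_add_of_nonneg _ _ zero_le_one (by linarith)]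
    congr 1
    ring
  simp only [e1] at h
  rw [h]
  congr 1
  refine lintegral_congr fun t => ?_
  rw [withDensity_apply _ (measurableSet_lt measurable_const hf.abs)]
  ring_nf

lemma lintegral_Ici_rpow {a : ℝ} (ha : 0 < a) {p : ℝ} (hp : p < 2) :
    ∫⁻ t in Ici a, ENNReal.ofReal (t ^ (p - 3)) = ENNReal.ofReal ((2 - p)⁻¹ * a ^ (p - 2)) := by
  rw [setLIntegral_congr Ioi_ae_eq_Ici.symm, ← ofReal_integral_eq_lintegral_ofReal
    (integrableOn_Ioi_rpow_of_lt (by linarith) ha), integral_Ioi_rpow_of_lt (by linarith) ha]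
  · congr 1
    have : 2 - p ≠ 0 := by linarith
    have : p - 2 ≠ 0 := by linarith
    rw [show p - 3 + 1 = p - 2 by ring, inv_mul_eq_div, div_eq_div_iff ‹_› ‹_›]
    ring
  · exact (ae_restrict_mem measurableSet_Ioi).mono fun t ht =>
      Real.rpow_nonneg (ha.trans (mem_Ioi.1 ht)).le _

lemma lintegral_sublevel_rpow {n : ℕ} {f : Evec n → ℝ} (hf : Measurable f) {p : ℝ}
    (hp : p < 2) :
    ∫⁻ t in Ioi (0 : ℝ), (∫⁻ x in {x | |f x| ≤ t}, ‖f x‖ₑ ^ (2 : ℝ)) *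
      ENNReal.ofReal (t ^ (p - 3)) ≤ ENNReal.ofReal (2 - p)⁻¹ * ∫⁻ x, ‖f x‖ₑ ^ p := by
  have hS : ∀ t : ℝ, MeasurableSet {x | |f x| ≤ t} := fun t =>
    measurableSet_le hf.abs measurable_const
  have hm : Measurable (Function.uncurry fun (t : ℝ) (x : Evec n) =>
      {q : ℝ × Evec n | |f q.2| ≤ q.1}.indicator
        (fun q => ‖f q.2‖ₑ ^ (2 : ℝ) * ENNReal.ofReal (q.1 ^ (p - 3))) (t, x)) := by
    refine Measurable.indicator (by fun_prop) (measurableSet_le ?_ measurable_fst)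
    fun_prop
  calc _ = ∫⁻ t in Ioi (0 : ℝ), ∫⁻ x, {q : ℝ × Evec n | |f q.2| ≤ q.1}.indicator
        (fun q => ‖f q.2‖ₑ ^ (2 : ℝ) * ENNReal.ofReal (q.1 ^ (p - 3))) (t, x) := by
        refine lintegral_congr fun t => ?_
        rw [← lintegral_mul_const _ (by fun_prop), ← lintegral_indicator (hS t)]
        rfl
    _ = ∫⁻ x, ∫⁻ t in Ioi (0 : ℝ), {q : ℝ × Evec n | |f q.2| ≤ q.1}.indicator
        (fun q => ‖f q.2‖ₑ ^ (2 : ℝ) * ENNReal.ofReal (q.1 ^ (p - 3))) (t, x) :=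
        lintegral_lintegral_swap hm.aemeasurable
    _ ≤ ∫⁻ x, ENNReal.ofReal (2 - p)⁻¹ * ‖f x‖ₑ ^ p := by
        refine lintegral_mono fun x => ?_
        rcases eq_or_ne (f x) 0 with h0 | h0
        · refine le_of_eq_of_le (lintegral_eq_zero_of_ae_eq_zero
            (Eventually.of_forall fun t => ?_)) zero_le
          simp [indicator_apply, h0]
        · have hpos : 0 < |f x| := abs_pos.2 h0
          calc _ ≤ ∫⁻ t, {q : ℝ × Evec n | |f q.2| ≤ q.1}.indicator
                  (fun q => ‖f q.2‖ₑ ^ (2 : ℝ) * ENNReal.ofReal (q.1 ^ (p - 3))) (t, x) :=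
                setLIntegral_le_lintegral _ _
            _ = ∫⁻ t in Ici |f x|, ‖f x‖ₑ ^ (2 : ℝ) * ENNReal.ofReal (t ^ (p - 3)) := by
                rw [← lintegral_indicator measurableSet_Ici]
                rfl
            _ = _ := by
                rw [lintegral_const_mul _ (by fun_prop), lintegral_Ici_rpow hpos hp,
                  ENNReal.ofReal_mul (by rw [inv_nonneg]; linarith), mul_left_comm]
                congr 1
                rw [← ENNReal.ofReal_rpow_of_pos hpos, ← Real.norm_eq_abs, ofReal_norm,
                  ← ENNReal.rpow_add _ _ (by simpa using h0) enorm_ne_top]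
                congr 1
                ring
    _ = _ := lintegral_const_mul _ (by fun_prop)

/-- Interpolation: singular integrals are bounded on `L^p` for `1 < p < 2`. -/
lemma exists_strong_type_of_lt_two (n : ℕ) (hn : 0 < n) {A : ℝ} (hA : 0 ≤ A) {p : ℝ} (hp : 1 < p)
    (hp2 : p < 2) : ∃ C : ℝ≥0∞, C ≠ ⊤ ∧ ∀ K : Evec n → ℝ, IsCZKernel K A → ∀ f : Evec n → ℝ,
      Continuous f → HasCompactSupport f → ∫⁻ x, ‖cv K f x‖ₑ ^ p ≤ C * ∫⁻ x, ‖f x‖ₑ ^ p := by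
  obtain ⟨C, hC, hw⟩ := exists_weak_type_one n hn hA
  have hp1 : ENNReal.ofReal (p - 1) ≠ 0 := by simpa using hp
  refine ⟨2 ^ p * (ENNReal.ofReal p * (C * (ENNReal.ofReal (p - 1))⁻¹ +
    ENNReal.ofReal A ^ (2 : ℝ) * ENNReal.ofReal (2 - p)⁻¹)), ?_, fun K hK f hf hfc => ?_⟩
  · have : (ENNReal.ofReal (p - 1))⁻¹ ≠ ⊤ := ENNReal.inv_ne_top.2 hp1
    have h2 : (2 : ℝ≥0∞) ^ p ≠ ⊤ := ENNReal.rpow_ne_top_of_nonneg (by linarith) (by simp)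
    have h3 : ENNReal.ofReal A ^ (2 : ℝ) ≠ ⊤ :=
      ENNReal.rpow_ne_top_of_nonneg (by norm_num) (by simp)
    finiteness
  have hfi : Integrable f := hf.integrable_of_hasCompactSupport hfc
  have hT : Continuous (cv K f) := cv_continuous hK.continuous hK.hasCompactSupport
    hfi.locallyIntegrable
  have hcm := hf.measurable
  have key : ∀ t : ℝ, t ∈ Ioi (0 : ℝ) → volume {x | t < |cv K f x / 2|} *
      ENNReal.ofReal (t ^ (p - 1)) ≤
        C * ((∫⁻ x in {x | t < |f x|}, ‖f x‖ₑ) * ENNReal.ofReal (t ^ (p - 2))) +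
        ENNReal.ofReal A ^ (2 : ℝ) * ((∫⁻ x in {x | |f x| ≤ t}, ‖f x‖ₑ ^ (2 : ℝ)) *
          ENNReal.ofReal (t ^ (p - 3))) := by
    intro t ht
    rw [mem_Ioi] at ht
    have hS : MeasurableSet {x | t < |f x|} := measurableSet_lt measurable_const hcm.abs
    have hS2 : MeasurableSet {x | |f x| ≤ t} := measurableSet_le hcm.abs measurable_const
    obtain ⟨f1, h1⟩ : ∃ g, g = {x | t < |f x|}.indicator f := ⟨_, rfl⟩
    obtain ⟨f2, h2⟩ : ∃ g, g = {x | |f x| ≤ t}.indicator f := ⟨_, rfl⟩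
    have hf12 : ∀ x, f x = f1 x + f2 x := by
      intro x
      rw [h1, h2, indicator_apply, indicator_apply]
      by_cases h : t < |f x|
      · rw [if_pos (show x ∈ {x | t < |f x|} from h),
          if_neg (show x ∉ {x | |f x| ≤ t} from not_le.2 h), add_zero]
      · rw [if_neg (show x ∉ {x | t < |f x|} from h),
          if_pos (show x ∈ {x | |f x| ≤ t} from not_lt.1 h), zero_add]
    have hi1 : Integrable f1 := h1 ▸ hfi.indicator hS
    have hi2 : Integrable f2 := h2 ▸ hfi.indicator hS2
    have hm2 : MemLp f2 (ENNReal.ofReal 2) :=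
      h2 ▸ (hf.memLp_of_hasCompactSupport hfc).indicator hS2
    have hcv : ∀ x, cv K f x = cv K f1 x + cv K f2 x := by
      intro x
      rw [← cv_add hK.continuous hK.hasCompactSupport hi1.locallyIntegrable hi2.locallyIntegrable x]
      exact congrArg (fun g => cv K g x) (funext hf12)
    have w1 := hw K hK f1 hi1 t ht
    have w2 := (mul_meas_ge_le_lintegral₀ (μ := volume) (f := fun x => ‖cv K f2 x‖ₑ ^ (2 : ℝ))
      ((cv_continuous hK.continuous hK.hasCompactSupport
        hi2.locallyIntegrable).measurable.enorm.pow_const _).aemeasurable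
      (ENNReal.ofReal t ^ (2 : ℝ))).trans (hK.sq_le f2 hm2)
    have e1 : ∫⁻ x, ‖f1 x‖ₑ = ∫⁻ x in {x | t < |f x|}, ‖f x‖ₑ := by
      rw [h1, ← lintegral_indicator hS]
      simp only [enorm_indicator_eq_indicator_enorm]
    have e2 : ∫⁻ x, ‖f2 x‖ₑ ^ (2 : ℝ) = ∫⁻ x in {x | |f x| ≤ t}, ‖f x‖ₑ ^ (2 : ℝ) := by
      rw [h2, ← lintegral_indicator hS2]
      refine lintegral_congr fun x => ?_
      rw [indicator_apply, indicator_apply]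
      split_ifs <;> simp
    rw [e1] at w1
    rw [e2] at w2
    have hsub : {x | t < |cv K f x / 2|} ⊆ {x | ENNReal.ofReal t < ‖cv K f1 x‖ₑ} ∪
        {x | ENNReal.ofReal t ^ (2 : ℝ) ≤ ‖cv K f2 x‖ₑ ^ (2 : ℝ)} := by
      intro x hx
      rw [mem_ofPred_eq, abs_div, abs_two, lt_div_iff₀ two_pos, hcv] at hx
      by_cases h : t < |cv K f1 x|
      · left
        rw [mem_ofPred_eq, ← ofReal_norm]
        exact (ENNReal.ofReal_lt_ofReal_iff (ht.trans h)).2 h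
      · right
        refine ENNReal.rpow_le_rpow ?_ two_pos.le
        rw [← ofReal_norm]
        refine ENNReal.ofReal_le_ofReal ?_
        rw [Real.norm_eq_abs]
        linarith [abs_add_le (cv K f1 x) (cv K f2 x), not_lt.1 h]
    have p1 : ENNReal.ofReal (t ^ (p - 1)) = ENNReal.ofReal t * ENNReal.ofReal (t ^ (p - 2)) := by
      rw [← ENNReal.ofReal_mul ht.le]
      nth_rewrite 2 [← Real.rpow_one t]
      rw [← Real.rpow_add ht]
      congr 2
      ring
    have p2 : ENNReal.ofReal (t ^ (p - 1)) =
        ENNReal.ofReal t ^ (2 : ℝ) * ENNReal.ofReal (t ^ (p - 3)) := by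
      rw [ENNReal.ofReal_rpow_of_pos ht, ← ENNReal.ofReal_mul (by positivity), ← Real.rpow_add ht]
      congr 2
      ring
    calc _ ≤ (volume {x | ENNReal.ofReal t < ‖cv K f1 x‖ₑ} +
          volume {x | ENNReal.ofReal t ^ (2 : ℝ) ≤ ‖cv K f2 x‖ₑ ^ (2 : ℝ)}) *
            ENNReal.ofReal (t ^ (p - 1)) :=
          mul_le_mul' ((measure_mono hsub).trans (measure_union_le _ _)) le_rfl
      _ = (ENNReal.ofReal t * volume {x | ENNReal.ofReal t < ‖cv K f1 x‖ₑ}) *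
            ENNReal.ofReal (t ^ (p - 2)) + (ENNReal.ofReal t ^ (2 : ℝ) *
            volume {x | ENNReal.ofReal t ^ (2 : ℝ) ≤ ‖cv K f2 x‖ₑ ^ (2 : ℝ)}) *
            ENNReal.ofReal (t ^ (p - 3)) := by
          rw [add_mul]
          nth_rewrite 1 [p1]
          rw [p2]
          ring
      _ ≤ _ := by
          refine (add_le_add (mul_le_mul' w1 le_rfl) (mul_le_mul' w2 le_rfl)).trans_eq ?_
          ring
  have hlc := lintegral_rpow_eq_lintegral_meas_lt_mul volume (f := fun x => |cv K f x / 2|)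
    (Eventually.of_forall fun x => abs_nonneg _) (by fun_prop) (p := p) (by linarith)
  have e3 : ∀ x, ‖cv K f x‖ₑ ^ p = 2 ^ p * ENNReal.ofReal (|cv K f x / 2| ^ p) := by
    intro x
    rw [← ENNReal.ofReal_rpow_of_nonneg (abs_nonneg _) (by linarith),
      ← ENNReal.mul_rpow_of_nonneg _ _ (by linarith : 0 ≤ p), ← ofReal_norm,
      Real.norm_eq_abs, abs_div, abs_two, ← ENNReal.ofReal_ofNat 2,
      ← ENNReal.ofReal_mul two_pos.le, mul_div_cancel₀ _ two_ne_zero]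
  simp only [e3]
  rw [lintegral_const_mul _ (by fun_prop), hlc, mul_assoc, mul_assoc]
  refine mul_le_mul' le_rfl (mul_le_mul' le_rfl ((setLIntegral_mono' measurableSet_Ioi key).trans ?_))
  have hmt : Measurable fun t : ℝ => (∫⁻ x in {x | t < |f x|}, ‖f x‖ₑ) *
      ENNReal.ofReal (t ^ (p - 2)) := by
    refine Measurable.mul ?_ (by fun_prop)
    refine Antitone.measurable fun a b hab => lintegral_mono_set fun x hx => ?_
    exact hab.trans_lt hx
  rw [lintegral_add_left (hmt.const_mul _), lintegral_const_mul _ hmt, lintegral_const_mul' _ _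
    (ENNReal.rpow_ne_top_of_nonneg (by norm_num) (by simp)), add_mul]
  refine add_le_add (le_of_eq ?_) ?_
  · rw [mul_assoc, ← lintegral_superlevel_rpow hcm hp, ← mul_assoc _ (ENNReal.ofReal (p - 1)),
      ENNReal.inv_mul_cancel hp1 (by simp), one_mul]
  · rw [mul_assoc]
    exact mul_le_mul' le_rfl (lintegral_sublevel_rpow hcm hp2)

/-- Convolution with an even kernel is self-adjoint. -/
lemma integral_cv_mul {n : ℕ} {K f h : Evec n → ℝ} (hK : Continuous K)
    (hev : ∀ x, K (-x) = K x) (hf : Continuous f) (hfc : HasCompactSupport f) (hh : Continuous h)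
    (hhc : HasCompactSupport h) : ∫ x, cv K f x * h x = ∫ y, f y * cv K h y := by
  have hcont : Continuous (Function.uncurry fun x y : Evec n => f y * K (x - y) * h x) := by
    simp only [Function.uncurry_def]
    fun_prop
  have hcs : HasCompactSupport (Function.uncurry fun x y : Evec n => f y * K (x - y) * h x) := by
    refine HasCompactSupport.intro (K := tsupport h ×ˢ tsupport f)
      (hhc.isCompact.prod hfc.isCompact) fun q hq => ?_
    rw [mem_prod, not_and_or] at hq
    rcases hq with hq | hq
    · simp [Function.uncurry_def, image_eq_zero_of_notMem_tsupport hq]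
    · simp [Function.uncurry_def, image_eq_zero_of_notMem_tsupport hq]
  have hsw := integral_integral_swap_of_hasCompactSupport hcont hcs (μ := volume) (ν := volume)
  calc ∫ x, cv K f x * h x = ∫ x, ∫ y, f y * K (x - y) * h x := by
        refine integral_congr_ae (Eventually.of_forall fun x => ?_)
        exact (integral_mul_const _ _).symm
    _ = ∫ y, ∫ x, f y * K (x - y) * h x := hsw
    _ = _ := by
        refine integral_congr_ae (Eventually.of_forall fun y => ?_)
        simp only [cv]
        rw [← integral_const_mul]
        refine integral_congr_ae (Eventually.of_forall fun x => ?_)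
        simp only
        rw [← hev (x - y), neg_sub]
        ring

/-- **Calderón–Zygmund theorem**: singular integrals are bounded on `L^p` for `1 < p < ∞`. -/
theorem exists_strong_type (n : ℕ) (hn : 0 < n) {A : ℝ} (hA : 0 ≤ A) {p : ℝ} (hp : 1 < p) :
    ∃ C : ℝ≥0∞, C ≠ ⊤ ∧ ∀ K : Evec n → ℝ, IsCZKernel K A → ∀ f : Evec n → ℝ,
      MemLp f (ENNReal.ofReal p) → ∫⁻ x, ‖cv K f x‖ₑ ^ p ≤ C ^ p * ∫⁻ x, ‖f x‖ₑ ^ p := by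
  have hp0 : 0 < p := by linarith
  suffices H : ∃ C : ℝ≥0∞, C ≠ ⊤ ∧ ∀ K : Evec n → ℝ, IsCZKernel K A → ∀ f : Evec n → ℝ,
      Continuous f → HasCompactSupport f →
        ∫⁻ x, ‖cv K f x‖ₑ ^ p ≤ C ^ p * ∫⁻ x, ‖f x‖ₑ ^ p by
    obtain ⟨C, hC, h⟩ := H
    exact ⟨C, hC, fun K hK f hf => lintegral_cv_le_of_continuous hK.continuous
      hK.hasCompactSupport hp hC (h K hK) hf⟩
  rcases lt_trichotomy p 2 with h2 | rfl | h2
  · obtain ⟨C, hC, h⟩ := exists_strong_type_of_lt_two n hn hA hp h2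
    refine ⟨C ^ (1 / p), ENNReal.rpow_ne_top_of_nonneg (by positivity) hC,
      fun K hK f hf hfc => ?_⟩
    rw [← ENNReal.rpow_mul, one_div_mul_cancel hp0.ne', ENNReal.rpow_one]
    exact h K hK f hf hfc
  · exact ⟨ENNReal.ofReal A, ENNReal.ofReal_ne_top, fun K hK f hf hfc =>
      hK.sq_le f (hf.memLp_of_hasCompactSupport hfc)⟩
  · have hpq : p.HolderConjugate (p / (p - 1)) := Real.HolderConjugate.conjExponent hp
    obtain ⟨q, hq⟩ : ∃ q, q = p / (p - 1) := ⟨_, rfl⟩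
    rw [← hq] at hpq
    have hq1 : 1 < q := hpq.symm.lt
    have hq0 : 0 < q := by linarith
    have hq2 : q < 2 := by
      rw [hq, div_lt_iff₀ (by linarith)]
      linarith
    have hpq1 : (p - 1) * q = p := by
      rw [hq]
      exact mul_div_cancel₀ _ (by linarith)
    obtain ⟨C, hC, h⟩ := exists_strong_type_of_lt_two n hn hA hq1 hq2
    refine ⟨C ^ (1 / q), ENNReal.rpow_ne_top_of_nonneg (by positivity) hC,
      fun K hK f hf hfc => ?_⟩
    have hT : Continuous (cv K f) := cv_continuous hK.continuous hK.hasCompactSupport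
      hf.locallyIntegrable
    have hTc : HasCompactSupport (cv K f) := cv_hasCompactSupport hK.hasCompactSupport hfc
    obtain ⟨g, hg⟩ : ∃ g : Evec n → ℝ, g = fun x => |cv K f x| ^ (p - 2) * cv K f x := ⟨_, rfl⟩
    have hgc : Continuous g := by
      rw [hg]
      exact (hT.abs.rpow_const fun x => Or.inr (by linarith)).mul hT
    have hgcs : HasCompactSupport g := by
      rw [hg]
      exact hTc.mul_left
    have hTg : Continuous (cv K g) := cv_continuous hK.continuous hK.hasCompactSupport
      hgc.locallyIntegrable
    obtain ⟨I, hI⟩ : ∃ I, I = ∫⁻ x, ‖cv K f x‖ₑ ^ p := ⟨_, rfl⟩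
    obtain ⟨J, hJ⟩ : ∃ J, J = ∫⁻ x, ‖f x‖ₑ ^ p := ⟨_, rfl⟩
    have hIt : I ≠ ⊤ := by
      have := (hT.memLp_of_hasCompactSupport (p := ENNReal.ofReal p) (μ := volume) hTc).2
      rw [eLpNorm_ofReal _ hp0, ← hI] at this
      intro hc
      rw [hc, ENNReal.top_rpow_of_pos (by positivity)] at this
      exact lt_irrefl _ this
    have hgq : ∫⁻ x, ‖g x‖ₑ ^ q = I := by
      rw [hI]
      refine lintegral_congr fun x => ?_
      rw [hg, ← ofReal_norm, ← ofReal_norm, ENNReal.ofReal_rpow_of_nonneg (norm_nonneg _) hq0.le,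
        ENNReal.ofReal_rpow_of_nonneg (norm_nonneg _) hp0.le, norm_mul,
        Real.norm_of_nonneg (by positivity), Real.norm_eq_abs]
      congr 1
      nth_rewrite 2 [← Real.rpow_one |cv K f x|]
      rw [← Real.rpow_add_of_nonneg (abs_nonneg _) (by linarith) zero_le_one, ← Real.rpow_mul
        (abs_nonneg _)]
      congr 1
      linarith
    have hI2 : I = ENNReal.ofReal (∫ x, cv K f x * g x) := by
      rw [ofReal_integral_eq_lintegral_ofReal (f := fun x => cv K f x * g x)
        ((hT.mul hgc).integrable_of_hasCompactSupport hTc.mul_right), hI]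
      · refine lintegral_congr fun x => ?_
        rw [hg, ← ofReal_norm, ENNReal.ofReal_rpow_of_nonneg (norm_nonneg _) hp0.le,
          Real.norm_eq_abs]
        congr 1
        rw [mul_left_comm, ← abs_mul_abs_self, ← pow_two, ← Real.rpow_two,
          ← Real.rpow_add_of_nonneg (abs_nonneg _) (by linarith) zero_le_two]
        congr 1
        ring
      · refine Eventually.of_forall fun x => ?_
        simp only [hg, Pi.zero_apply]
        rw [mul_left_comm]
        exact mul_nonneg (by positivity) (mul_self_nonneg _)
    have h3 : I ≤ J ^ (1 / p) * (C * I) ^ (1 / q) := by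
      calc I = ENNReal.ofReal (∫ y, f y * cv K g y) := by
            rw [hI2, integral_cv_mul hK.continuous hK.even hf hfc hgc hgcs]
        _ ≤ ‖∫ y, f y * cv K g y‖ₑ := Real.ofReal_le_enorm _
        _ ≤ ∫⁻ y, ‖f y * cv K g y‖ₑ := enorm_integral_le_lintegral_enorm _
        _ = ∫⁻ y, ((fun y => ‖f y‖ₑ) * fun y => ‖cv K g y‖ₑ) y := by
            simp only [enorm_mul, Pi.mul_apply]
        _ ≤ _ := ENNReal.lintegral_mul_le_Lp_mul_Lq _ hpq (by fun_prop) (by fun_prop)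
        _ ≤ _ := by
            rw [← hJ]
            refine mul_le_mul' le_rfl (ENNReal.rpow_le_rpow ?_ (by positivity))
            rw [← hgq]
            exact h K hK g hgc hgcs
    rw [← hI, ← hJ]
    rcases eq_or_ne I 0 with h0 | h0
    · rw [h0]
      exact zero_le
    have h4 : I ^ (1 / p) * I ^ (1 / q) ≤ C ^ (1 / q) * J ^ (1 / p) * I ^ (1 / q) := by
      rw [← ENNReal.rpow_add _ _ h0 hIt, one_div, one_div, hpq.inv_add_inv_eq_one,
        ENNReal.rpow_one, ← one_div, ← one_div]
      refine h3.trans_eq ?_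
      rw [ENNReal.mul_rpow_of_nonneg _ _ (by positivity)]
      ring
    have h5 := (ENNReal.mul_le_mul_iff_left
      (by simp [ENNReal.rpow_eq_zero_iff, h0, hIt])
      (ENNReal.rpow_ne_top_of_nonneg (by positivity) hIt)).1 h4
    have h6 := ENNReal.rpow_le_rpow h5 hp0.le
    rwa [ENNReal.mul_rpow_of_nonneg _ _ hp0.le, ← ENNReal.rpow_mul I, ← ENNReal.rpow_mul J,
      one_div_mul_cancel hp0.ne', ENNReal.rpow_one, ENNReal.rpow_one] at h6

lemma tsupport_pd_subset {n : ℕ} (D : Evec n → ℝ) (l : Fin n) : tsupport (pd l D) ⊆ tsupport D :=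
  tsupport_fderiv_apply_subset ℝ _

/-- Integration by parts against a test function supported in `Ω`, for a function that is merely
differentiable in `Ω`. -/
lemma integral_indicator_pd_mul {n : ℕ} {Ω : Set (Evec n)} (hΩ : IsOpen Ω) {u D : Evec n → ℝ}
    (hu : DifferentiableOn ℝ u Ω) (hui : IntegrableOn u Ω) (l : Fin n)
    (hpu : IntegrableOn (pd l u) Ω) (hD : ContDiff ℝ ∞ D) (hDc : HasCompactSupport D)
    (hDΩ : tsupport D ⊆ Ω) :
    ∫ x, Ω.indicator (pd l u) x * D x = - ∫ x, Ω.indicator u x * pd l D x := by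
  have hpD := pd_contDiff hD l
  have e : ∀ (w E : Evec n → ℝ), tsupport E ⊆ Ω →
      (fun x => Ω.indicator w x * E x) = fun x => w x * E x := by
    intro w E hE
    ext x
    by_cases hx : x ∈ Ω
    · rw [indicator_of_mem hx]
    · rw [image_eq_zero_of_notMem_tsupport (fun h => hx (hE h)), mul_zero, mul_zero]
  have hi : ∀ (w E : Evec n → ℝ), IntegrableOn w Ω → Continuous E → HasCompactSupport E →
      tsupport E ⊆ Ω → Integrable fun x => w x * E x := by
    intro w E hw hE hEc hEΩ
    rw [← e w E hEΩ]
    obtain ⟨C, hC⟩ := hE.bounded_above_of_compact_support hEc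
    exact (hw.integrable_indicator hΩ.measurableSet).mul_bdd hE.aestronglyMeasurable
      (Eventually.of_forall hC)
  have hpDΩ := (tsupport_pd_subset D l).trans hDΩ
  have h := integral_mul_fderiv_eq_neg_fderiv_mul_of_integrable (μ := (volume : Measure (Evec n)))
    (f := u) (g := D) (v := EuclideanSpace.single l 1)
    (hi _ D hpu hD.continuous hDc hDΩ)
    (hi u _ hui hpD.continuous (pd_hasCompactSupport hDc l) hpDΩ)
    (hi u D hui hD.continuous hDc hDΩ)
    (fun x hx => (hu x (hDΩ hx)).differentiableAt (hΩ.mem_nhds (hDΩ hx)))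
    (fun x _ => hD.differentiable (by simp) x)
  rw [e _ _ hDΩ, e _ _ hpDΩ]
  exact (neg_eq_iff_eq_neg.2 h).symm

/-- The rows of the matrix field `f` are curl-free in `Ω`, in the sense of distributions. -/
def RowCurlFree {n : ℕ} (Ω : Set (Evec n)) (f : Fin n → Fin n → Evec n → ℝ) : Prop :=
  ∀ (i j l : Fin n) (D : Evec n → ℝ), ContDiff ℝ ∞ D → HasCompactSupport D → tsupport D ⊆ Ω →
    ∫ x, f i j x * pd l D x = ∫ x, f i l x * pd j D x

lemma rowCurlFree_of_grad {n : ℕ} {Ω : Set (Evec n)} (hΩ : IsOpen Ω) {v : Fin n → Evec n → ℝ}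
    (hv : ∀ i, DifferentiableOn ℝ (v i) Ω) (hvi : ∀ i, IntegrableOn (v i) Ω)
    (hpv : ∀ i j, IntegrableOn (pd j (v i)) Ω) :
    RowCurlFree Ω fun i j => Ω.indicator (pd j (v i)) := by
  intro i j l D hD hDc hDΩ
  have h : ∀ a b : Fin n, ∫ x, Ω.indicator (pd a (v i)) x * pd b D x =
      - ∫ x, Ω.indicator (v i) x * pd a (pd b D) x := fun a b =>
    integral_indicator_pd_mul hΩ (hv i) (hvi i) a (hpv i a) (pd_contDiff hD b)
      (pd_hasCompactSupport hDc b) ((tsupport_pd_subset D b).trans hDΩ)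
  rw [h, h, pd_comm hD]

/-- The symmetric part of a matrix field. -/
def symPart {n : ℕ} (f : Fin n → Fin n → Evec n → ℝ) (i j : Fin n) (x : Evec n) : ℝ :=
  (f i j x + f j i x) / 2

/-- A derivative of an entry of a row-curl-free field is a combination of derivatives of its
symmetric part. -/
lemma RowCurlFree.integral_mul_pd {n : ℕ} {Ω : Set (Evec n)} {f : Fin n → Fin n → Evec n → ℝ}
    (hf : RowCurlFree Ω f) (hfi : ∀ i j, Integrable (f i j)) (i j l : Fin n) {D : Evec n → ℝ}
    (hD : ContDiff ℝ ∞ D) (hDc : HasCompactSupport D) (hDΩ : tsupport D ⊆ Ω) :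
    ∫ x, f i j x * pd l D x = (∫ x, symPart f i j x * pd l D x) +
      (∫ x, symPart f i l x * pd j D x) - ∫ x, symPart f j l x * pd i D x := by
  have hi : ∀ a b c, Integrable fun x => f a b x * pd c D x := by
    intro a b c
    have hc := (pd_contDiff hD c).continuous
    obtain ⟨C, hC⟩ := hc.bounded_above_of_compact_support (pd_hasCompactSupport hDc c)
    exact (hfi a b).mul_bdd hc.aestronglyMeasurable (Eventually.of_forall hC)
  have hs : ∀ a b c, ∫ x, symPart f a b x * pd c D x =
      ((∫ x, f a b x * pd c D x) + ∫ x, f b a x * pd c D x) / 2 := by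
    intro a b c
    rw [← integral_add (hi a b c) (hi b a c), ← integral_div]
    refine integral_congr_ae (Eventually.of_forall fun x => ?_)
    simp only [symPart]
    ring
  rw [hs, hs, hs, hf i l j D hD hDc hDΩ, hf j i l D hD hDc hDΩ, hf l i j D hD hDc hDΩ]
  ring

lemma pd_comp_sub_left {n : ℕ} {K : Evec n → ℝ} (hK : Differentiable ℝ K) (l : Fin n)
    (x y : Evec n) : pd l (fun z => K (x - z)) y = - pd l K (x - y) := by
  have h : HasFDerivAt (fun z => K (x - z))
      ((fderiv ℝ K (x - y)).comp (-ContinuousLinearMap.id ℝ (Evec n))) y :=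
    (hK (x - y)).hasFDerivAt.comp y ((hasFDerivAt_id y).const_sub x)
  rw [pd, h.fderiv]
  simp [pd]

/-- The pointwise form of `RowCurlFree.integral_mul_pd` for convolutions. -/
lemma RowCurlFree.cv_pd {n : ℕ} {Ω : Set (Evec n)} {f : Fin n → Fin n → Evec n → ℝ}
    (hf : RowCurlFree Ω f) (hfi : ∀ i j, Integrable (f i j)) (i j l : Fin n) {K : Evec n → ℝ}
    (hK : ContDiff ℝ ∞ K) {r : ℝ} (hKr : ∀ x, r ≤ ‖x‖ → K x = 0) {x : Evec n}
    (hx : Metric.closedBall x r ⊆ Ω) :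
    cv (pd l K) (f i j) x = cv (pd l K) (symPart f i j) x + cv (pd j K) (symPart f i l) x -
      cv (pd i K) (symPart f j l) x := by
  have hD : ContDiff ℝ ∞ fun z => K (x - z) := hK.comp (contDiff_const.sub contDiff_id)
  have hsub : tsupport (fun z => K (x - z)) ⊆ Metric.closedBall x r := by
    refine closure_minimal (fun z hz => ?_) Metric.isClosed_closedBall
    by_contra h
    refine hz (hKr _ ?_)
    rw [Metric.mem_closedBall, not_le, dist_comm, dist_eq_norm] at h
    exact h.le
  have hDc : HasCompactSupport fun z => K (x - z) :=
    (isCompact_closedBall x r).of_isClosed_subset (isClosed_tsupport _) hsub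
  have h := hf.integral_mul_pd hfi i j l hD hDc (hsub.trans hx)
  simp only [pd_comp_sub_left (hK.differentiable (by simp)), mul_neg, integral_neg] at h
  simp only [cv]
  linarith

lemma dil_kerPhi_integrable {n : ℕ} (s : ℝ) (hs : 0 < s) : Integrable (dil s (kerPhi (n := n))) :=
  (dil_contDiff kerPhi_contDiff s).continuous.integrable_of_hasCompactSupport
    (hasCompactSupport_of_norm s fun _ => dil_eq_zero (fun _ => kerPhi_of_one_le) hs)

/-- The mollifications of an integrable function converge almost everywhere. -/
lemma ae_tendsto_cv_dil {n : ℕ} (hn : 0 < n) {f : Evec n → ℝ} (hf : Integrable f) {s : ℕ → ℝ}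
    (hs0 : ∀ m, 0 < s m) (hs : Tendsto s atTop (𝓝 0)) :
    ∀ᵐ x, Tendsto (fun m => cv (dil (s m) kerPhi) f x) atTop (𝓝 (f x)) := by
  obtain ⟨M, hM⟩ := (kerPhi_contDiff (n := n)).continuous.bounded_above_of_compact_support
    kerPhi_hasCompactSupport
  filter_upwards [IsUnifLocDoublingMeasure.ae_tendsto_average_norm_sub
    (μ := (volume : Measure (Evec n))) hf.locallyIntegrable 1] with x hx
  have h1 := hx (fun _ : ℕ => x) s (tendsto_nhdsWithin_iff.2 ⟨hs, Eventually.of_forall hs0⟩)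
    (Eventually.of_forall fun m => Metric.mem_closedBall_self (by simpa using (hs0 m).le))
  have h2 := h1.const_mul (M * (volume : Measure (Evec n)).real (Metric.closedBall 0 1))
  rw [mul_zero] at h2
  refine tendsto_iff_norm_sub_tendsto_zero.2 (squeeze_zero (fun _ => norm_nonneg _)
    (fun m => ?_) h2)
  have hsm := hs0 m
  have hKi := dil_kerPhi_integrable (n := n) (s m) hsm
  have hKc := (dil_contDiff (kerPhi_contDiff (n := n)) (s m)).continuous
  have hcs : HasCompactSupport (dil (s m) (kerPhi (n := n))) :=
    hasCompactSupport_of_norm (s m) fun _ => dil_eq_zero (fun _ => kerPhi_of_one_le) hsm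
  have e1 : cv (dil (s m) kerPhi) f x - f x =
      ∫ y, (f y - f x) * dil (s m) kerPhi (x - y) := by
    have : ∫ y, dil (s m) kerPhi (x - y) = 1 := by
      rw [integral_sub_left_eq_self (fun y => dil (s m) kerPhi y), integral_dil _ hsm,
        integral_kerPhi hn]
    simp only [sub_mul]
    rw [integral_sub (cv_integrable hKc hcs hf.locallyIntegrable x)
      ((hKi.comp_sub_left x).const_mul _), integral_const_mul, this, mul_one, cv]
  have hb : ∀ y, ‖(f y - f x) * dil (s m) kerPhi (x - y)‖ ≤
      (Metric.closedBall x (s m)).indicator (fun y => (s m)⁻¹ ^ n * M * ‖f y - f x‖) y := by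
    intro y
    by_cases hy : y ∈ Metric.closedBall x (s m)
    · rw [indicator_of_mem hy, norm_mul, mul_comm, dil, norm_mul,
        Real.norm_of_nonneg (by positivity)]
      gcongr
      exact hM _
    · rw [indicator_of_notMem hy, dil_eq_zero (fun _ => kerPhi_of_one_le) hsm, mul_zero, norm_zero]
      rw [Metric.mem_closedBall, not_le, dist_comm, dist_eq_norm] at hy
      exact hy.le
  have hint : IntegrableOn (fun y => ‖f y - f x‖) (Metric.closedBall x (s m)) :=
    (hf.integrableOn.sub (integrableOn_const measure_closedBall_lt_top.ne)).norm
  have hint' : IntegrableOn (fun y => (s m)⁻¹ ^ n * M * ‖f y - f x‖) (Metric.closedBall x (s m)) :=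
    Integrable.const_mul hint _
  rw [e1]
  refine (norm_integral_le_of_norm_le (IntegrableOn.integrable_indicator hint'
    Metric.isClosed_closedBall.measurableSet) (Eventually.of_forall hb)).trans_eq ?_
  rw [integral_indicator Metric.isClosed_closedBall.measurableSet, integral_const_mul,
    setAverage_eq, smul_eq_mul]
  have hv : (volume : Measure (Evec n)).real (Metric.closedBall x (s m)) =
      s m ^ n * (volume : Measure (Evec n)).real (Metric.closedBall 0 1) := by
    rw [measureReal_def, measureReal_def, ← mul_one (s m), volume_closedBall_mul x hsm.le
      zero_le_one, ENNReal.toReal_mul, ENNReal.toReal_pow, ENNReal.toReal_ofReal hsm.le,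
      volume_closedBall_eq x zero_le_one, volume_closedBall_eq 0 zero_le_one, mul_one]
  have hv0 : (volume : Measure (Evec n)).real (Metric.closedBall 0 1) ≠ 0 := by
    rw [measureReal_def]
    exact (ENNReal.toReal_pos (Metric.measure_closedBall_pos _ _ one_pos).ne'
      measure_closedBall_lt_top.ne).ne'
  rw [hv, mul_inv, inv_pow]
  field_simp

lemma pd_eq_zero_of_norm {n : ℕ} {K : Evec n → ℝ} {r : ℝ} (h : ∀ x, r ≤ ‖x‖ → K x = 0) (l : Fin n)
    {x : Evec n} (hx : r < ‖x‖) : pd l K x = 0 := by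
  have : K =ᶠ[𝓝 x] fun _ => 0 := by
    filter_upwards [continuous_norm.continuousAt.eventually (lt_mem_nhds hx)] with y hy
    exact h y (le_of_lt hy)
  rw [pd, this.fderiv_eq]
  simp

lemma cv_indicator {n : ℕ} {K : Evec n → ℝ} {r : ℝ} (hK : ∀ x, r < ‖x‖ → K x = 0) (f : Evec n → ℝ)
    {S : Set (Evec n)} {x : Evec n} (hx : Metric.closedBall x r ⊆ S) :
    cv K (S.indicator f) x = cv K f x := by
  refine integral_congr_ae (Eventually.of_forall fun y => ?_)
  by_cases hy : y ∈ S
  · simp only [indicator_of_mem hy]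
  · have : y ∉ Metric.closedBall x r := fun h => hy (hx h)
    rw [Metric.mem_closedBall, not_le, dist_comm, dist_eq_norm] at this
    simp only [hK _ this, mul_zero]

/-- The `p`-energy of a matrix field over a set. -/
def energy {n : ℕ} (p : ℝ) (e : Fin n → Fin n → Evec n → ℝ) (S : Set (Evec n)) : ℝ≥0∞ :=
  ∑ a, ∑ b, ∫⁻ x in S, ‖e a b x‖ₑ ^ p

lemma lintegral_le_energy_of_sum_cv {n : ℕ} {p : ℝ} (hp : 1 < p)
    {e : Fin n → Fin n → Evec n → ℝ} (he : ∀ a b, MemLp (e a b) (ENNReal.ofReal p))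
    {ι : Type*} [Fintype ι] {K : ι → Evec n → ℝ} (a b : ι → Fin n) {B : ℝ≥0∞}
    (hKc : ∀ t, Continuous (K t)) (hKs : ∀ t, HasCompactSupport (K t))
    (hK : ∀ t (h : Evec n → ℝ), MemLp h (ENNReal.ofReal p) →
      ∫⁻ x, ‖cv (K t) h x‖ₑ ^ p ≤ B ^ p * ∫⁻ x, ‖h x‖ₑ ^ p)
    {r : ℝ} (hr : ∀ t x, r < ‖x‖ → K t x = 0) {L L' : Set (Evec n)} (hL : MeasurableSet L)
    (hL' : MeasurableSet L') (hLL : ∀ x ∈ L, Metric.closedBall x r ⊆ L') {F : Evec n → ℝ}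
    (hF : ∀ x ∈ L, ‖F x‖ₑ ≤ ∑ t, ‖cv (K t) (e (a t) (b t)) x‖ₑ) :
    ∫⁻ x in L, ‖F x‖ₑ ^ p ≤ (Fintype.card ι : ℝ≥0∞) ^ p * B ^ p * energy p e L' := by
  have hp0 : 0 < p := by linarith
  have h1p : (1 : ℝ≥0∞) ≤ ENNReal.ofReal p := by simpa using hp.le
  have hm : ∀ t, MemLp (L'.indicator (e (a t) (b t))) (ENNReal.ofReal p) := fun t =>
    (he _ _).indicator hL'
  have ht : ∀ t, ∫⁻ x, ‖cv (K t) (L'.indicator (e (a t) (b t))) x‖ₑ ^ p ≤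
      B ^ p * energy p e L' := by
    intro t
    refine (hK t _ (hm t)).trans (mul_le_mul' le_rfl ?_)
    calc _ = ∫⁻ x in L', ‖e (a t) (b t) x‖ₑ ^ p := by
          rw [← lintegral_indicator hL']
          refine lintegral_congr fun x => ?_
          by_cases hx : x ∈ L'
          · rw [indicator_of_mem hx, indicator_of_mem hx]
          · rw [indicator_of_notMem hx, indicator_of_notMem hx, enorm_zero,
              ENNReal.zero_rpow_of_pos hp0]
      _ ≤ ∑ b, ∫⁻ x in L', ‖e (a t) b x‖ₑ ^ p :=
          Finset.single_le_sum (f := fun b => ∫⁻ x in L', ‖e (a t) b x‖ₑ ^ p)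
            (fun _ _ => zero_le) (Finset.mem_univ _)
      _ ≤ _ := Finset.single_le_sum (f := fun a => ∑ b, ∫⁻ x in L', ‖e a b x‖ₑ ^ p)
            (fun _ _ => zero_le) (Finset.mem_univ _)
  calc ∫⁻ x in L, ‖F x‖ₑ ^ p ≤ ∫⁻ x in L, (Fintype.card ι : ℝ≥0∞) ^ (p - 1) *
        ∑ t, ‖cv (K t) (L'.indicator (e (a t) (b t))) x‖ₑ ^ p := by
        refine setLIntegral_mono' hL fun x hx => ?_
        refine (ENNReal.rpow_le_rpow (hF x hx) hp0.le).trans ?_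
        refine (ENNReal.rpow_sum_le_const_mul_sum_rpow _ _ hp.le).trans_eq ?_
        simp only [cv_indicator (hr _) _ (hLL x hx), Finset.card_univ]
    _ ≤ ∫⁻ x, (Fintype.card ι : ℝ≥0∞) ^ (p - 1) *
        ∑ t, ‖cv (K t) (L'.indicator (e (a t) (b t))) x‖ₑ ^ p := setLIntegral_le_lintegral _ _
    _ = (Fintype.card ι : ℝ≥0∞) ^ (p - 1) *
        ∑ t, ∫⁻ x, ‖cv (K t) (L'.indicator (e (a t) (b t))) x‖ₑ ^ p := by
        have hmeas : ∀ t, Measurable fun x =>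
            ‖cv (K t) (L'.indicator (e (a t) (b t))) x‖ₑ ^ p := fun t =>
          (cv_continuous (hKc t) (hKs t) ((hm t).locallyIntegrable h1p)).measurable.enorm.pow_const _
        rw [lintegral_const_mul _ (Finset.measurable_fun_sum _ fun t _ => hmeas t),
          lintegral_finsetSum _ fun t _ => hmeas t]
    _ ≤ (Fintype.card ι : ℝ≥0∞) ^ (p - 1) * ∑ _t : ι, B ^ p * energy p e L' :=
        mul_le_mul' le_rfl (Finset.sum_le_sum fun t _ => ht t)
    _ = _ := by
        rw [Finset.sum_const, Finset.card_univ, nsmul_eq_mul, ← mul_assoc, ← mul_assoc]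
        congr 2
        nth_rewrite 2 [← ENNReal.rpow_one (Fintype.card ι : ℝ≥0∞)]
        rw [← ENNReal.rpow_add_of_nonneg _ _ (by linarith) zero_le_one]
        congr 1
        ring

lemma cv_kernel_sum {n : ℕ} {ι : Type*} (s : Finset ι) {K : ι → Evec n → ℝ} {f : Evec n → ℝ}
    (hK : ∀ t, Continuous (K t)) (hc : ∀ t, HasCompactSupport (K t)) (hf : LocallyIntegrable f)
    (x : Evec n) : cv (fun y => ∑ t ∈ s, K t y) f x = ∑ t ∈ s, cv (K t) f x := by
  unfold cv
  rw [← integral_finsetSum s fun t _ => cv_integrable (hK t) (hc t) hf x]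
  simp only [Finset.mul_sum]

lemma cv_kernel_const_mul {n : ℕ} (c : ℝ) (K f : Evec n → ℝ) (x : Evec n) :
    cv (fun y => c * K y) f x = c * cv K f x := by
  unfold cv
  rw [← integral_const_mul]
  refine integral_congr_ae (Eventually.of_forall fun y => ?_)
  simp only
  ring

lemma enorm_add_sub_le (x y z : ℝ) : ‖x + y - z‖ₑ ≤ ‖x‖ₑ + ‖y‖ₑ + ‖z‖ₑ :=
  (enorm_sub_le (a := x + y) (b := z)).trans (add_le_add_left (enorm_add_le x y) _)

lemma symPart_integrable {n : ℕ} {f : Fin n → Fin n → Evec n → ℝ}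
    (hf : ∀ i j, Integrable (f i j)) (i j : Fin n) : Integrable (symPart f i j) :=
  ((hf i j).add (hf j i)).div_const 2

lemma symPart_memLp {n : ℕ} {f : Fin n → Fin n → Evec n → ℝ} {q : ℝ≥0∞}
    (hf : ∀ i j, MemLp (f i j) q) (i j : Fin n) : MemLp (symPart f i j) q := by
  have h : symPart f i j = fun x => (2 : ℝ)⁻¹ * (f i j + f j i) x := by
    ext x
    simp only [symPart, Pi.add_apply]
    ring
  rw [h]
  exact ((hf i j).add (hf j i)).const_mul _

/-- The difference between two mollifications of a row-curl-free field is controlled by its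
symmetric part. -/
lemma exists_lintegral_cv_dil_sub_le {n : ℕ} (hn : 0 < n) {p : ℝ} (hp : 1 < p) :
    ∃ C : ℝ≥0∞, C ≠ ⊤ ∧ ∀ (Ω L L' : Set (Evec n)) (f : Fin n → Fin n → Evec n → ℝ) (s r : ℝ),
      RowCurlFree Ω f → (∀ i j, Integrable (f i j)) →
      (∀ i j, MemLp (f i j) (ENNReal.ofReal p)) → MeasurableSet L → MeasurableSet L' →
      0 < s → s ≤ r → (∀ x ∈ L, Metric.closedBall x r ⊆ L') → L' ⊆ Ω → ∀ i j,
      ∫⁻ x in L, ‖cv (dil s kerPhi) (f i j) x - cv (dil r kerPhi) (f i j) x‖ₑ ^ p ≤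
        C * energy p (symPart f) L' := by
  obtain ⟨A, hA, hK⟩ := exists_isCZKernel_pd_kerD n
  obtain ⟨B, hB, hst⟩ := exists_strong_type n hn hA hp
  have hp0 : 0 < p := by linarith
  refine ⟨(Fintype.card (Fin n × Fin 3) : ℝ≥0∞) ^ p * B ^ p, by finiteness,
    fun Ω L L' f s r hf hfi hfp hL hL' hs hsr hLL hLΩ i j => ?_⟩
  have hr : 0 < r := hs.trans_le hsr
  have hd : ∀ t : ℝ, 0 < t → Continuous (dil t (kerPhi (n := n))) ∧
      HasCompactSupport (dil t (kerPhi (n := n))) := fun t ht =>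
    ⟨(dil_contDiff kerPhi_contDiff t).continuous,
      hasCompactSupport_of_norm t fun _ => dil_eq_zero (fun _ => kerPhi_of_one_le) ht⟩
  refine lintegral_le_energy_of_sum_cv hp (symPart_memLp hfp) (B := B) (r := r) (ι := Fin n × Fin 3)
    (K := fun t => pd (![t.1, j, i] t.2) (kerD s r t.1)) (fun t => ![i, i, j] t.2)
    (fun t => ![j, t.1, t.1] t.2) (fun t => (hK s r hs hsr _ _).continuous)
    (fun t => (hK s r hs hsr _ _).hasCompactSupport)
    (fun t h hh => hst _ (hK s r hs hsr _ _) h hh)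
    (fun t x hx => pd_eq_zero_of_norm (fun _ => kerD_of_le hs hsr _) _ hx) hL hL' hLL
    fun x hx => ?_
  have e : cv (dil s kerPhi) (f i j) x - cv (dil r kerPhi) (f i j) x =
      ∑ l, (cv (pd l (kerD s r l)) (symPart f i j) x + cv (pd j (kerD s r l)) (symPart f i l) x -
      cv (pd i (kerD s r l)) (symPart f j l) x) := by
    rw [← cv_kernel_sub (hd s hs).1 (hd s hs).2 (hd r hr).1 (hd r hr).2
      (hfi i j).locallyIntegrable]
    simp only [← sum_pd_kerD hs hr]
    rw [cv_kernel_sum _ (fun l => (hK s r hs hsr l l).continuous)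
      (fun l => (hK s r hs hsr l l).hasCompactSupport) (hfi i j).locallyIntegrable]
    exact Finset.sum_congr rfl fun l _ => hf.cv_pd hfi i j l (kerD_contDiff s r l)
      (fun _ => kerD_of_le hs hsr _) ((hLL x hx).trans hLΩ)
  rw [e, Fintype.sum_prod_type]
  refine (enorm_sum_le _ _).trans (Finset.sum_le_sum fun l _ => ?_)
  refine (enorm_add_sub_le _ _ _).trans_eq ?_
  simp [Fin.sum_univ_three]

/-- A row-curl-free field is close to its mollifications in terms of its symmetric part. -/
lemma exists_lintegral_sub_cv_dil_le {n : ℕ} (hn : 0 < n) {p : ℝ} (hp : 1 < p) :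
    ∃ C : ℝ≥0∞, C ≠ ⊤ ∧ ∀ (Ω L L' : Set (Evec n)) (f : Fin n → Fin n → Evec n → ℝ) (r : ℝ),
      RowCurlFree Ω f → (∀ i j, Integrable (f i j)) →
      (∀ i j, MemLp (f i j) (ENNReal.ofReal p)) → MeasurableSet L → MeasurableSet L' →
      0 < r → (∀ x ∈ L, Metric.closedBall x r ⊆ L') → L' ⊆ Ω → ∀ i j,
      ∫⁻ x in L, ‖f i j x - cv (dil r kerPhi) (f i j) x‖ₑ ^ p ≤
        C * energy p (symPart f) L' := by
  obtain ⟨C, hC, h⟩ := exists_lintegral_cv_dil_sub_le hn hp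
  refine ⟨C, hC, fun Ω L L' f r hf hfi hfp hL hL' hr hLL hLΩ i j => ?_⟩
  have hp0 : 0 < p := by linarith
  obtain ⟨s, hsdef⟩ : ∃ s : ℕ → ℝ, s = fun m : ℕ => r * (1 / ((m : ℝ) + 1)) := ⟨_, rfl⟩
  have hs0 : ∀ m, 0 < s m := fun m => by rw [hsdef]; positivity
  have hsr : ∀ m, s m ≤ r := fun m => by
    rw [hsdef]
    exact mul_le_of_le_one_right hr.le ((div_le_one (by positivity)).2 (by simp))
  have hs : Tendsto s atTop (𝓝 0) := by
    rw [hsdef, ← mul_zero r]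
    exact tendsto_one_div_add_atTop_nhds_zero_nat.const_mul r
  have hm : ∀ t : ℝ, 0 < t → Measurable (cv (dil t kerPhi) (f i j)) := fun t ht =>
    (cv_continuous (dil_contDiff kerPhi_contDiff t).continuous (hasCompactSupport_of_norm t fun _ =>
      dil_eq_zero (fun _ => kerPhi_of_one_le) ht) (hfi i j).locallyIntegrable).measurable
  calc ∫⁻ x in L, ‖f i j x - cv (dil r kerPhi) (f i j) x‖ₑ ^ p
      = ∫⁻ x in L, liminf (fun m => ‖cv (dil (s m) kerPhi) (f i j) x -
          cv (dil r kerPhi) (f i j) x‖ₑ ^ p) atTop := by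
        refine lintegral_congr_ae (ae_restrict_of_ae ?_)
        filter_upwards [ae_tendsto_cv_dil hn (hfi i j) hs0 hs] with x hx
        refine (Tendsto.liminf_eq ?_).symm
        exact ((ENNReal.continuous_rpow_const (y := p)).tendsto _).comp
          ((hx.sub_const _).enorm)
    _ ≤ liminf (fun m => ∫⁻ x in L, ‖cv (dil (s m) kerPhi) (f i j) x -
          cv (dil r kerPhi) (f i j) x‖ₑ ^ p) atTop :=
        lintegral_liminf_le fun m => ((hm _ (hs0 m)).sub (hm r hr)).enorm.pow_const _
    _ ≤ liminf (fun _ : ℕ => C * energy p (symPart f) L') atTop :=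
        liminf_le_liminf (Eventually.of_forall fun m =>
          h Ω L L' f (s m) r hf hfi hfp hL hL' (hs0 m) (hsr m) hLL hLΩ i j)
    _ = _ := liminf_const _

/-- The derivatives of the mollifications of a row-curl-free field are controlled by its symmetric
part. -/
lemma exists_lintegral_pd_cv_dil_le {n : ℕ} {p : ℝ} (hp : 1 < p) :
    ∃ C : ℝ≥0∞, C ≠ ⊤ ∧ ∀ (Ω L L' : Set (Evec n)) (f : Fin n → Fin n → Evec n → ℝ) (r : ℝ),
      RowCurlFree Ω f → (∀ i j, Integrable (f i j)) →
      (∀ i j, MemLp (f i j) (ENNReal.ofReal p)) → MeasurableSet L → MeasurableSet L' →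
      0 < r → (∀ x ∈ L, Metric.closedBall x r ⊆ L') → L' ⊆ Ω → ∀ i j l,
      ∫⁻ x in L, ‖r * pd l (cv (dil r kerPhi) (f i j)) x‖ₑ ^ p ≤
        C * energy p (symPart f) L' := by
  have hp0 : 0 < p := by linarith
  have hcd := fun d : Fin n => pd_contDiff (kerPhi_contDiff (n := n)) d
  have hcs := fun d : Fin n => pd_hasCompactSupport (kerPhi_hasCompactSupport (n := n)) d
  have hint : ∀ d : Fin n, Integrable (pd d (kerPhi (n := n))) := fun d =>
    (hcd d).continuous.integrable_of_hasCompactSupport (hcs d)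
  obtain ⟨B, hBdef⟩ : ∃ B : ℝ≥0∞, B = ∑ d : Fin n, ∫⁻ x, ‖pd d (kerPhi (n := n)) x‖ₑ := ⟨_, rfl⟩
  have hB : B ≠ ⊤ := hBdef ▸ (ENNReal.sum_lt_top.2 fun d _ => (hint d).2).ne
  refine ⟨(Fintype.card (Fin 3) : ℝ≥0∞) ^ p * B ^ p, by finiteness,
    fun Ω L L' f r hf hfi hfp hL hL' hr hLL hLΩ i j l => ?_⟩
  have hphi : Differentiable ℝ (kerPhi (n := n)) := kerPhi_contDiff.differentiable (by simp)
  have hdc := dil_contDiff (kerPhi_contDiff (n := n)) r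
  have hd0 : ∀ x : Evec n, r ≤ ‖x‖ → dil r kerPhi x = 0 := fun _ =>
    dil_eq_zero (fun _ => kerPhi_of_one_le) hr
  have hds : HasCompactSupport (dil r (kerPhi (n := n))) := hasCompactSupport_of_norm r hd0
  have hpd : ∀ d : Fin n, pd d (dil r (kerPhi (n := n))) = fun x => r⁻¹ * dil r (pd d kerPhi) x :=
    fun d => funext fun x => pd_dil hphi r d x
  have hpd' : ∀ d : Fin n, dil r (pd d (kerPhi (n := n))) = fun x => r * pd d (dil r kerPhi) x :=
    fun d => funext fun x => by rw [hpd, mul_inv_cancel_left₀ hr.ne']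
  have hKc : ∀ d : Fin n, Continuous (dil r (pd d (kerPhi (n := n)))) := fun d =>
    (dil_contDiff (hcd d) r).continuous
  refine lintegral_le_energy_of_sum_cv hp (symPart_memLp hfp) (B := B) (r := r) (ι := Fin 3)
    (K := fun t => dil r (pd (![l, j, i] t) kerPhi)) ![i, i, j] ![j, l, l] (fun t => hKc _)
    (fun t => ?_) (fun t h hh => ?_) (fun t x hx => ?_) hL hL' hLL fun x hx => ?_
  · rw [hpd']
    exact (pd_hasCompactSupport hds _).mul_left
  · refine (lintegral_cv_rpow_le (hKc _).measurable hh.1.aemeasurable hp).trans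
      (mul_le_mul' (ENNReal.rpow_le_rpow ?_ hp0.le) le_rfl)
    rw [lintegral_dil (hint _) hr, hBdef]
    exact Finset.single_le_sum (f := fun d => ∫⁻ x, ‖pd d (kerPhi (n := n)) x‖ₑ)
      (fun _ _ => zero_le) (Finset.mem_univ _)
  · simp only [hpd', pd_eq_zero_of_norm hd0 _ hx, mul_zero]
  · rw [pd_cv hdc hds (hfi i j).locallyIntegrable,
      hf.cv_pd hfi i j l hdc hd0 ((hLL x hx).trans hLΩ), mul_sub, mul_add]
    simp only [← cv_kernel_const_mul, ← hpd']
    refine (enorm_add_sub_le _ _ _).trans_eq ?_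
    simp [Fin.sum_univ_three]

lemma continuous_bdist {n : ℕ} (Ω : Set (Evec n)) : Continuous (bdist Ω) :=
  Metric.continuous_infDist_pt _

lemma bdist_le_add_dist {n : ℕ} (Ω : Set (Evec n)) (x y : Evec n) :
    bdist Ω x ≤ bdist Ω y + dist x y := Metric.infDist_le_infDist_add_dist

lemma closedBall_subset_of_lt_bdist {n : ℕ} {Ω : Set (Evec n)} (hΩ : IsOpen Ω) {x : Evec n}
    (hx : x ∈ Ω) {r : ℝ} (hr : 0 ≤ r) (h : r < bdist Ω x) : Metric.closedBall x r ⊆ Ω := by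
  by_contra hsub
  obtain ⟨z, hz⟩ := not_subset.1 hsub
  have hfr : ∀ w ∈ Metric.closedBall x r, w ∉ frontier Ω := fun w hw hwf => by
    have h1 : bdist Ω x ≤ dist x w := Metric.infDist_le_dist_of_mem hwf
    have h2 := Metric.mem_closedBall'.1 hw
    linarith
  have hcl : ∀ w ∈ Metric.closedBall x r, w ∈ closure Ω → w ∈ Ω := fun w hw hwc => by
    by_contra hwΩ
    exact hfr w hw (hΩ.frontier_eq ▸ ⟨hwc, hwΩ⟩)
  obtain ⟨w, -, hw1, hw2⟩ := (convex_closedBall x r).isPreconnected Ω (closure Ω)ᶜ hΩ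
    isClosed_closure.isOpen_compl (fun w hw => (em (w ∈ closure Ω)).imp (hcl w hw) id)
    ⟨x, Metric.mem_closedBall_self hr, hx⟩ ⟨z, hz.1, fun h => hz.2 (hcl z hz.1 h)⟩
  exact hw2 (subset_closure hw1)

lemma frontier_nonempty_of_isBoundedDomain {n : ℕ} (hn : 0 < n) {Ω : Set (Evec n)}
    (hΩ : IsBoundedDomain Ω) : (frontier Ω).Nonempty := by
  have : Nonempty (Fin n) := ⟨⟨0, hn⟩⟩
  by_contra h
  rw [not_nonempty_iff_eq_empty, ← isClopen_iff_frontier_eq_empty, isClopen_iff] at h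
  rcases h with h | h
  · exact hΩ.2.1.nonempty.ne_empty h
  · exact NormedSpace.unbounded_univ ℝ (Evec n) (h ▸ hΩ.2.2)

lemma bdist_pos {n : ℕ} (hn : 0 < n) {Ω : Set (Evec n)} (hΩ : IsBoundedDomain Ω) {x : Evec n}
    (hx : x ∈ Ω) : 0 < bdist Ω x := by
  refine (isClosed_frontier.notMem_iff_infDist_pos
    (frontier_nonempty_of_isBoundedDomain hn hΩ)).1 fun h => ?_
  rw [hΩ.1.frontier_eq] at h
  exact h.2 hx

lemma exists_bdist_lt {n : ℕ} (hn : 0 < n) {Ω : Set (Evec n)} (hΩ : IsBoundedDomain Ω) :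
    ∃ R : ℝ, 0 < R ∧ ∀ x ∈ Ω, bdist Ω x < R := by
  obtain ⟨z, hz⟩ := frontier_nonempty_of_isBoundedDomain hn hΩ
  obtain ⟨R, hR0, hR⟩ := hΩ.2.2.subset_ball_lt 0 z
  exact ⟨R, hR0, fun x hx => (Metric.infDist_le_dist_of_mem hz).trans_lt (hR hx)⟩

/-- A smooth cutoff equal to one where the distance to the boundary is well above `t`. -/
def cutoff {n : ℕ} (Ω : Set (Evec n)) (t : ℝ) : Evec n → ℝ :=
  cv (dil (t / 4) kerPhi) ((Ω ∩ {x | t < bdist Ω x}).indicator 1)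

lemma cutoffSet_measurable {n : ℕ} {Ω : Set (Evec n)} (hΩ : IsOpen Ω) (t : ℝ) :
    MeasurableSet (Ω ∩ {x | t < bdist Ω x}) :=
  hΩ.measurableSet.inter (measurableSet_lt measurable_const (continuous_bdist Ω).measurable)

lemma cutoffSet_locallyIntegrable {n : ℕ} {Ω : Set (Evec n)} (hΩ : IsOpen Ω) (t : ℝ) :
    LocallyIntegrable ((Ω ∩ {x | t < bdist Ω x}).indicator (1 : Evec n → ℝ)) :=
  (locallyIntegrable_const (1 : ℝ)).indicator (cutoffSet_measurable hΩ t)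

lemma cutoff_contDiff {n : ℕ} {Ω : Set (Evec n)} (hΩ : IsOpen Ω) {t : ℝ} (ht : 0 < t) :
    ContDiff ℝ ∞ (cutoff Ω t) :=
  cv_contDiff (dil_contDiff kerPhi_contDiff _) (hasCompactSupport_of_norm (t / 4) fun _ =>
    dil_eq_zero (fun _ => kerPhi_of_one_le) (by positivity)) (cutoffSet_locallyIntegrable hΩ t)

lemma enorm_cv_le_of_norm_le_one {n : ℕ} (K f : Evec n → ℝ) (hf : ∀ x, ‖f x‖ ≤ 1) (x : Evec n) :
    ‖cv K f x‖ₑ ≤ ∫⁻ y, ‖K y‖ₑ := by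
  refine (enorm_cv_le K f x).trans ?_
  rw [← lintegral_sub_left_eq_self (fun y => ‖K y‖ₑ) x]
  refine lintegral_mono fun y => mul_le_of_le_one_right zero_le ?_
  rw [← ofReal_norm]
  exact ENNReal.ofReal_le_one.2 (hf y)

lemma norm_indicator_one_le {n : ℕ} (S : Set (Evec n)) (x : Evec n) :
    ‖S.indicator (1 : Evec n → ℝ) x‖ ≤ 1 := by
  by_cases hx : x ∈ S
  · simp [hx]
  · simp [hx]

lemma exists_cutoff_bound {n : ℕ} : ∃ C : ℝ≥0∞, C ≠ ⊤ ∧ ∀ (Ω : Set (Evec n)), IsOpen Ω →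
    ∀ t : ℝ, 0 < t → ∀ x, ‖cutoff Ω t x‖ₑ ≤ C ∧ ∀ l, ‖t * pd l (cutoff Ω t) x‖ₑ ≤ C := by
  have hi : Integrable (kerPhi (n := n)) :=
    kerPhi_contDiff.continuous.integrable_of_hasCompactSupport kerPhi_hasCompactSupport
  have hi' : ∀ l : Fin n, Integrable (pd l (kerPhi (n := n))) := fun l =>
    (pd_contDiff kerPhi_contDiff l).continuous.integrable_of_hasCompactSupport
      (pd_hasCompactSupport kerPhi_hasCompactSupport l)
  have hfin : ∑ l : Fin n, ∫⁻ y, ‖pd l (kerPhi (n := n)) y‖ₑ ≠ ⊤ :=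
    (ENNReal.sum_lt_top.2 fun l _ => (hi' l).2).ne
  refine ⟨(∫⁻ y, ‖kerPhi (n := n) y‖ₑ) + ‖(4 : ℝ)‖ₑ * ∑ l : Fin n, ∫⁻ y, ‖pd l (kerPhi (n := n)) y‖ₑ,
    ENNReal.add_ne_top.2 ⟨hi.2.ne, ENNReal.mul_ne_top enorm_ne_top hfin⟩,
    fun Ω hΩ t ht x => ⟨?_, fun l => ?_⟩⟩
  · refine le_add_right ?_
    rw [← lintegral_dil hi (s := t / 4) (by positivity)]
    exact enorm_cv_le_of_norm_le_one _ _ (norm_indicator_one_le _) x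
  · refine le_add_left ?_
    have ht4 : 0 < t / 4 := by positivity
    have hd : Differentiable ℝ (kerPhi (n := n)) := kerPhi_contDiff.differentiable (by simp)
    have e : t * pd l (cutoff Ω t) x = 4 * cv (dil (t / 4) (pd l kerPhi))
        ((Ω ∩ {x | t < bdist Ω x}).indicator 1) x := by
      rw [cutoff, pd_cv (dil_contDiff kerPhi_contDiff _) (hasCompactSupport_of_norm (t / 4) fun _ =>
        dil_eq_zero (fun _ => kerPhi_of_one_le) ht4) (cutoffSet_locallyIntegrable hΩ t)]
      rw [show pd l (dil (t / 4) (kerPhi (n := n))) = fun x => (t / 4)⁻¹ * dil (t / 4) (pd l kerPhi) x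
        from funext fun x => pd_dil hd _ l x, cv_kernel_const_mul]
      field_simp
    rw [e, enorm_mul]
    refine mul_le_mul' le_rfl ((enorm_cv_le_of_norm_le_one _ _ (norm_indicator_one_le _) x).trans ?_)
    rw [lintegral_dil (hi' l) ht4]
    exact Finset.single_le_sum (f := fun l => ∫⁻ y, ‖pd l (kerPhi (n := n)) y‖ₑ)
      (fun _ _ => zero_le) (Finset.mem_univ l)

lemma cutoff_eq_zero {n : ℕ} {Ω : Set (Evec n)} {t : ℝ} (ht : 0 < t) {x : Evec n}
    (hx : bdist Ω x < 3 / 4 * t) : cutoff Ω t x = 0 := by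
  rw [cutoff, ← cv_indicator (r := t / 4) (S := Metric.closedBall x (t / 4))
    (fun y hy => dil_eq_zero (fun _ => kerPhi_of_one_le) (by positivity) hy.le) _ subset_rfl]
  rw [cv]
  refine integral_eq_zero_of_ae (Eventually.of_forall fun y => ?_)
  have : (Metric.closedBall x (t / 4)).indicator
      ((Ω ∩ {x | t < bdist Ω x}).indicator (1 : Evec n → ℝ)) y = 0 := by
    rw [indicator_indicator]
    refine indicator_of_notMem (fun h => ?_) _
    have h1 := bdist_le_add_dist Ω y x
    have h2 := Metric.mem_closedBall.1 h.1
    have h3 : t < bdist Ω y := h.2.2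
    linarith
  simp only [this, zero_mul, Pi.zero_apply]

lemma cutoff_eq_one {n : ℕ} (hn : 0 < n) {Ω : Set (Evec n)} (hΩ : IsOpen Ω) {t : ℝ} (ht : 0 < t) {x : Evec n}
    (hxΩ : x ∈ Ω) (hx : 5 / 4 * t < bdist Ω x) : cutoff Ω t x = 1 := by
  have ht4 : 0 < t / 4 := by positivity
  have hsub : Metric.closedBall x (t / 4) ⊆ Ω ∩ {x | t < bdist Ω x} := by
    refine fun y hy => ⟨closedBall_subset_of_lt_bdist hΩ hxΩ ht4.le (by linarith) hy, ?_⟩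
    have h1 := bdist_le_add_dist Ω x y
    have h2 := Metric.mem_closedBall'.1 hy
    rw [mem_ofPred_eq]
    linarith
  rw [cutoff, cv_indicator (r := t / 4)
    (fun y hy => dil_eq_zero (fun _ => kerPhi_of_one_le) ht4 hy.le) _ hsub, cv]
  simp only [Pi.one_apply, one_mul]
  rw [integral_sub_left_eq_self (fun y => dil (t / 4) kerPhi y), integral_dil _ ht4,
    integral_kerPhi hn]

lemma cutoff_of_bdist_lt {n : ℕ} {Ω : Set (Evec n)} {t : ℝ}
    (h : ∀ x ∈ Ω, bdist Ω x < t) : cutoff Ω t = 0 := by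
  have : Ω ∩ {x | t < bdist Ω x} = ∅ :=
    eq_empty_of_forall_notMem fun x hx => lt_asymm (h x hx.1) hx.2
  ext x
  simp [cutoff, cv, this]

/-- The layer of `Ω` at distance comparable to `t` from the boundary. -/
def layer {n : ℕ} (Ω : Set (Evec n)) (a b : ℝ) : Set (Evec n) :=
  Ω ∩ {x | a ≤ bdist Ω x ∧ bdist Ω x ≤ b}

lemma layer_measurable {n : ℕ} {Ω : Set (Evec n)} (hΩ : IsOpen Ω) (a b : ℝ) :
    MeasurableSet (layer Ω a b) :=
  hΩ.measurableSet.inter ((measurableSet_le measurable_const (continuous_bdist Ω).measurable).inter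
    (measurableSet_le (continuous_bdist Ω).measurable measurable_const))

lemma closedBall_subset_layer {n : ℕ} {Ω : Set (Evec n)} (hΩ : IsOpen Ω) {a b t : ℝ} (ht : 0 ≤ t) (hta : t < a)
    {x : Evec n} (hx : x ∈ layer Ω a b) :
    Metric.closedBall x t ⊆ layer Ω (a - t) (b + t) := by
  intro y hy
  have h1 := bdist_le_add_dist Ω x y
  have h2 := bdist_le_add_dist Ω y x
  have h3 := Metric.mem_closedBall.1 hy
  rw [dist_comm] at h1
  exact ⟨closedBall_subset_of_lt_bdist hΩ hx.1 ht (hta.trans_le hx.2.1) hy, by linarith [hx.2.1],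
    by linarith [hx.2.2]⟩

lemma card_filter_layer_le {n : ℕ} {Ω : Set (Evec n)} {R : ℝ} (hR : 0 < R) {x : Evec n}
    (hx : 0 < bdist Ω x) (s : Finset ℕ) [DecidablePred fun k => x ∈ layer Ω (R * (1 / 2) ^ k / 4) (R * (1 / 2) ^ k * 2)] :
    (s.filter fun k => x ∈ layer Ω (R * (1 / 2) ^ k / 4) (R * (1 / 2) ^ k * 2)).card ≤ 4 := by
  rcases (s.filter fun k => x ∈ layer Ω (R * (1 / 2) ^ k / 4)
    (R * (1 / 2) ^ k * 2)).eq_empty_or_nonempty with h | h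
  · simp [h]
  obtain ⟨m, hm, hmin⟩ := Finset.exists_min_image _ id h
  have hm2 := (Finset.mem_filter.1 hm).2.2.1
  refine (Finset.card_le_card (t := Finset.Icc m (m + 3)) fun k hk => ?_).trans
    (by rw [Nat.card_Icc]; omega)
  have hk2 := (Finset.mem_filter.1 hk).2.2.2
  have hmk : m ≤ k := hmin k hk
  refine Finset.mem_Icc.2 ⟨hmk, ?_⟩
  by_contra hcon
  have h4 : ((1 : ℝ) / 2) ^ k ≤ (1 / 2) ^ (m + 4) :=
    pow_le_pow_of_le_one (by norm_num) (by norm_num) (by omega)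
  rw [pow_add] at h4
  have h5 : R * (1 / 2) ^ k ≤ R * (1 / 2) ^ m / 16 := by
    refine (mul_le_mul_of_nonneg_left h4 hR.le).trans_eq ?_
    ring
  linarith

/-- The partition of unity of `Ω` into layers. -/
def layerFn {n : ℕ} (Ω : Set (Evec n)) (R : ℝ) (k : ℕ) (x : Evec n) : ℝ :=
  cutoff Ω (R * (1 / 2) ^ (k + 1)) x - cutoff Ω (R * (1 / 2) ^ k) x

lemma layerFn_contDiff {n : ℕ} {Ω : Set (Evec n)} (hΩ : IsOpen Ω) {R : ℝ} (hR : 0 < R) (k : ℕ) :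
    ContDiff ℝ ∞ (layerFn Ω R k) :=
  (cutoff_contDiff hΩ (by positivity)).sub (cutoff_contDiff hΩ (by positivity))

lemma pd_layerFn {n : ℕ} {Ω : Set (Evec n)} (hΩ : IsOpen Ω) {R : ℝ} (hR : 0 < R) (k : ℕ)
    (l : Fin n) (x : Evec n) : pd l (layerFn Ω R k) x =
      pd l (cutoff Ω (R * (1 / 2) ^ (k + 1))) x - pd l (cutoff Ω (R * (1 / 2) ^ k)) x := by
  have h : ∀ k : ℕ, DifferentiableAt ℝ (cutoff Ω (R * (1 / 2) ^ k)) x := fun k =>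
    (cutoff_contDiff hΩ (by positivity)).differentiable (by simp) x
  simp only [pd]
  rw [show layerFn Ω R k = fun x => cutoff Ω (R * (1 / 2) ^ (k + 1)) x -
    cutoff Ω (R * (1 / 2) ^ k) x from rfl, fderiv_fun_sub (h _) (h _)]
  rfl

lemma exists_layerFn_bound {n : ℕ} : ∃ C : ℝ≥0∞, C ≠ ⊤ ∧ ∀ (Ω : Set (Evec n)), IsOpen Ω →
    ∀ R : ℝ, 0 < R → ∀ k x, ‖layerFn Ω R k x‖ₑ ≤ C ∧
      ∀ l, ‖R * (1 / 2) ^ k * pd l (layerFn Ω R k) x‖ₑ ≤ C := by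
  obtain ⟨C, hC, h⟩ := exists_cutoff_bound (n := n)
  refine ⟨3 * C, by finiteness, fun Ω hΩ R hR k x => ?_⟩
  have h1 := h Ω hΩ (R * (1 / 2) ^ (k + 1)) (by positivity) x
  have h2 := h Ω hΩ (R * (1 / 2) ^ k) (by positivity) x
  refine ⟨?_, fun l => ?_⟩
  · refine enorm_sub_le.trans ((add_le_add h1.1 h2.1).trans ?_)
    rw [← two_mul]
    gcongr
    norm_num
  · rw [pd_layerFn hΩ hR]
    rw [show R * (1 / 2) ^ k * (pd l (cutoff Ω (R * (1 / 2) ^ (k + 1))) x -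
      pd l (cutoff Ω (R * (1 / 2) ^ k)) x) =
      2 * (R * (1 / 2) ^ (k + 1) * pd l (cutoff Ω (R * (1 / 2) ^ (k + 1))) x) -
      R * (1 / 2) ^ k * pd l (cutoff Ω (R * (1 / 2) ^ k)) x by ring]
    refine enorm_sub_le.trans ?_
    rw [enorm_mul, show ‖(2 : ℝ)‖ₑ = 2 by simp [← ofReal_norm]]
    refine (add_le_add (mul_le_mul' le_rfl (h1.2 l)) (h2.2 l)).trans_eq ?_
    ring

lemma layerFn_eventuallyEq_zero {n : ℕ} (hn : 0 < n) {Ω : Set (Evec n)} (hΩ : IsOpen Ω) {R : ℝ}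
    (hR : 0 < R) (k : ℕ) {x : Evec n} (hx : x ∈ Ω)
    (h : x ∉ layer Ω (R * (1 / 2) ^ k * (3 / 8)) (R * (1 / 2) ^ k * (5 / 4))) :
    layerFn Ω R k =ᶠ[𝓝 x] fun _ => 0 := by
  have hk : 0 < R * (1 / 2) ^ k := by positivity
  have hk1 : 0 < R * (1 / 2) ^ (k + 1) := by positivity
  have e : R * (1 / 2) ^ (k + 1) = R * (1 / 2) ^ k / 2 := by ring
  have hor : bdist Ω x < R * (1 / 2) ^ k * (3 / 8) ∨ R * (1 / 2) ^ k * (5 / 4) < bdist Ω x := by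
    by_contra hcon
    push Not at hcon
    exact h ⟨hx, hcon⟩
  have hc := (continuous_bdist Ω).continuousAt (x := x)
  rcases hor with h | h
  · filter_upwards [hc.eventually (gt_mem_nhds h)] with y hy
    rw [layerFn, cutoff_eq_zero hk1 (by linarith), cutoff_eq_zero hk (by linarith), sub_self]
  · filter_upwards [hc.eventually (lt_mem_nhds h), hΩ.mem_nhds hx] with y hy hyΩ
    rw [layerFn, cutoff_eq_one hn hΩ hk1 hyΩ (by linarith), cutoff_eq_one hn hΩ hk hyΩ (by linarith),
      sub_self]

lemma exists_sum_layerFn_eq_one {n : ℕ} (hn : 0 < n) {Ω : Set (Evec n)} (hΩ : IsBoundedDomain Ω)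
    {R : ℝ} (hR : 0 < R) (hRΩ : ∀ x ∈ Ω, bdist Ω x < R) {x : Evec n} (hx : x ∈ Ω) :
    ∃ N : ℕ, ∀ᶠ y in 𝓝 x, (∀ k ≥ N, layerFn Ω R k y = 0) ∧
      ∑ k ∈ Finset.range N, layerFn Ω R k y = 1 := by
  have hpos := bdist_pos hn hΩ hx
  obtain ⟨N, hN⟩ := exists_pow_lt_of_lt_one (show 0 < bdist Ω x / (2 * R) by positivity)
    (show (1 : ℝ) / 2 < 1 by norm_num)
  have hN' : 5 / 4 * (R * (1 / 2) ^ N) < bdist Ω x := by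
    rw [lt_div_iff₀ (by positivity)] at hN
    nlinarith
  refine ⟨N, ?_⟩
  filter_upwards [(continuous_bdist Ω).continuousAt.eventually (lt_mem_nhds hN'),
    hΩ.1.mem_nhds hx] with y hy hyΩ
  have hone : ∀ k ≥ N, cutoff Ω (R * (1 / 2) ^ k) y = 1 := fun k hk => by
    refine cutoff_eq_one hn hΩ.1 (by positivity) hyΩ (lt_of_le_of_lt ?_ hy)
    have : ((1 : ℝ) / 2) ^ k ≤ (1 / 2) ^ N := pow_le_pow_of_le_one (by norm_num) (by norm_num) hk
    gcongr
  refine ⟨fun k hk => ?_, ?_⟩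
  · rw [layerFn, hone k hk, hone (k + 1) (by omega), sub_self]
  · simp only [layerFn]
    rw [Finset.sum_range_sub (fun k => cutoff Ω (R * (1 / 2) ^ k) y), hone N le_rfl, pow_zero,
      mul_one, cutoff_of_bdist_lt hRΩ]
    simp

lemma sum_indicator_le {α ι : Type*} (L : ι → Set α) (x : α) (u : ℝ≥0∞) (s : Finset ι)
    [DecidablePred fun k => x ∈ L k] {M : ℕ} (h : (s.filter fun k => x ∈ L k).card ≤ M) :
    ∑ k ∈ s, (L k).indicator (fun _ => u) x ≤ M * u := by
  have e : ∑ k ∈ s, (L k).indicator (fun _ => u) x = ∑ k ∈ s.filter fun k => x ∈ L k, u := by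
    rw [Finset.sum_filter]
    refine Finset.sum_congr rfl fun k _ => ?_
    simp [indicator_apply]
  rw [e, Finset.sum_const, nsmul_eq_mul]
  gcongr

lemma enorm_sum_rpow_le {ι : Type*} (s : Finset ι) (b : ι → ℝ) (P : ι → Prop) [DecidablePred P]
    (hb : ∀ k ∈ s, ¬ P k → b k = 0) {M : ℕ} (h : (s.filter P).card ≤ M) {p : ℝ} (hp : 1 < p) :
    ‖∑ k ∈ s, b k‖ₑ ^ p ≤ (M : ℝ≥0∞) ^ (p - 1) * ∑' k, if P k then ‖b k‖ₑ ^ p else 0 := by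
  have e : ∑ k ∈ s, b k = ∑ k ∈ s.filter P, b k :=
    (Finset.sum_filter_of_ne fun k hk hne => by_contra fun hP => hne (hb k hk hP)).symm
  rw [e]
  calc ‖∑ k ∈ s.filter P, b k‖ₑ ^ p ≤ (∑ k ∈ s.filter P, ‖b k‖ₑ) ^ p :=
        ENNReal.rpow_le_rpow (enorm_sum_le _ _) (by linarith)
    _ ≤ ((s.filter P).card : ℝ≥0∞) ^ (p - 1) * ∑ k ∈ s.filter P, ‖b k‖ₑ ^ p :=
        ENNReal.rpow_sum_le_const_mul_sum_rpow _ _ hp.le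
    _ ≤ (M : ℝ≥0∞) ^ (p - 1) * ∑' k, if P k then ‖b k‖ₑ ^ p else 0 := by
        refine mul_le_mul' (ENNReal.rpow_le_rpow (by exact_mod_cast h) (by linarith)) ?_
        refine le_trans (le_of_eq ?_) (ENNReal.sum_le_tsum s)
        rw [Finset.sum_filter]

lemma tsum_energy_layer_le {n : ℕ} (hn : 0 < n) {Ω : Set (Evec n)} (hΩ : IsBoundedDomain Ω) {R : ℝ}
    (hR : 0 < R) {p : ℝ} {e : Fin n → Fin n → Evec n → ℝ}
    (he : ∀ a b, AEStronglyMeasurable (e a b) volume) :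
    ∑' k : ℕ, energy p e (layer Ω (R * (1 / 2) ^ k / 4) (R * (1 / 2) ^ k * 2)) ≤
      4 * energy p e Ω := by
  classical
  obtain ⟨L, hLdef⟩ : ∃ L : ℕ → Set (Evec n),
    L = fun k => layer Ω (R * (1 / 2) ^ k / 4) (R * (1 / 2) ^ k * 2) := ⟨_, rfl⟩
  have hL : ∀ k, MeasurableSet (L k) := fun k => by
    rw [hLdef]; exact layer_measurable hΩ.1 _ _
  have key : ∀ a b, ∑' k : ℕ, ∫⁻ x in L k, ‖e a b x‖ₑ ^ p ≤ 4 * ∫⁻ x in Ω, ‖e a b x‖ₑ ^ p := by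
    intro a b
    have hm : AEMeasurable (fun x => ‖e a b x‖ₑ ^ p) volume := (he a b).enorm.pow_const _
    simp only [← lintegral_indicator (hL _), ← lintegral_indicator hΩ.1.measurableSet]
    rw [← lintegral_tsum fun k => hm.indicator (hL k), ← lintegral_const_mul'' _
      (hm.indicator hΩ.1.measurableSet)]
    refine lintegral_mono fun x => ?_
    by_cases hx : x ∈ Ω
    · rw [indicator_of_mem hx, ENNReal.tsum_eq_iSup_sum]
      refine iSup_le fun s => ?_
      have := sum_indicator_le L x (‖e a b x‖ₑ ^ p) s (M := 4) (by
        simp only [hLdef]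
        exact card_filter_layer_le hR (bdist_pos hn hΩ hx) s)
      exact this
    · have : ∀ k, (L k).indicator (fun x => ‖e a b x‖ₑ ^ p) x = 0 := fun k =>
        indicator_of_notMem (fun h => hx (by rw [hLdef] at h; exact h.1)) _
      simp [this]
  calc ∑' k : ℕ, energy p e (layer Ω (R * (1 / 2) ^ k / 4) (R * (1 / 2) ^ k * 2))
      = ∑ a, ∑ b, ∑' k : ℕ, ∫⁻ x in L k, ‖e a b x‖ₑ ^ p := by
        simp only [energy, hLdef]
        rw [Summable.tsum_finsetSum fun _ _ => ENNReal.summable]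
        refine Finset.sum_congr rfl fun a _ => ?_
        rw [Summable.tsum_finsetSum fun _ _ => ENNReal.summable]
    _ ≤ ∑ a, ∑ b, 4 * ∫⁻ x in Ω, ‖e a b x‖ₑ ^ p :=
        Finset.sum_le_sum fun a _ => Finset.sum_le_sum fun b _ => key a b
    _ = 4 * energy p e Ω := by simp only [energy, Finset.mul_sum]

/-- Mollification of `h` at a scale comparable to the distance to the boundary of `Ω`. -/
def whitneyMollify {n : ℕ} (Ω : Set (Evec n)) (R : ℝ) (h : Evec n → ℝ) (x : Evec n) : ℝ :=
  ∑' k : ℕ, layerFn Ω R k x * cv (dil (R * (1 / 2) ^ k / 8) kerPhi) h x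

lemma exists_whitneyMollify_eventuallyEq {n : ℕ} (hn : 0 < n) {Ω : Set (Evec n)}
    (hΩ : IsBoundedDomain Ω) {R : ℝ} (hR : 0 < R) (hRΩ : ∀ x ∈ Ω, bdist Ω x < R) (h : Evec n → ℝ)
    {x : Evec n} (hx : x ∈ Ω) : ∃ N : ℕ, (whitneyMollify Ω R h =ᶠ[𝓝 x] fun y =>
      ∑ k ∈ Finset.range N, layerFn Ω R k y * cv (dil (R * (1 / 2) ^ k / 8) kerPhi) h y) ∧
      ((fun y => ∑ k ∈ Finset.range N, layerFn Ω R k y) =ᶠ[𝓝 x] fun _ => 1) := by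
  obtain ⟨N, hN⟩ := exists_sum_layerFn_eq_one hn hΩ hR hRΩ hx
  refine ⟨N, ?_, ?_⟩
  · filter_upwards [hN] with y hy
    refine tsum_eq_sum fun k hk => ?_
    rw [hy.1 k (by simpa using hk), zero_mul]
  · filter_upwards [hN] with y hy using hy.2

lemma cv_dil_kerPhi_contDiff {n : ℕ} {h : Evec n → ℝ} (hh : LocallyIntegrable h) {t : ℝ}
    (ht : 0 < t) : ContDiff ℝ ∞ (cv (dil t kerPhi) h) :=
  cv_contDiff (dil_contDiff kerPhi_contDiff _) (hasCompactSupport_of_norm t fun _ =>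
    dil_eq_zero (fun _ => kerPhi_of_one_le) ht) hh

lemma pd_sum {n : ℕ} {ι : Type*} (s : Finset ι) {F : ι → Evec n → ℝ} {x : Evec n}
    (hF : ∀ k, DifferentiableAt ℝ (F k) x) (l : Fin n) :
    pd l (fun y => ∑ k ∈ s, F k y) x = ∑ k ∈ s, pd l (F k) x := by
  simp only [pd]
  rw [fderiv_fun_sum fun k _ => hF k, sum_apply]

lemma pd_mul {n : ℕ} {F G : Evec n → ℝ} {x : Evec n} (hF : DifferentiableAt ℝ F x)
    (hG : DifferentiableAt ℝ G x) (l : Fin n) :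
    pd l (fun y => F y * G y) x = F x * pd l G x + pd l F x * G x := by
  simp only [pd]
  rw [fderiv_fun_mul hF hG]
  simp [mul_comm]

lemma whitneyMollify_differentiableOn {n : ℕ} (hn : 0 < n) {Ω : Set (Evec n)}
    (hΩ : IsBoundedDomain Ω) {R : ℝ} (hR : 0 < R) (hRΩ : ∀ x ∈ Ω, bdist Ω x < R)
    {h : Evec n → ℝ} (hh : LocallyIntegrable h) :
    DifferentiableOn ℝ (whitneyMollify Ω R h) Ω := by
  intro x hx
  obtain ⟨N, hN, -⟩ := exists_whitneyMollify_eventuallyEq hn hΩ hR hRΩ h hx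
  refine (DifferentiableAt.congr_of_eventuallyEq ?_ hN).differentiableWithinAt
  exact DifferentiableAt.fun_sum fun k _ =>
    ((layerFn_contDiff hΩ.1 hR k).differentiable (by simp) x).mul
      ((cv_dil_kerPhi_contDiff hh (by positivity)).differentiable (by simp) x)

lemma layer_inner_subset {n : ℕ} {Ω : Set (Evec n)} {R : ℝ} (hR : 0 < R) (k : ℕ) :
    layer Ω (R * (1 / 2) ^ k * (3 / 8)) (R * (1 / 2) ^ k * (5 / 4)) ⊆
      layer Ω (R * (1 / 2) ^ k / 4) (R * (1 / 2) ^ k * 2) := by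
  have : 0 < R * (1 / 2) ^ k := by positivity
  rintro x ⟨hx, h1, h2⟩
  exact ⟨hx, by linarith, by linarith⟩

lemma card_filter_layer_inner_le {n : ℕ} {Ω : Set (Evec n)} {R : ℝ} (hR : 0 < R) {x : Evec n}
    (hx : 0 < bdist Ω x) (s : Finset ℕ)
    [DecidablePred fun k => x ∈ layer Ω (R * (1 / 2) ^ k * (3 / 8)) (R * (1 / 2) ^ k * (5 / 4))] :
    (s.filter fun k => x ∈ layer Ω (R * (1 / 2) ^ k * (3 / 8)) (R * (1 / 2) ^ k * (5 / 4))).card ≤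
      4 := by
  classical
  refine (Finset.card_le_card fun k hk => ?_).trans (card_filter_layer_le hR hx s)
  rw [Finset.mem_filter] at hk ⊢
  exact ⟨hk.1, layer_inner_subset hR k hk.2⟩

open Classical in
lemma enorm_sub_whitneyMollify_le {n : ℕ} (hn : 0 < n) {Ω : Set (Evec n)}
    (hΩ : IsBoundedDomain Ω) {R : ℝ} (hR : 0 < R) (hRΩ : ∀ x ∈ Ω, bdist Ω x < R) {C : ℝ≥0∞}
    (hC : ∀ k x, ‖layerFn Ω R k x‖ₑ ≤ C) {p : ℝ} (hp : 1 < p) (h : Evec n → ℝ) {x : Evec n}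
    (hx : x ∈ Ω) : ‖h x - whitneyMollify Ω R h x‖ₑ ^ p ≤ 4 ^ (p - 1) * ∑' k : ℕ,
      (layer Ω (R * (1 / 2) ^ k * (3 / 8)) (R * (1 / 2) ^ k * (5 / 4))).indicator
        (fun x => C ^ p * ‖h x - cv (dil (R * (1 / 2) ^ k / 8) kerPhi) h x‖ₑ ^ p) x := by
  have hp0 : 0 ≤ p := by linarith
  obtain ⟨N, hN1, hN2⟩ := exists_whitneyMollify_eventuallyEq hn hΩ hR hRΩ h hx
  have e : h x - whitneyMollify Ω R h x = ∑ k ∈ Finset.range N,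
      layerFn Ω R k x * (h x - cv (dil (R * (1 / 2) ^ k / 8) kerPhi) h x) := by
    simp only [mul_sub, Finset.sum_sub_distrib, ← Finset.sum_mul]
    rw [hN1.eq_of_nhds, hN2.eq_of_nhds, one_mul]
  rw [e]
  refine (enorm_sum_rpow_le (Finset.range N) _
    (fun k => x ∈ layer Ω (R * (1 / 2) ^ k * (3 / 8)) (R * (1 / 2) ^ k * (5 / 4)))
    (fun k _ hk => ?_) (card_filter_layer_inner_le hR (bdist_pos hn hΩ hx) _) hp).trans ?_
  · rw [(layerFn_eventuallyEq_zero hn hΩ.1 hR k hx hk).eq_of_nhds, zero_mul]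
  · refine mul_le_mul' (by simp) (ENNReal.tsum_le_tsum fun k => ?_)
    rw [indicator_apply]
    split_ifs
    · rw [enorm_mul, ENNReal.mul_rpow_of_nonneg _ _ hp0]
      exact mul_le_mul' (ENNReal.rpow_le_rpow (hC k x) hp0) le_rfl
    · exact le_rfl

open Classical in
lemma enorm_bdist_mul_pd_whitneyMollify_le {n : ℕ} (hn : 0 < n) {Ω : Set (Evec n)}
    (hΩ : IsBoundedDomain Ω) {R : ℝ} (hR : 0 < R) (hRΩ : ∀ x ∈ Ω, bdist Ω x < R) {C : ℝ≥0∞}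
    (hC : ∀ k x, ‖layerFn Ω R k x‖ₑ ≤ C)
    (hC' : ∀ k x l, ‖R * (1 / 2) ^ k * pd l (layerFn Ω R k) x‖ₑ ≤ C) {p : ℝ} (hp : 1 < p)
    {h : Evec n → ℝ} (hh : LocallyIntegrable h) (l : Fin n) {x : Evec n}
    (hx : x ∈ Ω) : ‖bdist Ω x * pd l (whitneyMollify Ω R h) x‖ₑ ^ p ≤ 4 ^ (p - 1) * ∑' k : ℕ,
      (layer Ω (R * (1 / 2) ^ k * (3 / 8)) (R * (1 / 2) ^ k * (5 / 4))).indicator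
        (fun x => (16 * C) ^ p * 2 ^ (p - 1) *
          (‖h x - cv (dil (R * (1 / 2) ^ k / 8) kerPhi) h x‖ₑ ^ p +
          ‖R * (1 / 2) ^ k / 8 * pd l (cv (dil (R * (1 / 2) ^ k / 8) kerPhi) h) x‖ₑ ^ p)) x := by
  have hp0 : 0 ≤ p := by linarith
  obtain ⟨N, hN1, hN2⟩ := exists_whitneyMollify_eventuallyEq hn hΩ hR hRΩ h hx
  have hd1 : ∀ k, DifferentiableAt ℝ (layerFn Ω R k) x := fun k =>
    (layerFn_contDiff hΩ.1 hR k).differentiable (by simp) x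
  have hd2 : ∀ k : ℕ, DifferentiableAt ℝ (cv (dil (R * (1 / 2) ^ k / 8) kerPhi) h) x := fun k =>
    (cv_dil_kerPhi_contDiff hh (by positivity)).differentiable (by simp) x
  have h0 : ∑ k ∈ Finset.range N, pd l (layerFn Ω R k) x = 0 := by
    rw [← pd_sum _ hd1, pd, hN2.fderiv_eq]
    simp
  have e : bdist Ω x * pd l (whitneyMollify Ω R h) x = ∑ k ∈ Finset.range N, bdist Ω x *
      (layerFn Ω R k x * pd l (cv (dil (R * (1 / 2) ^ k / 8) kerPhi) h) x -
      pd l (layerFn Ω R k) x * (h x - cv (dil (R * (1 / 2) ^ k / 8) kerPhi) h x)) := by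
    have e1 : pd l (whitneyMollify Ω R h) x = ∑ k ∈ Finset.range N,
        (layerFn Ω R k x * pd l (cv (dil (R * (1 / 2) ^ k / 8) kerPhi) h) x +
        pd l (layerFn Ω R k) x * cv (dil (R * (1 / 2) ^ k / 8) kerPhi) h x) := by
      rw [pd, hN1.fderiv_eq]
      refine (pd_sum _ (fun k => (hd1 k).mul (hd2 k)) l).trans ?_
      exact Finset.sum_congr rfl fun k _ => pd_mul (hd1 k) (hd2 k) l
    rw [← Finset.mul_sum, e1]
    congr 1
    simp only [mul_sub, Finset.sum_sub_distrib, Finset.sum_add_distrib, ← Finset.sum_mul, h0]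
    ring
  rw [e]
  refine (enorm_sum_rpow_le (Finset.range N) _
    (fun k => x ∈ layer Ω (R * (1 / 2) ^ k * (3 / 8)) (R * (1 / 2) ^ k * (5 / 4)))
    (fun k _ hk => ?_) (card_filter_layer_inner_le hR (bdist_pos hn hΩ hx) _) hp).trans ?_
  · have hz := layerFn_eventuallyEq_zero hn hΩ.1 hR k hx hk
    have hz' : pd l (layerFn Ω R k) x = 0 := by
      rw [pd, hz.fderiv_eq]
      simp
    rw [hz.eq_of_nhds, hz', zero_mul, zero_mul, sub_zero, mul_zero]
  · refine mul_le_mul' (by simp) (ENNReal.tsum_le_tsum fun k => ?_)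
    rw [indicator_apply]
    split_ifs with hk
    swap
    · exact le_rfl
    have hρ0 : 0 ≤ bdist Ω x := Metric.infDist_nonneg
    have hρ : bdist Ω x ≤ 2 * (R * (1 / 2) ^ k) := by
      have : 0 < R * (1 / 2) ^ k := by positivity
      linarith [hk.2.2]
    obtain ⟨r, hr⟩ : ∃ r, r = R * (1 / 2) ^ k := ⟨_, rfl⟩
    have hr0 : 0 < r := hr ▸ (by positivity)
    have hCx := hC k x
    have hCx' := hC' k x l
    rw [← hr] at hρ hCx' ⊢
    obtain ⟨F, hF⟩ : ∃ F, F = cv (dil (r / 8) kerPhi) h := ⟨_, rfl⟩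
    rw [← hF]
    rw [mul_assoc]
    calc _ ≤ (16 * C * (‖h x - F x‖ₑ + ‖r / 8 * pd l F x‖ₑ)) ^ p := by
          refine ENNReal.rpow_le_rpow ?_ hp0
          calc ‖bdist Ω x * (layerFn Ω R k x * pd l F x - pd l (layerFn Ω R k) x * (h x - F x))‖ₑ
              ≤ ‖2 * r * (layerFn Ω R k x * pd l F x -
                pd l (layerFn Ω R k) x * (h x - F x))‖ₑ := by
                rw [enorm_mul, enorm_mul]
                refine mul_le_mul' ?_ le_rfl
                rw [Real.enorm_of_nonneg hρ0, Real.enorm_of_nonneg (by positivity)]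
                exact ENNReal.ofReal_le_ofReal hρ
            _ = ‖layerFn Ω R k x * (16 * (r / 8 * pd l F x)) -
                2 * (r * pd l (layerFn Ω R k) x) * (h x - F x)‖ₑ := by
                congr 1
                ring
            _ ≤ C * (16 * ‖r / 8 * pd l F x‖ₑ) + 2 * C * ‖h x - F x‖ₑ := by
                refine enorm_sub_le.trans ?_
                rw [enorm_mul, enorm_mul, enorm_mul (2 * _), enorm_mul (2 : ℝ),
                  show ‖(16 : ℝ)‖ₑ = 16 by simp [← ofReal_norm],
                  show ‖(2 : ℝ)‖ₑ = 2 by simp [← ofReal_norm]]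
                gcongr
            _ ≤ C * (16 * ‖r / 8 * pd l F x‖ₑ) + 16 * C * ‖h x - F x‖ₑ := by
                gcongr
                norm_num
            _ = _ := by ring
      _ ≤ _ := by
          rw [ENNReal.mul_rpow_of_nonneg _ _ hp0]
          exact mul_le_mul' le_rfl (ENNReal.rpow_add_le_mul_rpow_add_rpow _ _ hp.le)

lemma lintegral_le_of_le_tsum_layer {n : ℕ} (hn : 0 < n) {Ω : Set (Evec n)}
    (hΩ : IsBoundedDomain Ω) {R : ℝ} (hR : 0 < R) {p : ℝ} {e : Fin n → Fin n → Evec n → ℝ}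
    (he : ∀ a b, AEStronglyMeasurable (e a b) volume) {H : Evec n → ℝ≥0∞}
    {G : ℕ → Evec n → ℝ≥0∞} {A B : ℝ≥0∞} (hA : A ≠ ⊤) (hG : ∀ k, AEMeasurable (G k))
    (hH : ∀ x ∈ Ω, H x ≤ A * ∑' k : ℕ,
      (layer Ω (R * (1 / 2) ^ k * (3 / 8)) (R * (1 / 2) ^ k * (5 / 4))).indicator (G k) x)
    (hB : ∀ k : ℕ, ∫⁻ x in layer Ω (R * (1 / 2) ^ k * (3 / 8)) (R * (1 / 2) ^ k * (5 / 4)), G k x ≤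
      B * energy p e (layer Ω (R * (1 / 2) ^ k / 4) (R * (1 / 2) ^ k * 2))) :
    ∫⁻ x in Ω, H x ≤ A * (B * (4 * energy p e Ω)) := by
  have hL : ∀ k : ℕ, MeasurableSet (layer Ω (R * (1 / 2) ^ k * (3 / 8)) (R * (1 / 2) ^ k * (5 / 4))) :=
    fun k => layer_measurable hΩ.1 _ _
  calc ∫⁻ x in Ω, H x ≤ ∫⁻ x in Ω, A * ∑' k : ℕ,
        (layer Ω (R * (1 / 2) ^ k * (3 / 8)) (R * (1 / 2) ^ k * (5 / 4))).indicator (G k) x :=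
        setLIntegral_mono' hΩ.1.measurableSet hH
    _ ≤ ∫⁻ x, A * ∑' k : ℕ,
        (layer Ω (R * (1 / 2) ^ k * (3 / 8)) (R * (1 / 2) ^ k * (5 / 4))).indicator (G k) x :=
        setLIntegral_le_lintegral _ _
    _ = A * ∑' k : ℕ,
        ∫⁻ x in layer Ω (R * (1 / 2) ^ k * (3 / 8)) (R * (1 / 2) ^ k * (5 / 4)), G k x := by
        rw [lintegral_const_mul' _ _ hA, lintegral_tsum fun k => (hG k).indicator (hL k)]
        simp only [lintegral_indicator (hL _)]
    _ ≤ A * ∑' k : ℕ, B * energy p e (layer Ω (R * (1 / 2) ^ k / 4) (R * (1 / 2) ^ k * 2)) :=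
        mul_le_mul' le_rfl (ENNReal.tsum_le_tsum hB)
    _ ≤ A * (B * (4 * energy p e Ω)) := by
        rw [ENNReal.tsum_mul_left]
        exact mul_le_mul' le_rfl (mul_le_mul' le_rfl (tsum_energy_layer_le hn hΩ hR he))

/-- A row-curl-free field on a bounded domain is approximated by a field whose weighted gradient is
controlled by the symmetric part. -/
theorem exists_whitney_approximation {n : ℕ} (hn : 0 < n) {Ω : Set (Evec n)}
    (hΩ : IsBoundedDomain Ω) {p : ℝ} (hp : 1 < p) :
    ∃ C : ℝ≥0∞, C ≠ ⊤ ∧ ∀ f : Fin n → Fin n → Evec n → ℝ, RowCurlFree Ω f →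
      (∀ i j, Integrable (f i j)) → (∀ i j, MemLp (f i j) (ENNReal.ofReal p)) → ∀ i j,
      ∃ g : Evec n → ℝ, DifferentiableOn ℝ g Ω ∧
        ∫⁻ x in Ω, ‖f i j x - g x‖ₑ ^ p ≤ C * energy p (symPart f) Ω ∧
        ∀ l, ∫⁻ x in Ω, ‖bdist Ω x * pd l g x‖ₑ ^ p ≤ C * energy p (symPart f) Ω := by
  have hp0 : 0 < p := by linarith
  obtain ⟨R, hR, hRΩ⟩ := exists_bdist_lt hn hΩ
  obtain ⟨K, hK, hψ⟩ := exists_layerFn_bound (n := n)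
  obtain ⟨C₁, hC₁, h₁⟩ := exists_lintegral_sub_cv_dil_le hn hp
  obtain ⟨C₂, hC₂, h₂⟩ := exists_lintegral_pd_cv_dil_le (n := n) hp
  have h4 : (4 : ℝ≥0∞) ^ (p - 1) ≠ ⊤ := ENNReal.rpow_ne_top_of_nonneg (by linarith) (by simp)
  have h16 : (16 * K) ^ p * 2 ^ (p - 1) ≠ ⊤ :=
    ENNReal.mul_ne_top (ENNReal.rpow_ne_top_of_nonneg hp0.le (by finiteness))
      (ENNReal.rpow_ne_top_of_nonneg (by linarith) (by simp))
  refine ⟨4 ^ (p - 1) * (K ^ p * C₁ * 4) + 4 ^ (p - 1) * ((16 * K) ^ p * 2 ^ (p - 1) * (C₁ + C₂) * 4),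
    by finiteness, fun f hf hfi hfp i j => ?_⟩
  have hfl := (hfi i j).locallyIntegrable
  have he : ∀ a b, AEStronglyMeasurable (symPart f a b) volume := fun a b =>
    (symPart_integrable hfi a b).1
  have hr : ∀ k : ℕ, 0 < R * (1 / 2) ^ k := fun k => by positivity
  have hLL : ∀ k : ℕ, ∀ x ∈ layer Ω (R * (1 / 2) ^ k * (3 / 8)) (R * (1 / 2) ^ k * (5 / 4)),
      Metric.closedBall x (R * (1 / 2) ^ k / 8) ⊆
        layer Ω (R * (1 / 2) ^ k / 4) (R * (1 / 2) ^ k * 2) := by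
    intro k x hx
    have hk := hr k
    refine (closedBall_subset_layer hΩ.1 (by linarith) (by linarith) hx).trans ?_
    rintro y ⟨hy, hy1, hy2⟩
    exact ⟨hy, by linarith, by linarith⟩
  have hF : ∀ k : ℕ, ContDiff ℝ ∞ (cv (dil (R * (1 / 2) ^ k / 8) kerPhi) (f i j)) := fun k =>
    cv_dil_kerPhi_contDiff hfl (by have := hr k; positivity)
  have hm : ∀ k : ℕ, AEMeasurable fun x =>
      ‖f i j x - cv (dil (R * (1 / 2) ^ k / 8) kerPhi) (f i j) x‖ₑ ^ p := fun k =>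
    (((hfi i j).1.sub (hF k).continuous.aestronglyMeasurable).enorm).pow_const _
  have hm' : ∀ (k : ℕ) l, Measurable fun x => ‖R * (1 / 2) ^ k / 8 *
      pd l (cv (dil (R * (1 / 2) ^ k / 8) kerPhi) (f i j)) x‖ₑ ^ p := fun k l =>
    ((pd_contDiff (hF k) l).continuous.measurable.const_mul _).enorm.pow_const _
  have hb₁ : ∀ k : ℕ, ∫⁻ x in layer Ω (R * (1 / 2) ^ k * (3 / 8)) (R * (1 / 2) ^ k * (5 / 4)),
      ‖f i j x - cv (dil (R * (1 / 2) ^ k / 8) kerPhi) (f i j) x‖ₑ ^ p ≤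
      C₁ * energy p (symPart f) (layer Ω (R * (1 / 2) ^ k / 4) (R * (1 / 2) ^ k * 2)) := fun k =>
    h₁ Ω _ _ f _ hf hfi hfp (layer_measurable hΩ.1 _ _) (layer_measurable hΩ.1 _ _)
      (by have := hr k; positivity) (hLL k) inter_subset_left i j
  have hb₂ : ∀ (k : ℕ) l, ∫⁻ x in layer Ω (R * (1 / 2) ^ k * (3 / 8)) (R * (1 / 2) ^ k * (5 / 4)),
      ‖R * (1 / 2) ^ k / 8 * pd l (cv (dil (R * (1 / 2) ^ k / 8) kerPhi) (f i j)) x‖ₑ ^ p ≤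
      C₂ * energy p (symPart f) (layer Ω (R * (1 / 2) ^ k / 4) (R * (1 / 2) ^ k * 2)) := fun k l =>
    h₂ Ω _ _ f _ hf hfi hfp (layer_measurable hΩ.1 _ _) (layer_measurable hΩ.1 _ _)
      (by have := hr k; positivity) (hLL k) inter_subset_left i j l
  refine ⟨whitneyMollify Ω R (f i j), whitneyMollify_differentiableOn hn hΩ hR hRΩ hfl, ?_,
    fun l => ?_⟩
  · refine (lintegral_le_of_le_tsum_layer (p := p) hn hΩ hR he (B := K ^ p * C₁) h4
      (fun k => (hm k).const_mul (K ^ p)) (fun x hx => enorm_sub_whitneyMollify_le hn hΩ hR hRΩ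
        (fun k x => (hψ Ω hΩ.1 R hR k x).1) hp (f i j) hx) fun k => ?_).trans ?_
    · rw [lintegral_const_mul'' _ (hm k).restrict, mul_assoc (K ^ p) C₁]
      exact mul_le_mul' le_rfl (hb₁ k)
    · rw [add_mul]
      refine le_add_right (le_of_eq ?_)
      ring
  · refine (lintegral_le_of_le_tsum_layer (p := p) hn hΩ hR he
      (B := (16 * K) ^ p * 2 ^ (p - 1) * (C₁ + C₂)) h4
      (fun k => ((hm k).add (hm' k l).aemeasurable).const_mul ((16 * K) ^ p * 2 ^ (p - 1)))
      (fun x hx => enorm_bdist_mul_pd_whitneyMollify_le hn hΩ hR hRΩ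
        (fun k x => (hψ Ω hΩ.1 R hR k x).1) (fun k x l => (hψ Ω hΩ.1 R hR k x).2 l) hp hfl l hx)
        fun k => ?_).trans ?_
    · simp only [Pi.add_apply]
      rw [lintegral_const_mul' _ _ h16, lintegral_add_left' (hm k).restrict,
        mul_assoc _ (C₁ + C₂), add_mul]
      exact mul_le_mul' le_rfl (add_le_add (hb₁ k) (hb₂ k l))
    · rw [add_mul]
      refine le_add_left (le_of_eq ?_)
      ring

lemma lintegral_rpow_le_measure_mul {α : Type*} [MeasurableSpace α] (μ : Measure α) {h : α → ℝ≥0∞}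
    (hh : AEMeasurable h μ) {p : ℝ} (hp : 1 < p) :
    (∫⁻ x, h x ∂μ) ^ p ≤ μ univ ^ (p - 1) * ∫⁻ x, h x ^ p ∂μ := by
  have hp0 : 0 < p := by linarith
  have hpq := Real.HolderConjugate.conjExponent hp
  have h1 := ENNReal.lintegral_mul_le_Lp_mul_Lq μ hpq hh (aemeasurable_const (b := (1 : ℝ≥0∞)))
  simp only [Pi.mul_apply, mul_one, ENNReal.one_rpow, lintegral_const, one_mul] at h1
  have e : 1 / p.conjExponent * p = p - 1 := by
    have := hpq.inv_add_inv_eq_one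
    field_simp at this ⊢
    linarith
  calc (∫⁻ x, h x ∂μ) ^ p ≤ ((∫⁻ x, h x ^ p ∂μ) ^ (1 / p) * μ univ ^ (1 / p.conjExponent)) ^ p :=
        ENNReal.rpow_le_rpow h1 hp0.le
    _ = μ univ ^ (p - 1) * ∫⁻ x, h x ^ p ∂μ := by
        rw [ENNReal.mul_rpow_of_nonneg _ _ hp0.le, ← ENNReal.rpow_mul, ← ENNReal.rpow_mul, e,
          one_div_mul_cancel hp0.ne', ENNReal.rpow_one, mul_comm]

lemma lintegral_enorm_add_rpow_le {α : Type*} [MeasurableSpace α] (μ : Measure α) {f g : α → ℝ}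
    (hf : AEMeasurable f μ) {p : ℝ} (hp : 1 < p) :
    ∫⁻ x, ‖f x + g x‖ₑ ^ p ∂μ ≤
      2 ^ (p - 1) * ((∫⁻ x, ‖f x‖ₑ ^ p ∂μ) + ∫⁻ x, ‖g x‖ₑ ^ p ∂μ) := by
  have h2 : (2 : ℝ≥0∞) ^ (p - 1) ≠ ⊤ := ENNReal.rpow_ne_top_of_nonneg (by linarith) (by simp)
  rw [← lintegral_add_left' (hf.enorm.pow_const _), ← lintegral_const_mul' _ _ h2]
  refine lintegral_mono fun x => ?_
  exact (ENNReal.rpow_le_rpow (enorm_add_le _ _) (by linarith)).trans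
    (ENNReal.rpow_add_le_mul_rpow_add_rpow _ _ hp.le)

lemma norm_le_sum_abs_apply_single {n : ℕ} (L : Evec n →L[ℝ] ℝ) :
    ‖L‖ ≤ ∑ l, |L (EuclideanSpace.single l 1)| := by
  refine L.opNorm_le_bound (Finset.sum_nonneg fun _ _ => abs_nonneg _) fun x => ?_
  have hx : x = ∑ l, x l • EuclideanSpace.single l (1 : ℝ) := by
    ext i
    simp [Pi.single_apply]
  conv_lhs => rw [hx]
  rw [map_sum, Finset.sum_mul]
  refine (norm_sum_le _ _).trans (Finset.sum_le_sum fun l _ => ?_)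
  rw [map_smul, norm_smul, mul_comm, Real.norm_eq_abs (L _)]
  exact mul_le_mul_of_nonneg_left (PiLp.norm_apply_le x l) (abs_nonneg _)

lemma bdist_nonneg {n : ℕ} (Ω : Set (Evec n)) (x : Evec n) : 0 ≤ bdist Ω x := Metric.infDist_nonneg

lemma ofReal_abs_rpow {p : ℝ} (hp : 0 < p) (t : ℝ) : ENNReal.ofReal (|t| ^ p) = ‖t‖ₑ ^ p := by
  rw [← ENNReal.ofReal_rpow_of_nonneg (abs_nonneg t) hp.le, ← Real.norm_eq_abs, ofReal_norm]

lemma wIp_zero {n : ℕ} (Ω S : Set (Evec n)) {p : ℝ} (hp : 0 < p) (g : Evec n → ℝ) :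
    wIp Ω S p 0 g = ∫⁻ x in S, ‖g x‖ₑ ^ p := by
  simp only [wIp, Real.rpow_zero, mul_one, ofReal_abs_rpow hp]

lemma wIp_self_eq {n : ℕ} (Ω S : Set (Evec n)) {p : ℝ} (hp : 0 < p) (g : Evec n → ℝ) :
    wIp Ω S p p g = ∫⁻ x in S, ‖bdist Ω x * g x‖ₑ ^ p := by
  simp only [wIp]
  refine lintegral_congr fun x => ?_
  rw [← Real.mul_rpow (abs_nonneg _) (bdist_nonneg Ω x), ← ofReal_abs_rpow hp, abs_mul,
    abs_of_nonneg (bdist_nonneg Ω x), mul_comm]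

lemma enorm_rpow_le_sum {ι : Type*} (s : Finset ι) (a : ι → ℝ) {p : ℝ} (hp : 1 < p) {t : ℝ}
    (ht : |t| ≤ ∑ i ∈ s, |a i|) :
    ‖t‖ₑ ^ p ≤ (s.card : ℝ≥0∞) ^ (p - 1) * ∑ i ∈ s, ‖a i‖ₑ ^ p := by
  refine (ENNReal.rpow_le_rpow ?_ (by linarith)).trans
    (ENNReal.rpow_sum_le_const_mul_sum_rpow s (fun i => ‖a i‖ₑ) hp.le)
  have h : ‖t‖ₑ = ENNReal.ofReal |t| := by rw [← Real.norm_eq_abs, ofReal_norm]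
  rw [h]
  refine (ENNReal.ofReal_le_ofReal ht).trans ?_
  rw [ENNReal.ofReal_sum_of_nonneg fun _ _ => abs_nonneg _]
  exact Finset.sum_le_sum fun i _ => by rw [← Real.norm_eq_abs, ofReal_norm]

/-- The Poincaré inequality in terms of the partial derivatives. -/
lemma PoincareIneq.exists_lintegral_sub_le {n : ℕ} {Ω : Set (Evec n)} {p : ℝ}
    (hP : PoincareIneq Ω p 0 p) (hp : 1 < p) : ∃ C : ℝ≥0∞, C ≠ ⊤ ∧
      ∀ (g : Evec n → ℝ) (B : ℝ≥0∞), DifferentiableOn ℝ g Ω → ∫⁻ x in Ω, ‖g x‖ₑ ^ p < ⊤ → B ≠ ⊤ →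
      (∀ l, ∫⁻ x in Ω, ‖bdist Ω x * pd l g x‖ₑ ^ p ≤ B) →
      ∃ c : ℝ, ∫⁻ x in Ω, ‖g x - c‖ₑ ^ p ≤ C * B := by
  obtain ⟨C, -, hC⟩ := hP
  have hp0 : 0 < p := by linarith
  have hn : (n : ℝ≥0∞) ^ (p - 1) ≠ ⊤ := ENNReal.rpow_ne_top_of_nonneg (by linarith) (by simp)
  refine ⟨ENNReal.ofReal C * (n ^ (p - 1) * n), by finiteness, fun g B hg hgp hB hgB => ?_⟩
  have hgrad : wIp Ω Ω p p (gradLen g) ≤ n ^ (p - 1) * n * B := by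
    rw [wIp_self_eq Ω Ω hp0]
    calc ∫⁻ x in Ω, ‖bdist Ω x * gradLen g x‖ₑ ^ p
        ≤ ∫⁻ x in Ω, n ^ (p - 1) * ∑ l, ‖bdist Ω x * pd l g x‖ₑ ^ p := by
          refine lintegral_mono fun x => ?_
          have h := enorm_rpow_le_sum Finset.univ (fun l => bdist Ω x * pd l g x) hp
            (t := bdist Ω x * gradLen g x) ?_
          · rwa [Finset.card_fin] at h
          · simp only [abs_mul, ← Finset.mul_sum]
            rw [gradLen, abs_norm]
            exact mul_le_mul_of_nonneg_left (norm_le_sum_abs_apply_single _) (abs_nonneg _)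
      _ = n ^ (p - 1) * ∑ l, ∫⁻ x in Ω, ‖bdist Ω x * pd l g x‖ₑ ^ p := by
          have hm : ∀ l, Measurable fun x => ‖bdist Ω x * pd l g x‖ₑ ^ p := fun l =>
            ((continuous_bdist Ω).measurable.mul
              (measurable_fderiv_apply_const ℝ g _)).enorm.pow_const _
          rw [lintegral_const_mul' _ _ hn, lintegral_finsetSum _ fun l _ => hm l]
      _ ≤ n ^ (p - 1) * ∑ _l : Fin n, B :=
          mul_le_mul' le_rfl (Finset.sum_le_sum fun l _ => hgB l)
      _ = _ := by simp [mul_assoc]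
  refine ⟨wAvg Ω 0 g, ?_⟩
  have h := hC g ⟨hg, by rwa [wIp_zero Ω Ω hp0], hgrad.trans_lt (by finiteness)⟩
  rw [wIp_zero Ω Ω hp0] at h
  exact (h.trans (mul_le_mul' le_rfl hgrad)).trans_eq (by ring)

/-- A constant is controlled by its distance to a derivative `pd j u` and by `u`. -/
lemma exists_enorm_const_rpow_le {n : ℕ} (hn : 0 < n) {Ω : Set (Evec n)} (hΩ : IsBoundedDomain Ω)
    {p : ℝ} (hp : 1 < p) : ∃ C : ℝ≥0∞, C ≠ ⊤ ∧ ∀ (u : Evec n → ℝ) (j : Fin n) (c : ℝ),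
      DifferentiableOn ℝ u Ω → IntegrableOn u Ω → IntegrableOn (pd j u) Ω →
      ‖c‖ₑ ^ p ≤ C * ((∫⁻ x in Ω, ‖pd j u x - c‖ₑ ^ p) + ∫⁻ x in Ω, ‖u x‖ₑ ^ p) := by
  have hp0 : 0 < p := by linarith
  have hΩo := hΩ.1
  have hfin : (volume : Measure (Evec n)) Ω ≠ ⊤ := hΩ.2.2.measure_lt_top.ne
  obtain ⟨x₀, hx₀⟩ := hΩ.2.1.nonempty
  obtain ⟨R, hR, hRΩ⟩ := Metric.nhds_basis_closedBall.mem_iff.1 (hΩo.mem_nhds hx₀)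
  set ζ : Evec n → ℝ := fun z => dil R kerPhi (x₀ - z) with hζ
  have hζs : ContDiff ℝ ∞ ζ :=
    (dil_contDiff kerPhi_contDiff R).comp (contDiff_const.sub contDiff_id)
  have hsub : tsupport ζ ⊆ Metric.closedBall x₀ R := by
    refine closure_minimal (fun z hz => ?_) Metric.isClosed_closedBall
    by_contra h
    refine hz (dil_eq_zero (fun _ => kerPhi_of_one_le) hR ?_)
    rw [Metric.mem_closedBall, not_le, dist_comm, dist_eq_norm] at h
    exact h.le
  have hζc : HasCompactSupport ζ :=
    (isCompact_closedBall x₀ R).of_isClosed_subset (isClosed_tsupport _) hsub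
  have hζΩ := hsub.trans hRΩ
  have hζ1 : ∫ z, ζ z = 1 := by
    rw [hζ, integral_sub_left_eq_self (fun y => dil R kerPhi y), integral_dil _ hR,
      integral_kerPhi hn]
  obtain ⟨M, hM⟩ := hζs.continuous.bounded_above_of_compact_support hζc
  choose M' hM' using fun l => (pd_contDiff hζs l).continuous.bounded_above_of_compact_support
    (pd_hasCompactSupport hζc l)
  set N : ℝ := |M| + ∑ l, |M' l| with hN
  have hN1 : ∀ x, ‖ζ x‖ ≤ N := fun x => (hM x).trans ((le_abs_self M).trans
    (le_add_of_nonneg_right (Finset.sum_nonneg fun _ _ => abs_nonneg _)))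
  have hN2 : ∀ l x, ‖pd l ζ x‖ ≤ N := fun l x => (hM' l x).trans ((le_abs_self _).trans
    ((Finset.single_le_sum (f := fun l => |M' l|) (fun _ _ => abs_nonneg _)
      (Finset.mem_univ l)).trans (le_add_of_nonneg_left (abs_nonneg _))))
  have key : ∀ w E : Evec n → ℝ, (∀ x, ‖E x‖ ≤ N) →
      ‖∫ x, Ω.indicator w x * E x‖ₑ ≤ ENNReal.ofReal N * ∫⁻ x in Ω, ‖w x‖ₑ := by
    intro w E hE
    refine (enorm_integral_le_lintegral_enorm _).trans ?_
    rw [← lintegral_indicator hΩo.measurableSet, ← lintegral_const_mul' _ _ (by finiteness)]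
    refine lintegral_mono fun x => ?_
    rw [enorm_mul, mul_comm, enorm_indicator_eq_indicator_enorm]
    refine mul_le_mul' ?_ le_rfl
    rw [← ofReal_norm]
    exact ENNReal.ofReal_le_ofReal (hE x)
  have h2 : (2 : ℝ≥0∞) ^ (p - 1) ≠ ⊤ := ENNReal.rpow_ne_top_of_nonneg (by linarith) (by simp)
  have hv : (volume : Measure (Evec n)) Ω ^ (p - 1) ≠ ⊤ :=
    ENNReal.rpow_ne_top_of_nonneg (by linarith) hfin
  have hNp : ENNReal.ofReal N ^ p ≠ ⊤ := ENNReal.rpow_ne_top_of_nonneg hp0.le (by simp)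
  refine ⟨ENNReal.ofReal N ^ p * (2 ^ (p - 1) * volume Ω ^ (p - 1)), by finiteness,
    fun u j c hu hui hpu => ?_⟩
  have hci : IntegrableOn (fun x => pd j u x - c) Ω := hpu.sub (integrableOn_const hfin)
  have hdec : c = -(∫ x, Ω.indicator u x * pd j ζ x) -
      ∫ x, Ω.indicator (fun x => pd j u x - c) x * ζ x := by
    rw [← integral_indicator_pd_mul hΩo hu hui j hpu hζs hζc hζΩ, ← integral_sub]
    · have e : (fun x => Ω.indicator (pd j u) x * ζ x -
          Ω.indicator (fun x => pd j u x - c) x * ζ x) = fun x => c * ζ x := by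
        ext x
        by_cases hx : x ∈ Ω
        · simp only [indicator_of_mem hx]
          ring
        · simp [image_eq_zero_of_notMem_tsupport fun h => hx (hζΩ h)]
      rw [e, integral_const_mul, hζ1, mul_one]
    · exact (hpu.integrable_indicator hΩo.measurableSet).mul_bdd
        hζs.continuous.aestronglyMeasurable (Eventually.of_forall hN1)
    · exact (hci.integrable_indicator hΩo.measurableSet).mul_bdd
        hζs.continuous.aestronglyMeasurable (Eventually.of_forall hN1)
  have h1 : ‖c‖ₑ ≤ ENNReal.ofReal N *
      ((∫⁻ x in Ω, ‖pd j u x - c‖ₑ) + ∫⁻ x in Ω, ‖u x‖ₑ) := by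
    conv_lhs => rw [hdec]
    refine enorm_sub_le.trans ?_
    rw [enorm_neg, mul_add, add_comm]
    exact add_le_add (key _ _ hN1) (key _ _ (hN2 j))
  have hm1 := lintegral_rpow_le_measure_mul (volume.restrict Ω) hci.1.enorm hp
  have hm2 := lintegral_rpow_le_measure_mul (volume.restrict Ω) hui.1.enorm hp
  rw [Measure.restrict_apply_univ] at hm1 hm2
  calc ‖c‖ₑ ^ p ≤ (ENNReal.ofReal N *
      ((∫⁻ x in Ω, ‖pd j u x - c‖ₑ) + ∫⁻ x in Ω, ‖u x‖ₑ)) ^ p := ENNReal.rpow_le_rpow h1 hp0.le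
    _ = ENNReal.ofReal N ^ p * ((∫⁻ x in Ω, ‖pd j u x - c‖ₑ) + ∫⁻ x in Ω, ‖u x‖ₑ) ^ p :=
        ENNReal.mul_rpow_of_nonneg _ _ hp0.le
    _ ≤ ENNReal.ofReal N ^ p * (2 ^ (p - 1) *
        ((∫⁻ x in Ω, ‖pd j u x - c‖ₑ) ^ p + (∫⁻ x in Ω, ‖u x‖ₑ) ^ p)) :=
        mul_le_mul' le_rfl (ENNReal.rpow_add_le_mul_rpow_add_rpow _ _ hp.le)
    _ ≤ ENNReal.ofReal N ^ p * (2 ^ (p - 1) *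
        (volume Ω ^ (p - 1) * (∫⁻ x in Ω, ‖pd j u x - c‖ₑ ^ p) +
          volume Ω ^ (p - 1) * ∫⁻ x in Ω, ‖u x‖ₑ ^ p)) :=
        mul_le_mul' le_rfl (mul_le_mul' le_rfl (add_le_add hm1 hm2))
    _ = _ := by ring

lemma memLp_of_lintegral_lt_top {α : Type*} [MeasurableSpace α] {μ : Measure α} {h : α → ℝ}
    (hh : AEStronglyMeasurable h μ) {p : ℝ} (hp : 0 < p) (hlt : ∫⁻ x, ‖h x‖ₑ ^ p ∂μ < ⊤) :
    MemLp h (ENNReal.ofReal p) μ := by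
  refine ⟨hh, ?_⟩
  rw [eLpNorm_eq_lintegral_rpow_enorm_toReal (by simpa using hp) (by simp),
    ENNReal.toReal_ofReal hp.le]
  exact ENNReal.rpow_lt_top_of_nonneg (by positivity) hlt.ne

lemma energy_symPart_indicator {n : ℕ} {Ω : Set (Evec n)} (hΩ : MeasurableSet Ω) (p : ℝ)
    (f : Fin n → Fin n → Evec n → ℝ) :
    energy p (symPart fun i j => Ω.indicator (f i j)) Ω = energy p (symPart f) Ω := by
  refine Finset.sum_congr rfl fun i _ => Finset.sum_congr rfl fun j _ =>
    setLIntegral_congr_fun hΩ fun x hx => ?_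
  simp only [symPart, indicator_of_mem hx]

/-- Korn's inequality for a single partial derivative. -/
lemma PoincareIneq.exists_lintegral_pd_le {n : ℕ} (hn : 0 < n) {Ω : Set (Evec n)} {p : ℝ}
    (hΩ : IsBoundedDomain Ω) (hp : 1 < p) (hP : PoincareIneq Ω p 0 p) :
    ∃ C : ℝ≥0∞, C ≠ ⊤ ∧ ∀ v : Fin n → Evec n → ℝ, (∀ i, DifferentiableOn ℝ (v i) Ω) →
      (∀ i, ∫⁻ x in Ω, ‖v i x‖ₑ ^ p < ⊤) → (∀ i j, ∫⁻ x in Ω, ‖pd j (v i) x‖ₑ ^ p < ⊤) →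
      ∀ i j, ∫⁻ x in Ω, ‖pd j (v i) x‖ₑ ^ p ≤
        C * (energy p (symPart fun i j => pd j (v i)) Ω + ∫⁻ x in Ω, ‖v i x‖ₑ ^ p) := by
  have hp0 : 0 < p := by linarith
  have hΩm := hΩ.1.measurableSet
  have hfin : (volume : Measure (Evec n)) Ω ≠ ⊤ := hΩ.2.2.measure_lt_top.ne
  have : IsFiniteMeasure ((volume : Measure (Evec n)).restrict Ω) :=
    isFiniteMeasure_restrict.2 hfin
  obtain ⟨A, hA, hW⟩ := exists_whitney_approximation hn hΩ hp
  obtain ⟨B, hB, hPC⟩ := hP.exists_lintegral_sub_le hp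
  obtain ⟨D, hD, hcD⟩ := exists_enorm_const_rpow_le hn hΩ hp
  have h2 : (2 : ℝ≥0∞) ^ (p - 1) ≠ ⊤ := ENNReal.rpow_ne_top_of_nonneg (by linarith) (by simp)
  set T : ℝ≥0∞ := 2 ^ (p - 1) with hT
  refine ⟨T * ((1 + D * volume Ω) * (T * (A + B * A)) + D * volume Ω),
    by finiteness, fun v hv hvp hpv i j => ?_⟩
  have hvm : ∀ i, AEStronglyMeasurable (v i) (volume.restrict Ω) := fun i =>
    (hv i).continuousOn.aestronglyMeasurable hΩm
  have hpm : ∀ i j, Measurable (pd j (v i)) := fun i j =>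
    measurable_fderiv_apply_const ℝ (v i) _
  have h1p : 1 ≤ ENNReal.ofReal p := by simpa using hp.le
  have hpL : ∀ i j, MemLp (pd j (v i)) (ENNReal.ofReal p) (volume.restrict Ω) := fun i j =>
    memLp_of_lintegral_lt_top (hpm i j).aestronglyMeasurable hp0 (hpv i j)
  have hvi : ∀ i, IntegrableOn (v i) Ω := fun i =>
    (memLp_of_lintegral_lt_top (hvm i) hp0 (hvp i)).integrable h1p
  have hpi : ∀ i j, IntegrableOn (pd j (v i)) Ω := fun i j => (hpL i j).integrable h1p
  set E := energy p (symPart fun i j => pd j (v i)) Ω with hE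
  obtain ⟨g, hg, hfg, hgE⟩ := hW _ (rowCurlFree_of_grad hΩ.1 hv hvi hpi)
    (fun i j => (hpi i j).integrable_indicator hΩm)
    (fun i j => (memLp_indicator_iff_restrict hΩm).2 (hpL i j)) i j
  rw [energy_symPart_indicator hΩm] at hfg
  simp only [energy_symPart_indicator hΩm] at hgE
  have hfg' : ∫⁻ x in Ω, ‖pd j (v i) x - g x‖ₑ ^ p ≤ A * E := by
    refine le_of_eq_of_le (setLIntegral_congr_fun hΩm fun x hx => ?_) hfg
    simp only [indicator_of_mem hx]
  have hEfin : E ≠ ⊤ := by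
    refine ENNReal.sum_ne_top.2 fun a _ => ENNReal.sum_ne_top.2 fun b _ => ne_of_lt ?_
    have hs : MemLp (symPart (fun i j => pd j (v i)) a b) (ENNReal.ofReal p)
        (volume.restrict Ω) := by
      have h : symPart (fun i j => pd j (v i)) a b =
          fun x => (2 : ℝ)⁻¹ * (pd b (v a) + pd a (v b)) x := by
        ext x
        simp only [symPart, Pi.add_apply]
        ring
      rw [h]
      exact ((hpL a b).add (hpL b a)).const_mul _
    have := lintegral_rpow_enorm_lt_top_of_eLpNorm_lt_top (by simpa using hp0) (by simp) hs.2
    rwa [ENNReal.toReal_ofReal hp0.le] at this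
  have hgm : AEMeasurable g (volume.restrict Ω) :=
    (hg.continuousOn.aestronglyMeasurable hΩm).aemeasurable
  have hgp : ∫⁻ x in Ω, ‖g x‖ₑ ^ p < ⊤ := by
    have h := lintegral_enorm_add_rpow_le (volume.restrict Ω) (f := fun x => g x - pd j (v i) x)
      (g := pd j (v i)) (hgm.sub (hpm i j).aemeasurable) hp
    simp only [sub_add_cancel, enorm_sub_rev (g _)] at h
    refine h.trans_lt ?_
    have h3 := hpv i j
    have h4 : ∫⁻ x in Ω, ‖pd j (v i) x - g x‖ₑ ^ p < ⊤ := hfg'.trans_lt (by finiteness)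
    exact ENNReal.mul_lt_top (by finiteness) (ENNReal.add_lt_top.2 ⟨h4, h3⟩)
  obtain ⟨c, hc⟩ := hPC g (A * E) hg hgp (by finiteness) hgE
  set V := ∫⁻ x in Ω, ‖v i x‖ₑ ^ p with hV
  have hfc : ∫⁻ x in Ω, ‖pd j (v i) x - c‖ₑ ^ p ≤ T * (A + B * A) * E := by
    have h := lintegral_enorm_add_rpow_le (volume.restrict Ω) (f := fun x => pd j (v i) x - g x)
      (g := fun x => g x - c) ((hpm i j).aemeasurable.sub hgm) hp
    simp only [sub_add_sub_cancel] at h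
    refine h.trans ((mul_le_mul' le_rfl (add_le_add hfg' hc)).trans_eq ?_)
    ring
  have hcc := hcD (v i) j c (hv i) (hvi i) (hpi i j)
  have h := lintegral_enorm_add_rpow_le (volume.restrict Ω) (f := fun x => pd j (v i) x - c)
    (g := fun _ => c) ((hpm i j).aemeasurable.sub aemeasurable_const) hp
  simp only [sub_add_cancel, lintegral_const, Measure.restrict_apply_univ] at h
  calc ∫⁻ x in Ω, ‖pd j (v i) x‖ₑ ^ p
      ≤ T * ((∫⁻ x in Ω, ‖pd j (v i) x - c‖ₑ ^ p) + ‖c‖ₑ ^ p * volume Ω) := h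
    _ ≤ T * (T * (A + B * A) * E + D * (T * (A + B * A) * E + V) * volume Ω) :=
        mul_le_mul' le_rfl (add_le_add hfc (mul_le_mul'
          (hcc.trans (mul_le_mul' le_rfl (add_le_add hfc le_rfl))) le_rfl))
    _ = T * ((1 + D * volume Ω) * (T * (A + B * A))) * E + T * (D * volume Ω) * V := by ring
    _ ≤ T * ((1 + D * volume Ω) * (T * (A + B * A)) + D * volume Ω) * E +
        T * ((1 + D * volume Ω) * (T * (A + B * A)) + D * volume Ω) * V :=
        add_le_add (mul_le_mul' (mul_le_mul' le_rfl le_self_add) le_rfl)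
          (mul_le_mul' (mul_le_mul' le_rfl le_add_self) le_rfl)
    _ = _ := (mul_add _ _ _).symm

lemma pd_apply_eq_pder {n : ℕ} {v : Evec n → Evec n} {x : Evec n} (hv : DifferentiableAt ℝ v x)
    (i j : Fin n) : pd j (fun y => v y i) x = pder v i j x := by
  have h := (EuclideanSpace.proj (𝕜 := ℝ) i).hasFDerivAt.comp x hv.hasFDerivAt
  have h' : HasFDerivAt (fun y => v y i)
      ((EuclideanSpace.proj (𝕜 := ℝ) i).comp (fderiv ℝ v x)) x := h
  rw [pd, h'.fderiv]
  rfl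

lemma sqrt_sum_sq_le {ι : Type*} (s : Finset ι) (a : ι → ℝ) :
    Real.sqrt (∑ i ∈ s, a i ^ 2) ≤ ∑ i ∈ s, |a i| := by
  refine Real.sqrt_le_iff.2 ⟨Finset.sum_nonneg fun _ _ => abs_nonneg _, ?_⟩
  simpa only [sq_abs] using Finset.sum_sq_le_sq_sum_of_nonneg (s := s) (f := fun i => |a i|)
    fun _ _ => abs_nonneg _

lemma abs_le_sqrt_sum_sum_sq {n : ℕ} (a : Fin n → Fin n → ℝ) (i j : Fin n) :
    |a i j| ≤ Real.sqrt (∑ i, ∑ j, a i j ^ 2) := by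
  rw [← Real.sqrt_sq_eq_abs]
  refine Real.sqrt_le_sqrt ?_
  exact (Finset.single_le_sum (f := fun j => a i j ^ 2) (fun _ _ => sq_nonneg _)
    (Finset.mem_univ j)).trans (Finset.single_le_sum (f := fun i => ∑ j, a i j ^ 2)
      (fun _ _ => Finset.sum_nonneg fun _ _ => sq_nonneg _) (Finset.mem_univ i))

lemma enorm_rpow_le_of_abs_le {p : ℝ} (hp : 0 < p) {s t : ℝ} (h : |s| ≤ |t|) :
    ‖s‖ₑ ^ p ≤ ‖t‖ₑ ^ p := by
  rw [← ofReal_abs_rpow hp, ← ofReal_abs_rpow hp]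
  exact ENNReal.ofReal_le_ofReal (Real.rpow_le_rpow (abs_nonneg _) h hp.le)

/-- **Theorem 2.1 + Remark 2.1 (case `a = 0`, `b = p`).** If the bounded domain
`Ω ⊆ ℝⁿ`, `n ≥ 2`, supports the Poincaré inequality
`∫_Ω |u − u_Ω|^p ≤ C ∫_Ω |∇u|^p ρ^p`, then the classical Korn inequality `(K_p)` holds:
`∫_Ω |Dv|^p ≤ C' { ∫_Ω |ε(v)|^p + ∫_Ω |v|^p }` for every `v ∈ W^{1,p}(Ω)ⁿ`. -/
theorem poincare_implies_classical_korn {n : ℕ} (hn : 2 ≤ n) (Ω : Set (Evec n)) (p : ℝ)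
    (hΩ : IsBoundedDomain Ω) (hp : 1 < p) (hP : PoincareIneq Ω p 0 p) :
    ∃ C > 0, ∀ v : Evec n → Evec n, MemW1Vec Ω p 0 0 v →
      wIp Ω Ω p 0 (DvLen v) ≤
        ENNReal.ofReal C * (wIp Ω Ω p 0 (epsLen v) + wIp Ω Ω p 0 (fun x => ‖v x‖)) := by
  have hp0 : 0 < p := by linarith
  have hΩm := hΩ.1.measurableSet
  obtain ⟨A, hA, hK⟩ := hP.exists_lintegral_pd_le (by omega) hΩ hp
  set N : ℝ≥0∞ := ((Finset.univ : Finset (Fin n × Fin n)).card : ℝ≥0∞) with hN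
  have hNt : N ≠ ⊤ := ENNReal.natCast_ne_top _
  have hNp : N ^ (p - 1) ≠ ⊤ := ENNReal.rpow_ne_top_of_nonneg (by linarith) hNt
  have hC : N ^ (p - 1) * (N * (A * (N + 1))) ≠ ⊤ := by finiteness
  refine ⟨(N ^ (p - 1) * (N * (A * (N + 1)))).toReal + 1, by positivity, fun v hv => ?_⟩
  obtain ⟨hvd, hvp, hDv⟩ := hv
  simp only [wIp_zero Ω Ω hp0] at hvp hDv ⊢
  have hva : ∀ x ∈ Ω, DifferentiableAt ℝ v x := fun x hx =>
    (hvd x hx).differentiableAt (hΩ.1.mem_nhds hx)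
  have hci : ∀ i, ∫⁻ x in Ω, ‖v x i‖ₑ ^ p ≤ ∫⁻ x in Ω, ‖‖v x‖‖ₑ ^ p := fun i =>
    lintegral_mono fun x => enorm_rpow_le_of_abs_le hp0 (by
      rw [abs_norm]
      exact PiLp.norm_apply_le (v x) i)
  have hpe : ∀ i j, ∫⁻ x in Ω, ‖pd j (fun y => v y i) x‖ₑ ^ p = ∫⁻ x in Ω, ‖pder v i j x‖ₑ ^ p :=
    fun i j => setLIntegral_congr_fun hΩm fun x hx => by
      simp only [pd_apply_eq_pder (hva x hx)]
  have hpd : ∀ i j, ∫⁻ x in Ω, ‖pder v i j x‖ₑ ^ p ≤ ∫⁻ x in Ω, ‖DvLen v x‖ₑ ^ p := fun i j =>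
    lintegral_mono fun x => enorm_rpow_le_of_abs_le hp0
      ((abs_le_sqrt_sum_sum_sq (fun i j => pder v i j x) i j).trans (le_abs_self _))
  have hE : energy p (symPart fun i j => pd j fun x => v x i) Ω ≤
      N * ∫⁻ x in Ω, ‖epsLen v x‖ₑ ^ p := by
    have h1 : ∀ i j, ∫⁻ x in Ω, ‖symPart (fun i j => pd j fun x => v x i) i j x‖ₑ ^ p ≤
        ∫⁻ x in Ω, ‖epsLen v x‖ₑ ^ p := fun i j =>
      setLIntegral_mono' hΩm fun x hx => enorm_rpow_le_of_abs_le hp0 (by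
        simp only [symPart, pd_apply_eq_pder (hva x hx)]
        exact (abs_le_sqrt_sum_sum_sq (fun i j => (pder v i j x + pder v j i x) / 2) i j).trans
          (le_abs_self _))
    refine (Finset.sum_le_sum fun i _ => Finset.sum_le_sum fun j _ => h1 i j).trans_eq ?_
    simp [hN, mul_assoc]
  have hk := hK (fun i x => v x i)
    (fun i => (EuclideanSpace.proj (𝕜 := ℝ) i).differentiable.comp_differentiableOn hvd)
    (fun i => (hci i).trans_lt hvp) (fun i j => (hpe i j).trans_lt ((hpd i j).trans_lt hDv))
  set X := ∫⁻ x in Ω, ‖epsLen v x‖ₑ ^ p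
  set Y := ∫⁻ x in Ω, ‖‖v x‖‖ₑ ^ p
  have hij : ∀ i j, ∫⁻ x in Ω, ‖pder v i j x‖ₑ ^ p ≤ A * (N + 1) * (X + Y) := by
    intro i j
    rw [← hpe]
    refine (hk i j).trans ?_
    rw [mul_assoc]
    refine mul_le_mul' le_rfl ((add_le_add hE (hci i)).trans ?_)
    calc N * X + Y ≤ (N + 1) * X + (N + 1) * Y :=
          add_le_add (mul_le_mul' le_self_add le_rfl) (le_mul_of_one_le_left' le_add_self)
      _ = _ := (mul_add _ _ _).symm
  have hm : ∀ i j, AEMeasurable (fun x => ‖pder v i j x‖ₑ ^ p) (volume.restrict Ω) := fun i j => by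
    refine AEMeasurable.congr (f := fun x => ‖pd j (fun y => v y i) x‖ₑ ^ p)
      ((measurable_fderiv_apply_const ℝ (fun y => v y i) _).enorm.pow_const _).aemeasurable ?_
    filter_upwards [ae_restrict_mem hΩm] with x hx
    simp only [pd_apply_eq_pder (hva x hx)]
  calc ∫⁻ x in Ω, ‖DvLen v x‖ₑ ^ p
      ≤ ∫⁻ x in Ω, N ^ (p - 1) * ∑ t : Fin n × Fin n, ‖pder v t.1 t.2 x‖ₑ ^ p := by
        refine lintegral_mono fun x => enorm_rpow_le_sum Finset.univ
          (fun t : Fin n × Fin n => pder v t.1 t.2 x) hp ?_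
        rw [DvLen, abs_of_nonneg (Real.sqrt_nonneg _), ← Fintype.sum_prod_type'
          (f := fun i j => pder v i j x ^ 2)]
        exact sqrt_sum_sq_le _ _
    _ = N ^ (p - 1) * ∑ t : Fin n × Fin n, ∫⁻ x in Ω, ‖pder v t.1 t.2 x‖ₑ ^ p := by
        rw [lintegral_const_mul' _ _ hNp, lintegral_finsetSum' _ fun t _ => hm t.1 t.2]
    _ ≤ N ^ (p - 1) * ∑ _t : Fin n × Fin n, A * (N + 1) * (X + Y) :=
        mul_le_mul' le_rfl (Finset.sum_le_sum fun t _ => hij t.1 t.2)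
    _ = N ^ (p - 1) * (N * (A * (N + 1))) * (X + Y) := by
        rw [Finset.sum_const, nsmul_eq_mul]
        ring
    _ ≤ _ := by
        refine mul_le_mul' ?_ le_rfl
        conv_lhs => rw [← ENNReal.ofReal_toReal hC]
        exact ENNReal.ofReal_le_ofReal (by linarith)
end
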